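/- Let n ≥ 2, let A = Mat_{n×n}(ℂ), and let r(v;y₁,y₂) be a non-degenerate unitary solution of the AYBE, holomorphic on {(v,y₁,y₂) : v ≠ 0, y₁ ≠ y₂}, of the form (*), and meromorphic along the diagonal. Let r̄₀(y₁,y₂) = (pr⊗pr)(r₀(y₁,y₂)). If r̄₀ has no infinitesimal symmetries, then for every fixed u ≠ 0 the function (y₁,y₂) ↦ r(u;y₁,y₂) satisfies the quantum Yang–Baxter equation (QYBE). -/

import Mathlib

open Matrix Kronecker Filter Topology Set

noncomputable section

attribute [local instance] Matrix.normedAddCommGroup Matrix.normedSpace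

abbrev Mat (n : ℕ) : Type := Matrix (Fin n) (Fin n) ℂ
abbrev T2 (n : ℕ) : Type := Matrix (Fin n × Fin n) (Fin n × Fin n) ℂ
abbrev T3 (n : ℕ) : Type := Matrix (Fin n × Fin n × Fin n) (Fin n × Fin n × Fin n) ℂ

/-- The embedding `t ↦ t^{12}` of `A ⊗ A` into `A ⊗ A ⊗ A`. -/
def emb12 {n : ℕ} (t : T2 n) : T3 n :=
  Matrix.of fun p q => t (p.1, p.2.1) (q.1, q.2.1) * (if p.2.2 = q.2.2 then 1 else 0)

/-- The embedding `t ↦ t^{13}` of `A ⊗ A` into `A ⊗ A ⊗ A`. -/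
def emb13 {n : ℕ} (t : T2 n) : T3 n :=
  Matrix.of fun p q => t (p.1, p.2.2) (q.1, q.2.2) * (if p.2.1 = q.2.1 then 1 else 0)

/-- The embedding `t ↦ t^{23}` of `A ⊗ A` into `A ⊗ A ⊗ A`. -/
def emb23 {n : ℕ} (t : T2 n) : T3 n :=
  Matrix.of fun p q => t (p.2.1, p.2.2) (q.2.1, q.2.2) * (if p.1 = q.1 then 1 else 0)

/-- The flip `t ↦ t^{21}` on `A ⊗ A`. -/
def tflip {n : ℕ} (t : T2 n) : T2 n :=
  Matrix.of fun p q => t (p.2, p.1) (q.2, q.1)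

/-- The associative Yang–Baxter equation with three spectral parameters. -/
def IsAYBESolution {n : ℕ} (r : ℂ → ℂ → ℂ → T2 n) : Prop :=
  ∀ u v y₁ y₂ y₃ : ℂ, u ≠ 0 → v ≠ 0 → u + v ≠ 0 → y₁ ≠ y₂ → y₁ ≠ y₃ → y₂ ≠ y₃ →
    emb12 (r u y₁ y₂) * emb23 (r (u + v) y₂ y₃) =
      emb13 (r (u + v) y₁ y₃) * emb12 (r (-v) y₁ y₂) + emb23 (r v y₂ y₃) * emb13 (r u y₁ y₃)

/-- Unitarity: `r^{21}(-v; y₂, y₁) = - r(v; y₁, y₂)`. -/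
def IsUnitarySolution {n : ℕ} (r : ℂ → ℂ → ℂ → T2 n) : Prop :=
  ∀ v y₁ y₂ : ℂ, v ≠ 0 → y₁ ≠ y₂ → tflip (r (-v) y₂ y₁) = - r v y₁ y₂

/-- `can : A ⊗ A → End(A)`, `X ⊗ Y ↦ (Z ↦ tr(XZ)·Y)`. -/
def canMap {n : ℕ} (t : T2 n) (Z : Mat n) : Mat n :=
  Matrix.of fun k l => ∑ i, ∑ j, t (i, k) (j, l) * Z j i

/-- Non-degeneracy: on a dense subset of the domain the tensor is invertible under `can`. -/
def IsNonDegenerate {n : ℕ} (r : ℂ → ℂ → ℂ → T2 n) : Prop :=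
  {p : ℂ × ℂ × ℂ | p.1 ≠ 0 ∧ p.2.1 ≠ p.2.2} ⊆
    closure {p : ℂ × ℂ × ℂ | p.1 ≠ 0 ∧ p.2.1 ≠ p.2.2 ∧
      Function.Bijective (canMap (r p.1 p.2.1 p.2.2))}

/-- `r` is holomorphic on `{(v,y₁,y₂) : v ≠ 0, y₁ ≠ y₂}`. -/
def IsHolomorphicOnDomain {n : ℕ} (r : ℂ → ℂ → ℂ → T2 n) : Prop :=
  DifferentiableOn ℂ (fun p : ℂ × ℂ × ℂ => r p.1 p.2.1 p.2.2)
    {p : ℂ × ℂ × ℂ | p.1 ≠ 0 ∧ p.2.1 ≠ p.2.2}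

/-- `r` is of the form (*): `r(v;y₁,y₂) = v⁻¹·1⊗1 + r₀(y₁,y₂) + v·r₁(y₁,y₂) + …`,
with Taylor coefficients `rc k`. -/
def HasLaurentForm {n : ℕ} (r : ℂ → ℂ → ℂ → T2 n) (rc : ℕ → ℂ → ℂ → T2 n) : Prop :=
  ∀ y₁ y₂ : ℂ, y₁ ≠ y₂ → ∃ ε > 0, ∀ v : ℂ, v ≠ 0 → ‖v‖ < ε →
    HasSum (fun k : ℕ => v ^ k • rc k y₁ y₂) (r v y₁ y₂ - v⁻¹ • 1)

/-- `r` is meromorphic along the diagonal. -/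
def IsMeromorphicAlongDiagonal {n : ℕ} (r : ℂ → ℂ → ℂ → T2 n) : Prop :=
  ∀ u : ℂ, u ≠ 0 → ∀ y₁ : ℂ, MeromorphicAt (fun y₂ => r u y₁ y₂) y₁

/-- `pr ⊗ id` on `A ⊗ A`, where `pr X = X - (tr X / n)·1`. -/
def prLeft {n : ℕ} (t : T2 n) : T2 n :=
  Matrix.of fun p q => t p q - if p.1 = q.1 then (∑ m, t (m, p.2) (m, q.2)) / (n : ℂ) else 0

/-- `id ⊗ pr` on `A ⊗ A`. -/
def prRight {n : ℕ} (t : T2 n) : T2 n :=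
  Matrix.of fun p q => t p q - if p.2 = q.2 then (∑ m, t (p.1, m) (q.1, m)) / (n : ℂ) else 0

/-- `pr ⊗ pr` on `A ⊗ A`. -/
def prTensorPr {n : ℕ} (t : T2 n) : T2 n := prLeft (prRight t)

/-- `c` has no infinitesimal symmetries: the only traceless `a` with
`[c(y₁,y₂), a⊗1 + 1⊗a] = 0` for all `y₁ ≠ y₂` is `a = 0`. -/
def HasNoInfinitesimalSymmetry {n : ℕ} (c : ℂ → ℂ → T2 n) : Prop :=
  ∀ a : Mat n, a.trace = 0 →
    (∀ y₁ y₂ : ℂ, y₁ ≠ y₂ →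
      c y₁ y₂ * (a ⊗ₖ (1 : Mat n) + (1 : Mat n) ⊗ₖ a) =
        (a ⊗ₖ (1 : Mat n) + (1 : Mat n) ⊗ₖ a) * c y₁ y₂) → a = 0

/-- The quantum Yang–Baxter equation. -/
def SatisfiesQYBE {n : ℕ} (q : ℂ → ℂ → T2 n) : Prop :=
  ∀ y₁ y₂ y₃ : ℂ, y₁ ≠ y₂ → y₁ ≠ y₃ → y₂ ≠ y₃ →
    emb12 (q y₁ y₂) * emb13 (q y₁ y₃) * emb23 (q y₂ y₃) =
      emb23 (q y₂ y₃) * emb13 (q y₁ y₃) * emb12 (q y₁ y₂)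

/-- The permutation tensor `P = Σ e_{ij} ⊗ e_{ji}`. -/
def Pmat (n : ℕ) : T2 n :=
  ∑ i : Fin n, ∑ j : Fin n,
    Matrix.single i j (1 : ℂ) ⊗ₖ Matrix.single j i (1 : ℂ)

/-! ### Entry formulas for products of embedded tensors -/

theorem mul_12_23 {n : ℕ} (s t : T2 n) (a b c a' b' c' : Fin n) :
    (emb12 s * emb23 t) (a, b, c) (a', b', c') = ∑ m, s (a, b) (a', m) * t (m, c) (b', c') := by
  simp only [Matrix.mul_apply, Fintype.sum_prod_type, emb12, emb23, Matrix.of_apply]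
  simp [Finset.sum_ite_eq, Finset.sum_ite_eq', mul_ite, ite_mul]

theorem mul_23_12 {n : ℕ} (s t : T2 n) (a b c a' b' c' : Fin n) :
    (emb23 t * emb12 s) (a, b, c) (a', b', c') = ∑ m, t (b, c) (m, c') * s (a, m) (a', b') := by
  simp only [Matrix.mul_apply, Fintype.sum_prod_type, emb12, emb23, Matrix.of_apply]
  simp [Finset.sum_ite_eq, Finset.sum_ite_eq', mul_ite, ite_mul]

theorem mul_13_12 {n : ℕ} (s t : T2 n) (a b c a' b' c' : Fin n) :
    (emb13 s * emb12 t) (a, b, c) (a', b', c') = ∑ m, s (a, c) (m, c') * t (m, b) (a', b') := by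
  simp only [Matrix.mul_apply, Fintype.sum_prod_type, emb12, emb13, Matrix.of_apply]
  simp [Finset.sum_ite_eq, Finset.sum_ite_eq', mul_ite, ite_mul]

theorem mul_12_13 {n : ℕ} (s t : T2 n) (a b c a' b' c' : Fin n) :
    (emb12 s * emb13 t) (a, b, c) (a', b', c') = ∑ m, s (a, b) (m, b') * t (m, c) (a', c') := by
  simp only [Matrix.mul_apply, Fintype.sum_prod_type, emb12, emb13, Matrix.of_apply]
  simp [Finset.sum_ite_eq, Finset.sum_ite_eq', mul_ite, ite_mul]

theorem mul_23_13 {n : ℕ} (s t : T2 n) (a b c a' b' c' : Fin n) :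
    (emb23 s * emb13 t) (a, b, c) (a', b', c') = ∑ m, s (b, c) (b', m) * t (a, m) (a', c') := by
  simp only [Matrix.mul_apply, Fintype.sum_prod_type, emb23, emb13, Matrix.of_apply]
  simp [Finset.sum_ite_eq, Finset.sum_ite_eq', mul_ite, ite_mul]

theorem mul_13_23 {n : ℕ} (s t : T2 n) (a b c a' b' c' : Fin n) :
    (emb13 s * emb23 t) (a, b, c) (a', b', c') = ∑ m, s (a, c) (a', m) * t (b, m) (b', c') := by
  simp only [Matrix.mul_apply, Fintype.sum_prod_type, emb23, emb13, Matrix.of_apply]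
  simp [Finset.sum_ite_eq, Finset.sum_ite_eq', mul_ite, ite_mul]

/-! linear structure of the embeddings -/
theorem emb12_add {n : ℕ} (s t : T2 n) : emb12 (s + t) = emb12 s + emb12 t := by
  ext p q; simp only [emb12, Matrix.add_apply, Matrix.of_apply]; ring
theorem emb13_add {n : ℕ} (s t : T2 n) : emb13 (s + t) = emb13 s + emb13 t := by
  ext p q; simp only [emb13, Matrix.add_apply, Matrix.of_apply]; ring
theorem emb23_add {n : ℕ} (s t : T2 n) : emb23 (s + t) = emb23 s + emb23 t := by
  ext p q; simp only [emb23, Matrix.add_apply, Matrix.of_apply]; ring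
theorem emb12_neg {n : ℕ} (s : T2 n) : emb12 (-s) = -emb12 s := by
  ext p q; simp only [emb12, Matrix.neg_apply, Matrix.of_apply]; ring
theorem emb13_neg {n : ℕ} (s : T2 n) : emb13 (-s) = -emb13 s := by
  ext p q; simp only [emb13, Matrix.neg_apply, Matrix.of_apply]; ring
theorem emb23_neg {n : ℕ} (s : T2 n) : emb23 (-s) = -emb23 s := by
  ext p q; simp only [emb23, Matrix.neg_apply, Matrix.of_apply]; ring
theorem emb12_smul {n : ℕ} (c : ℂ) (s : T2 n) : emb12 (c • s) = c • emb12 s := by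
  ext p q; simp only [emb12, Matrix.smul_apply, Matrix.of_apply, smul_eq_mul]; ring
theorem emb13_smul {n : ℕ} (c : ℂ) (s : T2 n) : emb13 (c • s) = c • emb13 s := by
  ext p q; simp only [emb13, Matrix.smul_apply, Matrix.of_apply, smul_eq_mul]; ring
theorem emb23_smul {n : ℕ} (c : ℂ) (s : T2 n) : emb23 (c • s) = c • emb23 s := by
  ext p q; simp only [emb23, Matrix.smul_apply, Matrix.of_apply, smul_eq_mul]; ring
theorem emb12_one {n : ℕ} : emb12 (1 : T2 n) = 1 := by
  ext ⟨a, b, c⟩ ⟨a', b', c'⟩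
  simp only [emb12, Matrix.of_apply, Matrix.one_apply, Prod.mk.injEq]
  by_cases h1 : a = a' <;> by_cases h2 : b = b' <;> by_cases h3 : c = c' <;> simp [h1, h2, h3]
theorem emb13_one {n : ℕ} : emb13 (1 : T2 n) = 1 := by
  ext ⟨a, b, c⟩ ⟨a', b', c'⟩
  simp only [emb13, Matrix.of_apply, Matrix.one_apply, Prod.mk.injEq]
  by_cases h1 : a = a' <;> by_cases h2 : b = b' <;> by_cases h3 : c = c' <;> simp [h1, h2, h3]
theorem emb23_one {n : ℕ} : emb23 (1 : T2 n) = 1 := by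
  ext ⟨a, b, c⟩ ⟨a', b', c'⟩
  simp only [emb23, Matrix.of_apply, Matrix.one_apply, Prod.mk.injEq]
  by_cases h1 : a = a' <;> by_cases h2 : b = b' <;> by_cases h3 : c = c' <;> simp [h1, h2, h3]
theorem emb12_mul {n : ℕ} (s t : T2 n) : emb12 (s * t) = emb12 s * emb12 t := by
  ext ⟨a, b, c⟩ ⟨a', b', c'⟩
  simp only [Matrix.mul_apply, Fintype.sum_prod_type, emb12, Matrix.of_apply]
  by_cases h : c = c'
  · subst h; simp
  · simp [h]

theorem tflip_apply {n : ℕ} (t : T2 n) (a b a' b' : Fin n) :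
    tflip t (a, b) (a', b') = t (b, a) (b', a') := rfl
theorem tflip_tflip {n : ℕ} (t : T2 n) : tflip (tflip t) = t := rfl
theorem tflip_neg {n : ℕ} (t : T2 n) : tflip (-t) = - tflip t := rfl
theorem tflip_mul {n : ℕ} (s t : T2 n) : tflip (s * t) = tflip s * tflip t := by
  ext ⟨a, b⟩ ⟨a', b'⟩
  simp only [tflip_apply, Matrix.mul_apply, Fintype.sum_prod_type]
  rw [Finset.sum_comm]

/-! The standing hypotheses. -/
structure Sol {n : ℕ} (r : ℂ → ℂ → ℂ → T2 n) (rc : ℕ → ℂ → ℂ → T2 n) : Prop where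
  n0 : n ≠ 0
  aybe : IsAYBESolution r
  unit : IsUnitarySolution r
  nd : IsNonDegenerate r
  holo : IsHolomorphicOnDomain r
  form : HasLaurentForm r rc
  mero : IsMeromorphicAlongDiagonal r

variable {n : ℕ} {r : ℂ → ℂ → ℂ → T2 n} {rc : ℕ → ℂ → ℂ → T2 n}

theorem Sol.flip (h : Sol r rc) {v y₁ y₂ : ℂ} (hv : v ≠ 0) (hy : y₁ ≠ y₂) :
    tflip (r v y₁ y₂) = - r (-v) y₂ y₁ := by
  have := h.unit (-v) y₂ y₁ (neg_ne_zero.2 hv) hy.symm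
  rwa [neg_neg] at this

theorem Sol.flip_apply (h : Sol r rc) {v y₁ y₂ : ℂ} (hv : v ≠ 0) (hy : y₁ ≠ y₂)
    (a b a' b' : Fin n) :
    r v y₁ y₂ (a, b) (a', b') = - r (-v) y₂ y₁ (b, a) (b', a') := by
  have := congrFun (congrFun (h.flip hv hy) (b, a)) (b', a')
  simpa [tflip_apply] using this

/-- dual form of the AYBE -/
theorem Sol.dual (h : Sol r rc) {a b y₁ y₂ y₃ : ℂ} (ha : a ≠ 0) (hb : b ≠ 0) (hab : a + b ≠ 0)
    (h12 : y₁ ≠ y₂) (h13 : y₁ ≠ y₃) (h23 : y₂ ≠ y₃) :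
    emb23 (r (a + b) y₂ y₃) * emb12 (r a y₁ y₂) =
      emb13 (r a y₁ y₃) * emb23 (r b y₂ y₃) + emb12 (r (-b) y₁ y₂) * emb13 (r (a + b) y₁ y₃) := by
  have hA := h.aybe (-(a + b)) b y₃ y₂ y₁ (neg_ne_zero.2 hab) hb
    (by simpa using ha) h23.symm h13.symm h12.symm
  have e : -(a + b) + b = -a := by ring
  rw [e] at hA
  ext ⟨i, j, k⟩ ⟨i', j', k'⟩
  have := congrFun (congrFun hA (k, j, i)) (k', j', i')
  simp only [Matrix.add_apply, mul_12_23, mul_13_12, mul_23_13, mul_23_12, mul_13_23, mul_12_13]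
    at this ⊢
  simp only [h.flip_apply (neg_ne_zero.2 hab) h23.symm, h.flip_apply (neg_ne_zero.2 ha) h12.symm,
    h.flip_apply (neg_ne_zero.2 ha) h13.symm, h.flip_apply (neg_ne_zero.2 hb) h23.symm,
    h.flip_apply hb h12.symm, h.flip_apply (neg_ne_zero.2 hab) h13.symm, neg_neg, neg_mul_neg] at this
  exact this

/-- QYBE from scalarity of `r(u) r(-u)`. -/
theorem Sol.qybe_of_scalar (h : Sol r rc) {u : ℂ} (hu : u ≠ 0)
    (hS : ∀ y₁ y₂ : ℂ, y₁ ≠ y₂ → ∃ c : ℂ, r u y₁ y₂ * r (-u) y₁ y₂ = c • 1) :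
    SatisfiesQYBE (fun y₁ y₂ => r u y₁ y₂) := by
  intro y₁ y₂ y₃ h12 h13 h23
  have h2 : u + u ≠ 0 := by simpa [← two_mul] using hu
  have hA := h.aybe u u y₁ y₂ y₃ hu hu h2 h12 h13 h23
  have hB := h.dual hu hu h2 h12 h13 h23
  obtain ⟨c, hc⟩ := hS y₁ y₂ h12
  have hc' : r (-u) y₁ y₂ * r u y₁ y₂ = c • 1 := by
    by_cases hc0 : c = 0
    · obtain ⟨d, hd⟩ := hS y₂ y₁ h12.symm
      have := congrArg tflip hd
      rw [tflip_mul, h.flip hu h12.symm, h.flip (neg_ne_zero.2 hu) h12.symm, neg_neg, neg_mul_neg] at this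
      have hd1 : tflip (d • (1 : T2 n)) = d • 1 := by
        ext ⟨i, j⟩ ⟨i', j'⟩
        simp [tflip_apply, Matrix.one_apply, and_comm]
      rw [hd1] at this
      rw [this]
      have tr1 := congrArg Matrix.trace this
      have tr2 := congrArg Matrix.trace hc
      rw [Matrix.trace_mul_comm, tr2] at tr1
      have hn : (n : ℂ) ≠ 0 := Nat.cast_ne_zero.2 h.n0
      simp [Matrix.trace_smul, Matrix.trace_one, hn, hc0] at tr1
      rw [tr1, hc0]
    · have e : r u y₁ y₂ * (c⁻¹ • r (-u) y₁ y₂) = 1 := by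
        rw [Matrix.mul_smul, hc, smul_smul, inv_mul_cancel₀ hc0, one_smul]
      have := mul_eq_one_comm.1 e
      rw [Matrix.smul_mul] at this
      rw [← this, smul_smul, mul_inv_cancel₀ hc0, one_smul]
  have e1 : emb23 (r u y₂ y₃) * emb13 (r u y₁ y₃) =
      emb12 (r u y₁ y₂) * emb23 (r (u+u) y₂ y₃) - emb13 (r (u+u) y₁ y₃) * emb12 (r (-u) y₁ y₂) := by
    rw [hA]; abel
  have e2 : emb13 (r u y₁ y₃) * emb23 (r u y₂ y₃) =
      emb23 (r (u+u) y₂ y₃) * emb12 (r u y₁ y₂) - emb12 (r (-u) y₁ y₂) * emb13 (r (u+u) y₁ y₃) := by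
    rw [hB]; abel
  show emb12 (r u y₁ y₂) * emb13 (r u y₁ y₃) * emb23 (r u y₂ y₃) =
      emb23 (r u y₂ y₃) * emb13 (r u y₁ y₃) * emb12 (r u y₁ y₂)
  rw [Matrix.mul_assoc, e1, e2, Matrix.mul_sub, Matrix.sub_mul]
  have k1 : emb12 (r u y₁ y₂) * (emb12 (r (-u) y₁ y₂) * emb13 (r (u+u) y₁ y₃)) = c • emb13 (r (u+u) y₁ y₃) := by
    rw [← Matrix.mul_assoc, ← emb12_mul, hc, emb12_smul, emb12_one, Matrix.smul_mul, Matrix.one_mul]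
  have k2 : emb13 (r (u+u) y₁ y₃) * emb12 (r (-u) y₁ y₂) * emb12 (r u y₁ y₂) = c • emb13 (r (u+u) y₁ y₃) := by
    rw [Matrix.mul_assoc, ← emb12_mul, hc', emb12_smul, emb12_one, Matrix.mul_smul, Matrix.mul_one]
  rw [k1, k2, Matrix.mul_assoc]

/-! ### Entrywise analytic facts -/

theorem isOpen_dom : IsOpen {p : ℂ × ℂ × ℂ | p.1 ≠ 0 ∧ p.2.1 ≠ p.2.2} := by
  apply IsOpen.inter
  · exact isOpen_ne_fun continuous_fst continuous_const
  · exact isOpen_ne_fun (by fun_prop) (by fun_prop)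

theorem Sol.diff3 (h : Sol r rc) {p : ℂ × ℂ × ℂ} (hp : p.1 ≠ 0 ∧ p.2.1 ≠ p.2.2)
    (i j : Fin n × Fin n) :
    DifferentiableAt ℂ (fun p : ℂ × ℂ × ℂ => r p.1 p.2.1 p.2.2 i j) p := by
  have h1 : DifferentiableAt ℂ (fun p : ℂ × ℂ × ℂ => r p.1 p.2.1 p.2.2) p :=
    (h.holo p hp).differentiableAt (isOpen_dom.mem_nhds hp)
  have h2 := (differentiableAt_pi.1 h1) i
  exact (differentiableAt_pi.1 h2) j

theorem Sol.mero_entry (h : Sol r rc) {u : ℂ} (hu : u ≠ 0) (y : ℂ) (i j : Fin n × Fin n) :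
    MeromorphicAt (fun z => r u y z i j) y := by
  obtain ⟨N, hN⟩ := h.mero u hu y
  refine ⟨N, ?_⟩
  have e1 := (analyticAt_pi_iff.1 hN) i
  have e2 := (analyticAt_pi_iff.1 e1) j
  exact e2

theorem Sol.hasSum_entry (h : Sol r rc) {y₁ y₂ : ℂ} (hy : y₁ ≠ y₂) (i j : Fin n × Fin n) :
    ∃ ε > 0, ∀ v : ℂ, v ≠ 0 → ‖v‖ < ε →
    HasSum (fun k : ℕ => v ^ k • rc k y₁ y₂ i j) (r v y₁ y₂ i j - v⁻¹ * (1 : T2 n) i j) := by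
  obtain ⟨ε, he, hs⟩ := h.form y₁ y₂ hy
  refine ⟨ε, he, fun v hv hve => ?_⟩
  have h1 := hs v hv hve
  have h2 := Pi.hasSum.1 h1 i
  have h3 := Pi.hasSum.1 h2 j
  exact h3

end

noncomputable section
set_option linter.unusedSimpArgs false
set_option linter.unusedVariables false
variable {n : ℕ} {r : ℂ → ℂ → ℂ → T2 n} {rc : ℕ → ℂ → ℂ → T2 n}

theorem Sol.diff_u (h : Sol r rc) {u y₁ y₂ : ℂ} (hu : u ≠ 0) (hy : y₁ ≠ y₂)
    (i j : Fin n × Fin n) : DifferentiableAt ℂ (fun v => r v y₁ y₂ i j) u :=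
  DifferentiableAt.comp (f := fun v : ℂ => ((v, y₁, y₂) : ℂ × ℂ × ℂ)) u
    (h.diff3 (p := (u, y₁, y₂)) ⟨hu, hy⟩ i j) (by fun_prop)

theorem Sol.diff_1 (h : Sol r rc) {u y₁ y₂ : ℂ} (hu : u ≠ 0) (hy : y₁ ≠ y₂)
    (i j : Fin n × Fin n) : DifferentiableAt ℂ (fun x => r u x y₂ i j) y₁ :=
  DifferentiableAt.comp (f := fun x : ℂ => ((u, x, y₂) : ℂ × ℂ × ℂ)) y₁
    (h.diff3 (p := (u, y₁, y₂)) ⟨hu, hy⟩ i j) (by fun_prop)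

theorem Sol.diff_2 (h : Sol r rc) {u y₁ y₂ : ℂ} (hu : u ≠ 0) (hy : y₁ ≠ y₂)
    (i j : Fin n × Fin n) : DifferentiableAt ℂ (fun x => r u y₁ x i j) y₂ :=
  DifferentiableAt.comp (f := fun x : ℂ => ((u, y₁, x) : ℂ × ℂ × ℂ)) y₂
    (h.diff3 (p := (u, y₁, y₂)) ⟨hu, hy⟩ i j) (by fun_prop)

theorem Sol.cont3 (h : Sol r rc) {p : ℂ × ℂ × ℂ} (hp : p.1 ≠ 0 ∧ p.2.1 ≠ p.2.2) :
    ContinuousAt (fun p : ℂ × ℂ × ℂ => r p.1 p.2.1 p.2.2) p :=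
  continuousAt_pi.2 fun i => continuousAt_pi.2 fun j => (h.diff3 hp i j).continuousAt

theorem Sol.cont_u (h : Sol r rc) {u y₁ y₂ : ℂ} (hu : u ≠ 0) (hy : y₁ ≠ y₂) :
    ContinuousAt (fun v => r v y₁ y₂) u :=
  continuousAt_pi.2 fun i => continuousAt_pi.2 fun j => (h.diff_u hu hy i j).continuousAt
theorem Sol.cont_1 (h : Sol r rc) {u y₁ y₂ : ℂ} (hu : u ≠ 0) (hy : y₁ ≠ y₂) :
    ContinuousAt (fun x => r u x y₂) y₁ :=
  continuousAt_pi.2 fun i => continuousAt_pi.2 fun j => (h.diff_1 hu hy i j).continuousAt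
theorem Sol.cont_2 (h : Sol r rc) {u y₁ y₂ : ℂ} (hu : u ≠ 0) (hy : y₁ ≠ y₂) :
    ContinuousAt (fun x => r u y₁ x) y₂ :=
  continuousAt_pi.2 fun i => continuousAt_pi.2 fun j => (h.diff_2 hu hy i j).continuousAt

/-- the regular part of `r` at `v = 0` -/
def Hh (r : ℂ → ℂ → ℂ → T2 n) (rc : ℕ → ℂ → ℂ → T2 n) (u y₁ y₂ : ℂ) : T2 n :=
  if u = 0 then rc 0 y₁ y₂ else r u y₁ y₂ - u⁻¹ • 1

theorem Hh_zero (y₁ y₂ : ℂ) : Hh r rc 0 y₁ y₂ = rc 0 y₁ y₂ := by simp [Hh]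
theorem Hh_ne {u : ℂ} (hu : u ≠ 0) (y₁ y₂ : ℂ) : Hh r rc u y₁ y₂ = r u y₁ y₂ - u⁻¹ • 1 := by
  simp [Hh, hu]
theorem r_eq_Hh {u : ℂ} (hu : u ≠ 0) (y₁ y₂ : ℂ) : r u y₁ y₂ = u⁻¹ • 1 + Hh r rc u y₁ y₂ := by
  simp [Hh, hu]

theorem Sol.Hh_analytic_zero (h : Sol r rc) {y₁ y₂ : ℂ} (hy : y₁ ≠ y₂) (i j : Fin n × Fin n) :
    AnalyticAt ℂ (fun u => Hh r rc u y₁ y₂ i j) 0 := by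
  obtain ⟨ε, he, hs⟩ := h.hasSum_entry hy i j
  refine ⟨FormalMultilinearSeries.ofScalars ℂ (fun k => rc k y₁ y₂ i j), ?_⟩
  rw [hasFPowerSeriesAt_iff]
  have hb : Metric.ball (0 : ℂ) ε ∈ 𝓝 (0 : ℂ) := Metric.ball_mem_nhds _ he
  filter_upwards [hb] with z hz
  simp only [FormalMultilinearSeries.coeff_ofScalars, zero_add]
  by_cases hz0 : z = 0
  · subst hz0
    rw [Hh_zero]
    have := hasSum_single (f := fun k => (0 : ℂ) ^ k • rc k y₁ y₂ i j) 0
      (fun k hk => by simp [hk])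
    simpa using this
  · have := hs z hz0 (by simpa using hz)
    rw [Hh_ne hz0]
    simpa using this

theorem Sol.Hh_diff (h : Sol r rc) {y₁ y₂ : ℂ} (hy : y₁ ≠ y₂) (i j : Fin n × Fin n) :
    Differentiable ℂ (fun u => Hh r rc u y₁ y₂ i j) := by
  intro u
  by_cases hu : u = 0
  · subst hu; exact (h.Hh_analytic_zero hy i j).differentiableAt
  · have : (fun v => Hh r rc v y₁ y₂ i j) =ᶠ[𝓝 u] fun v => r v y₁ y₂ i j - v⁻¹ * (1 : T2 n) i j := by
      filter_upwards [isOpen_ne.mem_nhds hu] with v hv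
      rw [Hh_ne hv]; simp
    rw [this.differentiableAt_iff]
    exact (h.diff_u hu hy i j).sub ((differentiableAt_inv hu).mul_const _)

theorem Sol.Hh_cont (h : Sol r rc) {y₁ y₂ : ℂ} (hy : y₁ ≠ y₂) :
    Continuous (fun u => Hh r rc u y₁ y₂) :=
  continuous_pi fun i => continuous_pi fun j => (h.Hh_diff hy i j).continuous

theorem Sol.Hh_flip (h : Sol r rc) {y₁ y₂ : ℂ} (hy : y₁ ≠ y₂) (u : ℂ) :
    tflip (Hh r rc u y₁ y₂) = - Hh r rc (-u) y₂ y₁ := by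
  have hc : Continuous (tflip : T2 n → T2 n) := by
    refine continuous_pi fun i => continuous_pi fun j => ?_
    exact (continuous_apply_apply (i.2, i.1) (j.2, j.1))
  have := Continuous.ext_on (dense_compl_singleton (0 : ℂ))
    (hc.comp (h.Hh_cont hy)) ((h.Hh_cont hy.symm).comp continuous_neg).neg (by
      intro v hv
      have hv : v ≠ 0 := hv
      show tflip (Hh r rc v y₁ y₂) = - Hh r rc (-v) y₂ y₁
      rw [Hh_ne hv, Hh_ne (neg_ne_zero.2 hv)]
      have e := h.flip hv hy
      ext ⟨a, b⟩ ⟨a', b'⟩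
      have e' := congrFun (congrFun e (a, b)) (a', b')
      simp only [tflip_apply, Matrix.sub_apply, Matrix.neg_apply, Matrix.smul_apply, smul_eq_mul] at e' ⊢
      rw [e']
      have : (1 : T2 n) (b, a) (b', a') = (1 : T2 n) (a, b) (a', b') := by
        simp [Matrix.one_apply, and_comm]
      rw [this, inv_neg]; ring)
  exact congrFun this u

theorem Sol.r0_flip (h : Sol r rc) {y₁ y₂ : ℂ} (hy : y₁ ≠ y₂) :
    tflip (rc 0 y₁ y₂) = - rc 0 y₂ y₁ := by
  have := h.Hh_flip hy 0
  rwa [neg_zero, Hh_zero, Hh_zero] at this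

theorem Sol.r0_flip_apply (h : Sol r rc) {y₁ y₂ : ℂ} (hy : y₁ ≠ y₂) (a b a' b' : Fin n) :
    rc 0 y₁ y₂ (a, b) (a', b') = - rc 0 y₂ y₁ (b, a) (b', a') := by
  have := congrFun (congrFun (h.r0_flip hy) (b, a)) (b', a')
  simpa [tflip_apply] using this

theorem continuous_emb12 : Continuous (emb12 : T2 n → T3 n) :=
  continuous_pi fun i => continuous_pi fun j =>
    (continuous_apply_apply (i.1, i.2.1) (j.1, j.2.1)).mul continuous_const
theorem continuous_emb13 : Continuous (emb13 : T2 n → T3 n) :=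
  continuous_pi fun i => continuous_pi fun j =>
    (continuous_apply_apply (i.1, i.2.2) (j.1, j.2.2)).mul continuous_const
theorem continuous_emb23 : Continuous (emb23 : T2 n → T3 n) :=
  continuous_pi fun i => continuous_pi fun j =>
    (continuous_apply_apply (i.2.1, i.2.2) (j.2.1, j.2.2)).mul continuous_const
theorem continuous_tflip : Continuous (tflip : T2 n → T2 n) :=
  continuous_pi fun i => continuous_pi fun j =>
    (continuous_apply_apply (i.2, i.1) (j.2, j.1))

/-- derivative in the spectral parameter -/
def drm (r : ℂ → ℂ → ℂ → T2 n) (u y₁ y₂ : ℂ) : T2 n :=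
  Matrix.of fun i j => deriv (fun v => r v y₁ y₂ i j) u

theorem Sol.tendsto_drm (h : Sol r rc) {u y₁ y₂ : ℂ} (hu : u ≠ 0) (hy : y₁ ≠ y₂) :
    Tendsto (fun s : ℂ => s⁻¹ • (r (u + s) y₁ y₂ - r u y₁ y₂)) (𝓝[≠] 0) (𝓝 (drm r u y₁ y₂)) := by
  refine tendsto_pi_nhds.2 fun i => tendsto_pi_nhds.2 fun j => ?_
  have := (h.diff_u hu hy i j).hasDerivAt
  rw [hasDerivAt_iff_tendsto_slope_zero] at this
  exact this

theorem tendsto_neg_punct : Tendsto (fun s : ℂ => -s) (𝓝[≠] 0) (𝓝[≠] 0) := by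
  have := (continuous_neg (G := ℂ)).continuousAt.tendsto (x := 0)
  rw [neg_zero] at this
  refine tendsto_nhdsWithin_iff.2 ⟨this.mono_left nhdsWithin_le_nhds, ?_⟩
  filter_upwards [self_mem_nhdsWithin] with s hs
  simpa using hs

theorem Sol.tendsto_r_add (h : Sol r rc) {u y₁ y₂ : ℂ} (hu : u ≠ 0) (hy : y₁ ≠ y₂) :
    Tendsto (fun s : ℂ => r (u + s) y₁ y₂) (𝓝[≠] 0) (𝓝 (r u y₁ y₂)) := by
  have h1 : Tendsto (fun s : ℂ => u + s) (𝓝[≠] 0) (𝓝 u) := by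
    have : Continuous (fun s : ℂ => u + s) := by fun_prop
    have := this.tendsto 0
    rw [add_zero] at this
    exact this.mono_left nhdsWithin_le_nhds
  exact (h.cont_u hu hy).tendsto.comp h1

theorem Sol.tendsto_Hh (h : Sol r rc) {y₁ y₂ : ℂ} (hy : y₁ ≠ y₂) :
    Tendsto (fun s : ℂ => Hh r rc s y₁ y₂) (𝓝[≠] 0) (𝓝 (rc 0 y₁ y₂)) := by
  have := (h.Hh_cont hy).tendsto 0
  rw [Hh_zero] at this
  exact this.mono_left nhdsWithin_le_nhds

theorem eventually_add_ne {u : ℂ} (hu : u ≠ 0) : ∀ᶠ s : ℂ in 𝓝[≠] 0, s ≠ 0 ∧ u + s ≠ 0 := by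
  have : ∀ᶠ s : ℂ in 𝓝 0, u + s ≠ 0 := by
    have hc : Continuous (fun s : ℂ => u + s) := by fun_prop
    exact hc.continuousAt.eventually_ne (by simpa using hu)
  filter_upwards [self_mem_nhdsWithin, nhdsWithin_le_nhds this] with s h1 h2
  exact ⟨h1, h2⟩

/-- L1 -/
theorem Sol.L1 (h : Sol r rc) {u y₁ y₂ y₃ : ℂ} (hu : u ≠ 0)
    (h12 : y₁ ≠ y₂) (h13 : y₁ ≠ y₃) (h23 : y₂ ≠ y₃) :
    emb12 (r (-u) y₁ y₂) * emb13 (r u y₁ y₃) =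
      emb23 (r u y₂ y₃) * emb12 (rc 0 y₁ y₂) - emb13 (rc 0 y₁ y₃) * emb23 (r u y₂ y₃)
        + emb23 (drm r u y₂ y₃) := by
  have hu' := neg_ne_zero.2 hu
  -- the equation at parameter s
  have key : ∀ᶠ s : ℂ in 𝓝[≠] 0, emb12 (r (-u + s) y₁ y₂) * emb13 (r u y₁ y₃) =
      emb23 (r u y₂ y₃) * emb12 (Hh r rc s y₁ y₂)
       - emb13 (Hh r rc s y₁ y₃) * emb23 (r (u + -s) y₂ y₃)
        + emb23 ((-s)⁻¹ • (r (u + -s) y₂ y₃ - r u y₂ y₃)) := by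
    filter_upwards [eventually_add_ne hu', self_mem_nhdsWithin] with s hs hs0
    have hs0 : s ≠ 0 := hs0
    have hb : u - s ≠ 0 := by
      intro e; apply hs.2; linear_combination -e
    have := h.dual (a := s) (b := u - s) hs0 hb (by simpa using hu) h12 h13 h23
    have e1 : s + (u - s) = u := by ring
    have e2 : -(u - s) = -u + s := by ring
    rw [e1, e2] at this
    have e3 : emb12 (r (-u + s) y₁ y₂) * emb13 (r u y₁ y₃) =
      emb23 (r u y₂ y₃) * emb12 (r s y₁ y₂) - emb13 (r s y₁ y₃) * emb23 (r (u - s) y₂ y₃) := by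
      rw [this]; abel
    rw [e3, r_eq_Hh (r := r) (rc := rc) hs0 y₁ y₂, r_eq_Hh (r := r) (rc := rc) hs0 y₁ y₃, ← sub_eq_add_neg]
    simp only [emb12_add, emb13_add, emb12_smul, emb13_smul, emb12_one, emb13_one, emb23_smul,
      sub_eq_add_neg, emb23_add, emb23_neg, Matrix.mul_add, Matrix.add_mul, Matrix.mul_smul,
      Matrix.smul_mul, Matrix.mul_one, Matrix.one_mul, smul_add, smul_neg, inv_neg, neg_smul, neg_neg]
    abel
  have tneg := tendsto_neg_punct
  have l : Tendsto (fun s : ℂ => emb12 (r (-u + s) y₁ y₂) * emb13 (r u y₁ y₃)) (𝓝[≠] 0)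
      (𝓝 (emb12 (r (-u) y₁ y₂) * emb13 (r u y₁ y₃))) :=
    ((continuous_emb12.tendsto _).comp (h.tendsto_r_add hu' h12)).mul tendsto_const_nhds
  have rr : Tendsto (fun s : ℂ => emb23 (r u y₂ y₃) * emb12 (Hh r rc s y₁ y₂)
       - emb13 (Hh r rc s y₁ y₃) * emb23 (r (u + -s) y₂ y₃)
        + emb23 ((-s)⁻¹ • (r (u + -s) y₂ y₃ - r u y₂ y₃))) (𝓝[≠] 0)
      (𝓝 (emb23 (r u y₂ y₃) * emb12 (rc 0 y₁ y₂) - emb13 (rc 0 y₁ y₃) * emb23 (r u y₂ y₃)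
        + emb23 (drm r u y₂ y₃))) := by
    refine ((tendsto_const_nhds.mul ((continuous_emb12.tendsto _).comp (h.tendsto_Hh h12))).sub
      (((continuous_emb13.tendsto _).comp (h.tendsto_Hh h13)).mul
        ((continuous_emb23.tendsto _).comp ((h.tendsto_r_add hu h23).comp tneg)))).add
       ((continuous_emb23.tendsto _).comp ((h.tendsto_drm hu h23).comp tneg))
  exact tendsto_nhds_unique l (rr.congr' (key.mono fun _ hs => hs.symm))

/-- L2 -/
theorem Sol.L2 (h : Sol r rc) {u y₁ y₂ y₃ : ℂ} (hu : u ≠ 0)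
    (h12 : y₁ ≠ y₂) (h13 : y₁ ≠ y₃) (h23 : y₂ ≠ y₃) :
    emb12 (rc 0 y₁ y₂) * emb13 (r u y₁ y₃) =
      emb23 (r u y₂ y₃) * emb12 (r u y₁ y₂) - emb13 (r u y₁ y₃) * emb23 (rc 0 y₂ y₃)
        + emb13 (drm r u y₁ y₃) := by
  have key : ∀ᶠ s : ℂ in 𝓝[≠] 0, emb12 (Hh r rc s y₁ y₂) * emb13 (r u y₁ y₃) =
      emb23 (r u y₂ y₃) * emb12 (r (u + s) y₁ y₂)
       - emb13 (r (u + s) y₁ y₃) * emb23 (Hh r rc (-s) y₂ y₃)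
        + emb13 (s⁻¹ • (r (u + s) y₁ y₃ - r u y₁ y₃)) := by
    filter_upwards [eventually_add_ne hu, self_mem_nhdsWithin] with s hs hs0
    have hs0 : s ≠ 0 := hs0
    have hs0' : -s ≠ 0 := neg_ne_zero.2 hs0
    have := h.dual (a := u + s) (b := -s) hs.2 hs0' (by simpa using hu) h12 h13 h23
    have e1 : u + s + -s = u := by ring
    rw [e1, neg_neg] at this
    have e3 : emb12 (r s y₁ y₂) * emb13 (r u y₁ y₃) =
      emb23 (r u y₂ y₃) * emb12 (r (u + s) y₁ y₂) - emb13 (r (u + s) y₁ y₃) * emb23 (r (-s) y₂ y₃) := by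
      rw [this]; abel
    rw [r_eq_Hh (r := r) (rc := rc) hs0 y₁ y₂, r_eq_Hh (r := r) (rc := rc) hs0' y₂ y₃] at e3
    simp only [emb12_add, emb13_add, emb12_smul, emb13_smul, emb12_one, emb23_one, emb23_smul,
      sub_eq_add_neg, emb13_neg, emb23_neg, Matrix.mul_neg, emb23_add, Matrix.mul_add, Matrix.add_mul, Matrix.mul_smul,
      Matrix.smul_mul, Matrix.mul_one, Matrix.one_mul, smul_add, smul_neg, inv_neg, neg_smul, neg_neg] at e3 ⊢
    rw [← eq_sub_iff_add_eq'] at e3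
    rw [e3]; abel
  have tneg := tendsto_neg_punct
  have l : Tendsto (fun s : ℂ => emb12 (Hh r rc s y₁ y₂) * emb13 (r u y₁ y₃)) (𝓝[≠] 0)
      (𝓝 (emb12 (rc 0 y₁ y₂) * emb13 (r u y₁ y₃))) :=
    ((continuous_emb12.tendsto _).comp (h.tendsto_Hh h12)).mul tendsto_const_nhds
  have rr : Tendsto (fun s : ℂ => emb23 (r u y₂ y₃) * emb12 (r (u + s) y₁ y₂)
       - emb13 (r (u + s) y₁ y₃) * emb23 (Hh r rc (-s) y₂ y₃)
        + emb13 (s⁻¹ • (r (u + s) y₁ y₃ - r u y₁ y₃))) (𝓝[≠] 0)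
      (𝓝 (emb23 (r u y₂ y₃) * emb12 (r u y₁ y₂) - emb13 (r u y₁ y₃) * emb23 (rc 0 y₂ y₃)
        + emb13 (drm r u y₁ y₃))) := by
    refine ((tendsto_const_nhds.mul ((continuous_emb12.tendsto _).comp (h.tendsto_r_add hu h12))).sub
      (((continuous_emb13.tendsto _).comp (h.tendsto_r_add hu h13)).mul
        ((continuous_emb23.tendsto _).comp ((h.tendsto_Hh h23).comp tneg)))).add
       ((continuous_emb13.tendsto _).comp (h.tendsto_drm hu h13))
  exact tendsto_nhds_unique l (rr.congr' (key.mono fun _ hs => hs.symm))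

/-- the coefficient of `v` -/
def r1m (r : ℂ → ℂ → ℂ → T2 n) (rc : ℕ → ℂ → ℂ → T2 n) (y₁ y₂ : ℂ) : T2 n :=
  Matrix.of fun i j => deriv (fun v => Hh r rc v y₁ y₂ i j) 0

theorem Sol.tendsto_r1m (h : Sol r rc) {y₁ y₂ : ℂ} (hy : y₁ ≠ y₂) :
    Tendsto (fun s : ℂ => s⁻¹ • (Hh r rc s y₁ y₂ - rc 0 y₁ y₂)) (𝓝[≠] 0) (𝓝 (r1m r rc y₁ y₂)) := by
  refine tendsto_pi_nhds.2 fun i => tendsto_pi_nhds.2 fun j => ?_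
  have := (h.Hh_diff hy i j 0).hasDerivAt
  rw [hasDerivAt_iff_tendsto_slope_zero] at this
  simpa [Hh_zero, r1m] using this

theorem tendsto_two_punct : Tendsto (fun s : ℂ => s + s) (𝓝[≠] 0) (𝓝[≠] 0) := by
  have hc : Continuous (fun s : ℂ => s + s) := by fun_prop
  have := hc.tendsto 0
  rw [add_zero] at this
  refine tendsto_nhdsWithin_iff.2 ⟨this.mono_left nhdsWithin_le_nhds, ?_⟩
  filter_upwards [self_mem_nhdsWithin] with s hs
  have hs : s ≠ 0 := hs
  show s + s ≠ 0
  simpa [← two_mul] using hs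

/-- L3 -/
theorem Sol.L3 (h : Sol r rc) {y₁ y₂ y₃ : ℂ}
    (h12 : y₁ ≠ y₂) (h13 : y₁ ≠ y₃) (h23 : y₂ ≠ y₃) :
    emb12 (rc 0 y₁ y₂) * emb23 (rc 0 y₂ y₃) - emb13 (rc 0 y₁ y₃) * emb12 (rc 0 y₁ y₂)
      - emb23 (rc 0 y₂ y₃) * emb13 (rc 0 y₁ y₃) =
      -(emb12 (r1m r rc y₁ y₂) + emb23 (r1m r rc y₂ y₃) + emb13 (r1m r rc y₁ y₃)) := by
  have key : ∀ᶠ s : ℂ in 𝓝[≠] 0,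
      emb12 (Hh r rc s y₁ y₂) * emb23 (Hh r rc (s + s) y₂ y₃)
      - emb13 (Hh r rc (s + s) y₁ y₃) * emb12 (Hh r rc (-s) y₁ y₂)
      - emb23 (Hh r rc s y₂ y₃) * emb13 (Hh r rc s y₁ y₃) =
      -(emb12 ((2⁻¹ : ℂ) • (s⁻¹ • (Hh r rc s y₁ y₂ - rc 0 y₁ y₂)
          + (-s)⁻¹ • (Hh r rc (-s) y₁ y₂ - rc 0 y₁ y₂)))
        + emb23 ((2 : ℂ) • ((s + s)⁻¹ • (Hh r rc (s + s) y₂ y₃ - rc 0 y₂ y₃))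
          - s⁻¹ • (Hh r rc s y₂ y₃ - rc 0 y₂ y₃))
        + emb13 ((2 : ℂ) • ((s + s)⁻¹ • (Hh r rc (s + s) y₁ y₃ - rc 0 y₁ y₃))
          - s⁻¹ • (Hh r rc s y₁ y₃ - rc 0 y₁ y₃))) := by
    filter_upwards [self_mem_nhdsWithin] with s hs0
    have hs0 : s ≠ 0 := hs0
    have h2 : s + s ≠ 0 := by simpa [← two_mul] using hs0
    have := h.aybe s s y₁ y₂ y₃ hs0 hs0 h2 h12 h13 h23
    rw [r_eq_Hh (r := r) (rc := rc) hs0 y₁ y₂, r_eq_Hh (r := r) (rc := rc) h2 y₂ y₃,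
      r_eq_Hh (r := r) (rc := rc) h2 y₁ y₃, r_eq_Hh (r := r) (rc := rc) (neg_ne_zero.2 hs0) y₁ y₂,
      r_eq_Hh (r := r) (rc := rc) hs0 y₂ y₃, r_eq_Hh (r := r) (rc := rc) hs0 y₁ y₃] at this
    ext i j
    have := congrFun (congrFun this i) j
    simp only [emb12_add, emb13_add, emb12_smul, emb13_smul, emb12_one, emb23_one, emb13_one,
      emb23_smul, sub_eq_add_neg, emb13_neg, emb23_add, emb12_neg, emb23_neg,
      Matrix.mul_add, Matrix.add_mul, Matrix.mul_smul,
      Matrix.smul_mul, Matrix.mul_one, Matrix.one_mul, Matrix.add_apply, Matrix.neg_apply,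
      Matrix.smul_apply, smul_eq_mul] at this ⊢
    have e2 : (s + s)⁻¹ = s⁻¹ / 2 := by rw [← two_mul, mul_inv]; ring
    rw [e2, inv_neg] at *
    linear_combination this
  have l : Tendsto (fun s : ℂ => emb12 (Hh r rc s y₁ y₂) * emb23 (Hh r rc (s + s) y₂ y₃)
      - emb13 (Hh r rc (s + s) y₁ y₃) * emb12 (Hh r rc (-s) y₁ y₂)
      - emb23 (Hh r rc s y₂ y₃) * emb13 (Hh r rc s y₁ y₃)) (𝓝[≠] 0)
      (𝓝 (emb12 (rc 0 y₁ y₂) * emb23 (rc 0 y₂ y₃) - emb13 (rc 0 y₁ y₃) * emb12 (rc 0 y₁ y₂)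
      - emb23 (rc 0 y₂ y₃) * emb13 (rc 0 y₁ y₃))) := by
    refine ((((continuous_emb12.tendsto _).comp (h.tendsto_Hh h12)).mul
      ((continuous_emb23.tendsto _).comp ((h.tendsto_Hh h23).comp tendsto_two_punct))).sub
      (((continuous_emb13.tendsto _).comp ((h.tendsto_Hh h13).comp tendsto_two_punct)).mul
      ((continuous_emb12.tendsto _).comp ((h.tendsto_Hh h12).comp tendsto_neg_punct)))).sub
      (((continuous_emb23.tendsto _).comp (h.tendsto_Hh h23)).mul
      ((continuous_emb13.tendsto _).comp (h.tendsto_Hh h13)))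
  have t12 : Tendsto (fun s : ℂ => (2⁻¹ : ℂ) • (s⁻¹ • (Hh r rc s y₁ y₂ - rc 0 y₁ y₂)
          + (-s)⁻¹ • (Hh r rc (-s) y₁ y₂ - rc 0 y₁ y₂))) (𝓝[≠] 0) (𝓝 (r1m r rc y₁ y₂)) := by
    have := ((h.tendsto_r1m h12).add ((h.tendsto_r1m h12).comp tendsto_neg_punct)).const_smul (2⁻¹ : ℂ)
    have e : (2⁻¹ : ℂ) • (r1m r rc y₁ y₂ + r1m r rc y₁ y₂) = r1m r rc y₁ y₂ := by
      rw [← two_smul ℂ, smul_smul]; norm_num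
    rw [e] at this
    exact this
  have t2 : ∀ x y : ℂ, x ≠ y → Tendsto (fun s : ℂ => (2 : ℂ) • ((s + s)⁻¹ • (Hh r rc (s + s) x y - rc 0 x y))
          - s⁻¹ • (Hh r rc s x y - rc 0 x y)) (𝓝[≠] 0) (𝓝 (r1m r rc x y)) := by
    intro x y hxy
    have := (((h.tendsto_r1m hxy).comp tendsto_two_punct).const_smul (2 : ℂ)).sub (h.tendsto_r1m hxy)
    have e : (2 : ℂ) • r1m r rc x y - r1m r rc x y = r1m r rc x y := by
      rw [two_smul]; abel
    rw [e] at this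
    exact this
  have rr := ((((continuous_emb12.tendsto _).comp t12).add ((continuous_emb23.tendsto _).comp (t2 _ _ h23))).add
    ((continuous_emb13.tendsto _).comp (t2 _ _ h13))).neg
  exact tendsto_nhds_unique l (rr.congr' (key.mono fun _ hs => hs.symm))

end

noncomputable section
set_option linter.unusedSimpArgs false
set_option linter.unusedVariables false
variable {n : ℕ} {r : ℂ → ℂ → ℂ → T2 n} {rc : ℕ → ℂ → ℂ → T2 n}

/-! ### Holomorphy of `r₀` -/

theorem Sol.locUnif (h : Sol r rc) (y₂ : ℂ) (i j : Fin n × Fin n) :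
    TendstoLocallyUniformlyOn (fun (t x : ℂ) => Hh r rc t x y₂ i j) (fun x => rc 0 x y₂ i j)
      (𝓝[≠] (0 : ℂ)) {x : ℂ | x ≠ y₂} := by
  rw [Metric.tendstoLocallyUniformlyOn_iff]
  intro ε hε x0 hx0
  have hx0 : x0 ≠ y₂ := hx0
  obtain ⟨ρ, hρ, hK⟩ := Metric.nhds_basis_closedBall.mem_iff.1 (isOpen_ne.mem_nhds hx0)
  have hK' : ∀ x ∈ Metric.closedBall x0 ρ, x ≠ y₂ := fun x hx => hK hx
  have hcomp : IsCompact (Metric.sphere (0 : ℂ) 1 ×ˢ Metric.closedBall x0 ρ) :=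
    (isCompact_sphere _ _).prod (isCompact_closedBall _ _)
  have hcont : ContinuousOn (fun p : ℂ × ℂ => r p.1 p.2 y₂ i j - p.1⁻¹ * (1 : T2 n) i j)
      (Metric.sphere (0 : ℂ) 1 ×ˢ Metric.closedBall x0 ρ) := by
    intro p hp
    have hp1 : p.1 ≠ 0 := by
      intro e; have := hp.1; rw [e] at this; simp at this
    apply ContinuousAt.continuousWithinAt
    apply ContinuousAt.sub
    · have hd := (h.diff3 (p := (p.1, p.2, y₂)) ⟨hp1, hK' _ hp.2⟩ i j).continuousAt
      have hg : ContinuousAt (fun p : ℂ × ℂ => ((p.1, p.2, y₂) : ℂ × ℂ × ℂ)) p := by fun_prop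
      exact ContinuousAt.comp (g := fun p : ℂ × ℂ × ℂ => r p.1 p.2.1 p.2.2 i j)
        (f := fun p : ℂ × ℂ => ((p.1, p.2, y₂) : ℂ × ℂ × ℂ)) hd hg
    · exact (continuousAt_fst.inv₀ hp1).mul continuousAt_const
  obtain ⟨M, hM⟩ := hcomp.exists_bound_of_continuousOn hcont
  have hM0 : 0 ≤ M := by
    have := hM (1, x0) ⟨by simp, by simp [hρ.le]⟩
    exact (norm_nonneg _).trans this
  have bd : ∀ x ∈ Metric.closedBall x0 ρ, ∀ t ∈ Metric.ball (0 : ℂ) 1,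
      dist (Hh r rc t x y₂ i j) (rc 0 x y₂ i j) ≤ (2 * M + 1) * ‖t‖ := by
    intro x hx t ht
    have hd := h.Hh_diff (hK' x hx) i j
    have hmax : ∀ t ∈ Metric.closedBall (0 : ℂ) 1, ‖Hh r rc t x y₂ i j‖ ≤ M := by
      intro t ht
      refine Complex.norm_le_of_forall_mem_frontier_norm_le (U := Metric.ball (0 : ℂ) 1)
        (f := fun t => Hh r rc t x y₂ i j) Metric.isBounded_ball hd.diffContOnCl ?_ ?_
      · intro z hz
        rw [frontier_ball _ one_ne_zero] at hz
        have hz0 : z ≠ 0 := by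
          intro e; rw [e] at hz; simp at hz
        have := hM (z, x) ⟨hz, hx⟩
        simpa [Hh_ne hz0] using this
      · rwa [closure_ball _ one_ne_zero]
    have hmaps : MapsTo (fun t => Hh r rc t x y₂ i j) (Metric.ball (0 : ℂ) 1)
        (Metric.ball (Hh r rc 0 x y₂ i j) (2 * M + 1)) := by
      intro s hs
      rw [Metric.mem_ball, dist_eq_norm]
      have h1 := hmax s (Metric.ball_subset_closedBall hs)
      have h2 := hmax 0 (by simp)
      have := norm_sub_le (Hh r rc s x y₂ i j) (Hh r rc 0 x y₂ i j)
      show ‖Hh r rc s x y₂ i j - Hh r rc 0 x y₂ i j‖ < 2 * M + 1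
      linarith
    have := Complex.dist_le_div_mul_dist_of_mapsTo_ball hd.differentiableOn
      (hmaps.mono_right Metric.ball_subset_closedBall) ht
    rw [Hh_zero] at this
    simpa using this
  refine ⟨Metric.closedBall x0 ρ, mem_nhdsWithin_of_mem_nhds (Metric.closedBall_mem_nhds _ hρ), ?_⟩
  have hb : Metric.ball (0 : ℂ) (min 1 (ε / (2 * M + 1))) ∈ 𝓝 (0 : ℂ) :=
    Metric.ball_mem_nhds _ (lt_min one_pos (div_pos hε (by linarith)))
  filter_upwards [nhdsWithin_le_nhds hb] with t ht x hx
  rw [Metric.mem_ball, dist_zero_right, lt_min_iff] at ht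
  have := bd x hx t (by simpa using ht.1)
  rw [dist_comm]
  refine this.trans_lt ?_
  have := (lt_div_iff₀ (by linarith : (0 : ℝ) < 2 * M + 1)).1 ht.2
  linarith

theorem Sol.Hh_diff1 (h : Sol r rc) (y₂ : ℂ) (i j : Fin n × Fin n) {t : ℂ} (ht : t ≠ 0) :
    DifferentiableOn ℂ (fun x => Hh r rc t x y₂ i j) {x : ℂ | x ≠ y₂} := by
  intro x hx
  simp only [Hh_ne ht]
  exact ((h.diff_1 ht hx i j).sub_const _).differentiableWithinAt

theorem Sol.r0_diff_1 (h : Sol r rc) {y₁ y₂ : ℂ} (hy : y₁ ≠ y₂) (i j : Fin n × Fin n) :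
    DifferentiableAt ℂ (fun x => rc 0 x y₂ i j) y₁ := by
  have := (h.locUnif y₂ i j).differentiableOn
    (by filter_upwards [self_mem_nhdsWithin] with t ht using h.Hh_diff1 y₂ i j ht) isOpen_ne
  exact (this y₁ hy).differentiableAt (isOpen_ne.mem_nhds hy)

theorem Sol.tendsto_d1 (h : Sol r rc) {y₁ y₂ : ℂ} (hy : y₁ ≠ y₂) (i j : Fin n × Fin n) :
    Tendsto (fun t => deriv (fun x => r t x y₂ i j) y₁) (𝓝[≠] 0)
      (𝓝 (deriv (fun x => rc 0 x y₂ i j) y₁)) := by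
  have := (h.locUnif y₂ i j).deriv
    (by filter_upwards [self_mem_nhdsWithin] with t ht using h.Hh_diff1 y₂ i j ht) isOpen_ne
  have := this.tendsto_at (show y₁ ∈ {x : ℂ | x ≠ y₂} from hy)
  refine this.congr' ?_
  filter_upwards [self_mem_nhdsWithin] with t ht
  have ht : t ≠ 0 := ht
  simp only [Function.comp, Hh_ne ht]
  exact deriv_sub_const (f := fun x => r t x y₂ i j) (x := y₁) _

theorem Sol.r0_diff_2 (h : Sol r rc) {y₁ y₂ : ℂ} (hy : y₁ ≠ y₂) (i j : Fin n × Fin n) :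
    DifferentiableAt ℂ (fun x => rc 0 y₁ x i j) y₂ := by
  have := (h.r0_diff_1 hy.symm (i.2, i.1) (j.2, j.1)).neg
  refine this.congr_of_eventuallyEq ?_
  filter_upwards [isOpen_ne.mem_nhds hy.symm] with x hx
  exact h.r0_flip_apply (Ne.symm hx) i.1 i.2 j.1 j.2

theorem Sol.r0_cont_1 (h : Sol r rc) {y₁ y₂ : ℂ} (hy : y₁ ≠ y₂) :
    ContinuousAt (fun x => rc 0 x y₂) y₁ :=
  continuousAt_pi.2 fun i => continuousAt_pi.2 fun j => (h.r0_diff_1 hy i j).continuousAt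
theorem Sol.r0_cont_2 (h : Sol r rc) {y₁ y₂ : ℂ} (hy : y₁ ≠ y₂) :
    ContinuousAt (fun x => rc 0 y₁ x) y₂ :=
  continuousAt_pi.2 fun i => continuousAt_pi.2 fun j => (h.r0_diff_2 hy i j).continuousAt

/-- `∂₁ r₀` -/
def d1r0 (rc : ℕ → ℂ → ℂ → T2 n) (y₁ y₂ : ℂ) : T2 n :=
  Matrix.of fun i j => deriv (fun x => rc 0 x y₂ i j) y₁
/-- `∂₁ r` -/
def d1r (r : ℂ → ℂ → ℂ → T2 n) (t y₁ y₂ : ℂ) : T2 n :=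
  Matrix.of fun i j => deriv (fun x => r t x y₂ i j) y₁

theorem Sol.tendsto_d1r (h : Sol r rc) {y₁ y₂ : ℂ} (hy : y₁ ≠ y₂) :
    Tendsto (fun t => d1r r t y₁ y₂) (𝓝[≠] 0) (𝓝 (d1r0 rc y₁ y₂)) :=
  tendsto_pi_nhds.2 fun i => tendsto_pi_nhds.2 fun j => h.tendsto_d1 hy i j

end

noncomputable section
set_option linter.unusedSimpArgs false
set_option linter.unusedVariables false
variable {n : ℕ} {r : ℂ → ℂ → ℂ → T2 n} {rc : ℕ → ℂ → ℂ → T2 n}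

/-! ### Non-degeneracy -/

/-- contraction of the second leg -/
def ctr2 (t : T2 n) (C : Mat n) : Mat n :=
  Matrix.of fun i j => ∑ a, ∑ b, t (i, a) (j, b) * C b a

/-- the matrix of `can t` -/
def resh (t : T2 n) : Matrix (Fin n × Fin n) (Fin n × Fin n) ℂ :=
  Matrix.of fun p q => t (q.2, p.1) (q.1, p.2)

theorem canMap_eq (t : T2 n) (Z : Mat n) (k l : Fin n) :
    canMap t Z k l = (resh t *ᵥ fun q => Z q.1 q.2) (k, l) := by
  simp only [canMap, Matrix.of_apply, Matrix.mulVec, dotProduct, resh, Fintype.sum_prod_type]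
  rw [Finset.sum_comm]

theorem det_of_bij {t : T2 n} (h : Function.Bijective (canMap t)) : (resh t).det ≠ 0 := by
  have : Function.Injective (resh t).mulVec := by
    intro v w hvw
    have := @h.1 (Matrix.of fun i j => v (i, j)) (Matrix.of fun i j => w (i, j)) (by
      ext k l
      rw [canMap_eq, canMap_eq]
      exact congrFun hvw (k, l))
    ext ⟨i, j⟩
    exact congrFun (congrFun this i) j
  rw [Matrix.mulVec_injective_iff_isUnit] at this
  exact ((Matrix.isUnit_iff_isUnit_det _).1 this).ne_zero

theorem ctr2_surj {t : T2 n} (h : (resh t).det ≠ 0) (e : Mat n) : ∃ C, ctr2 t C = e := by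
  have h1 : IsUnit (resh t)ᵀ := by
    rw [Matrix.isUnit_iff_isUnit_det, Matrix.det_transpose]
    exact isUnit_iff_ne_zero.2 h
  obtain ⟨c, hc⟩ := (Matrix.mulVec_surjective_iff_isUnit.2 h1) (fun q => e q.2 q.1)
  refine ⟨Matrix.of fun b a => c (a, b), ?_⟩
  ext i j
  have := congrFun hc (j, i)
  simp only [Matrix.mulVec, dotProduct, resh, Fintype.sum_prod_type, Matrix.transpose_apply, Matrix.of_apply] at this
  rw [← this]
  simp [ctr2]

theorem det_resh_flip (t : T2 n) : (resh (tflip t)).det = (resh t).det := by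
  have : resh (tflip t) = ((resh t)ᵀ).submatrix (Equiv.prodComm _ _) (Equiv.prodComm _ _) := by
    ext p q
    rfl
  rw [this, Matrix.det_submatrix_equiv_self, Matrix.det_transpose]

theorem det_resh_neg {t : T2 n} (h : (resh t).det ≠ 0) : (resh (-t)).det ≠ 0 := by
  have : resh (-t) = - resh t := rfl
  rw [this, Matrix.det_neg]
  exact mul_ne_zero (pow_ne_zero _ (by norm_num)) h

theorem det_resh_smul {t : T2 n} {c : ℂ} (h : (resh (c • t)).det ≠ 0) : (resh t).det ≠ 0 := by
  have : resh (c • t) = c • resh t := rfl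
  rw [this, Matrix.det_smul] at h
  exact right_ne_zero_of_mul h

theorem differentiableAt_det {ι : Type*} [Fintype ι] [DecidableEq ι] {f : ℂ → Matrix ι ι ℂ} {x : ℂ}
    (h : ∀ i j, DifferentiableAt ℂ (fun z => f z i j) x) :
    DifferentiableAt ℂ (fun z => (f z).det) x := by
  simp only [Matrix.det_apply]
  apply DifferentiableAt.fun_sum
  intro σ _
  apply DifferentiableAt.fun_const_smul
  apply DifferentiableAt.fun_finset_prod
  intro i _
  exact h _ _

/-- good spectral parameters -/
def GoodU (r : ℂ → ℂ → ℂ → T2 n) (u : ℂ) : Prop :=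
  u ≠ 0 ∧ ∃ y₁ y₂ : ℂ, y₁ ≠ y₂ ∧ (resh (r u y₁ y₂)).det ≠ 0

theorem Sol.good_neg (h : Sol r rc) {u : ℂ} (hu : GoodU r u) : GoodU r (-u) := by
  obtain ⟨hu0, y₁, y₂, hy, hd⟩ := hu
  refine ⟨neg_ne_zero.2 hu0, y₂, y₁, hy.symm, ?_⟩
  have := h.flip hu0 hy
  rw [← det_resh_flip, this] at hd
  have := det_resh_neg hd
  rwa [neg_neg] at this

theorem Sol.good_dense (h : Sol r rc) {u : ℂ} (hu : u ≠ 0) : u ∈ closure {v | GoodU r v} := by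
  have h1 := h.nd (show ((u, 0, 1) : ℂ × ℂ × ℂ) ∈ _ from ⟨hu, by simp⟩)
  have h2 := image_closure_subset_closure_image (continuous_fst (X := ℂ) (Y := ℂ × ℂ)) (mem_image_of_mem Prod.fst h1)
  refine closure_mono ?_ h2
  rintro _ ⟨⟨v, y₁, y₂⟩, ⟨hv, hy, hb⟩, rfl⟩
  exact ⟨hv, y₁, y₂, hy, det_of_bij hb⟩

theorem Sol.good_y (h : Sol r rc) {u : ℂ} (hu : GoodU r u) :
    ∃ ys : ℂ, ∀ y0, y0 ≠ ys → ∀ᶠ y in 𝓝[≠] y0, y ≠ ys ∧ (resh (r u y ys)).det ≠ 0 := by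
  obtain ⟨hu0, y₁, ys, hy, hd⟩ := hu
  refine ⟨ys, fun y0 hy0 => ?_⟩
  have hdiff : DifferentiableOn ℂ (fun y => (resh (r u y ys)).det) {y | y ≠ ys} := by
    intro y hy
    exact (differentiableAt_det fun i j => h.diff_1 hu0 hy _ _).differentiableWithinAt
  have han := hdiff.analyticOnNhd isOpen_ne
  have hcon : IsPreconnected {y : ℂ | y ≠ ys} := by
    have : ({ys} : Set ℂ)ᶜ = {y : ℂ | y ≠ ys} := rfl
    rw [← this]
    exact (isConnected_compl_singleton_of_one_lt_rank (by simp) ys).isPreconnected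
  have hne : ∀ᶠ y in 𝓝[≠] y0, y ≠ ys :=
    nhdsWithin_le_nhds (isOpen_ne.mem_nhds hy0)
  rcases (han y0 hy0).eventually_eq_zero_or_eventually_ne_zero with h0 | h0
  · exact absurd (han.eqOn_zero_of_preconnected_of_eventuallyEq_zero hcon hy0 h0 hy) hd
  · exact hne.and h0

theorem Sol.good_t (h : Sol r rc) {u y ys : ℂ} (hu : u ≠ 0) (hy : y ≠ ys)
    (hd : (resh (r u y ys)).det ≠ 0) : ∀ᶠ t in 𝓝[≠] (0 : ℂ), (resh (r t y ys)).det ≠ 0 := by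
  have e : ∀ t : ℂ, t ≠ 0 → t • r t y ys = 1 + t • Hh r rc t y ys := by
    intro t ht
    rw [Hh_ne ht, smul_sub, smul_smul, mul_inv_cancel₀ ht, one_smul]; abel
  have hdiff : Differentiable ℂ (fun t => (resh (1 + t • Hh r rc t y ys)).det) := by
    intro t
    refine differentiableAt_det fun i j => ?_
    exact (differentiableAt_const _).add (differentiableAt_id.mul (h.Hh_diff hy _ _ t))
  have han : AnalyticOnNhd ℂ (fun t => (resh (1 + t • Hh r rc t y ys)).det) univ :=
    hdiff.differentiableOn.analyticOnNhd isOpen_univ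
  rcases (han 0 trivial).eventually_eq_zero_or_eventually_ne_zero with h0 | h0
  · have := han.eqOn_zero_of_preconnected_of_eventuallyEq_zero isPreconnected_univ trivial h0 (mem_univ u)
    simp only [← e u hu] at this
    have h2 : resh (u • r u y ys) = u • resh (r u y ys) := rfl
    rw [h2, Matrix.det_smul] at this
    simp [hu, hd] at this
  · filter_upwards [h0, self_mem_nhdsWithin] with t h1 h2
    rw [← e t h2] at h1
    exact det_resh_smul h1

end

noncomputable section
set_option linter.unusedSimpArgs false
set_option linter.unusedVariables false
variable {n : ℕ} {r : ℂ → ℂ → ℂ → T2 n} {rc : ℕ → ℂ → ℂ → T2 n}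

/-! ### Entrywise derivatives of matrix valued functions -/

/-- entrywise derivative -/
def HD {ι κ : Type*} (F : ℂ → Matrix ι κ ℂ) (F' : Matrix ι κ ℂ) (y : ℂ) : Prop :=
  ∀ i j, HasDerivAt (fun z => F z i j) (F' i j) y

theorem HD.tendsto {ι κ : Type*} {F : ℂ → Matrix ι κ ℂ} {F' : Matrix ι κ ℂ} {y : ℂ} (h : HD F F' y) :
    Tendsto F (𝓝 y) (𝓝 (F y)) :=
  tendsto_pi_nhds.2 fun i => tendsto_pi_nhds.2 fun j => (h i j).continuousAt.tendsto

theorem HD.mul {ι κ μ : Type*} [Fintype κ] {F : ℂ → Matrix ι κ ℂ} {F' : Matrix ι κ ℂ}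
    {G : ℂ → Matrix κ μ ℂ} {G' : Matrix κ μ ℂ} {y : ℂ} (hF : HD F F' y) (hG : HD G G' y) :
    HD (fun z => F z * G z) (F' * G y + F y * G') y := by
  intro i j
  simp only [Matrix.mul_apply, Matrix.add_apply, ← Finset.sum_add_distrib]
  exact HasDerivAt.fun_sum fun k _ => (hF i k).fun_mul (hG k j)

theorem HD.add {ι κ : Type*} {F G : ℂ → Matrix ι κ ℂ} {F' G' : Matrix ι κ ℂ} {y : ℂ}
    (hF : HD F F' y) (hG : HD G G' y) : HD (fun z => F z + G z) (F' + G') y :=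
  fun i j => (hF i j).fun_add (hG i j)

theorem HD.sub {ι κ : Type*} {F G : ℂ → Matrix ι κ ℂ} {F' G' : Matrix ι κ ℂ} {y : ℂ}
    (hF : HD F F' y) (hG : HD G G' y) : HD (fun z => F z - G z) (F' - G') y :=
  fun i j => (hF i j).fun_sub (hG i j)

theorem HD.const {ι κ : Type*} (M : Matrix ι κ ℂ) (y : ℂ) : HD (fun _ => M) 0 y :=
  fun i j => hasDerivAt_const y (M i j)

theorem HD.smul {ι κ : Type*} {F : ℂ → Matrix ι κ ℂ} {F' : Matrix ι κ ℂ} {f : ℂ → ℂ} {f' y : ℂ}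
    (hf : HasDerivAt f f' y) (hF : HD F F' y) : HD (fun z => f z • F z) (f' • F y + f y • F') y :=
  fun i j => hf.fun_mul (hF i j)

theorem HD.e12 {F : ℂ → T2 n} {F' : T2 n} {y : ℂ} (hF : HD F F' y) :
    HD (fun z => emb12 (F z)) (emb12 F') y := fun i j => (hF _ _).mul_const _
theorem HD.e13 {F : ℂ → T2 n} {F' : T2 n} {y : ℂ} (hF : HD F F' y) :
    HD (fun z => emb13 (F z)) (emb13 F') y := fun i j => (hF _ _).mul_const _
theorem HD.e23 {F : ℂ → T2 n} {F' : T2 n} {y : ℂ} (hF : HD F F' y) :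
    HD (fun z => emb23 (F z)) (emb23 F') y := fun i j => (hF _ _).mul_const _

theorem HD.unique {ι κ : Type*} {F G : ℂ → Matrix ι κ ℂ} {F' G' : Matrix ι κ ℂ} {y : ℂ}
    (hF : HD F F' y) (hG : HD G G' y) (he : ∀ᶠ z in 𝓝[≠] y, F z = G z) :
    F y = G y ∧ F' = G' := by
  have h0 : F y = G y :=
    tendsto_nhds_unique_of_eventuallyEq (hF.tendsto.mono_left nhdsWithin_le_nhds)
      (hG.tendsto.mono_left nhdsWithin_le_nhds) he
  refine ⟨h0, ?_⟩
  have he' : ∀ᶠ z in 𝓝 y, F z = G z := by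
    rw [eventually_nhdsWithin_iff] at he
    filter_upwards [he] with z hz
    by_cases hzy : z = y
    · rw [hzy, h0]
    · exact hz hzy
  ext i j
  refine (hF i j).unique ((hG i j).congr_of_eventuallyEq ?_)
  filter_upwards [he'] with z hz
  rw [hz]

theorem Sol.HD_1 (h : Sol r rc) {u y₁ y₂ : ℂ} (hu : u ≠ 0) (hy : y₁ ≠ y₂) :
    HD (fun x => r u x y₂) (d1r r u y₁ y₂) y₁ := fun i j => (h.diff_1 hu hy i j).hasDerivAt

/-! ### contractions -/

/-- contraction of the third leg -/
def ctr3 (T : T3 n) (C : Mat n) : T2 n :=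
  Matrix.of fun p q => ∑ a, ∑ b, T (p.1, p.2, a) (q.1, q.2, b) * C b a

theorem ctr3_add (S T : T3 n) (C : Mat n) : ctr3 (S + T) C = ctr3 S C + ctr3 T C := by
  ext p q; simp [ctr3, add_mul, Finset.sum_add_distrib]
theorem ctr3_sub (S T : T3 n) (C : Mat n) : ctr3 (S - T) C = ctr3 S C - ctr3 T C := by
  ext p q; simp [ctr3, sub_mul, Finset.sum_sub_distrib]
theorem ctr3_smul (c : ℂ) (T : T3 n) (C : Mat n) : ctr3 (c • T) C = c • ctr3 T C := by
  ext p q; simp [ctr3, Finset.mul_sum, mul_assoc]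
theorem HD.ctr3 {F : ℂ → T3 n} {F' : T3 n} {y : ℂ} (hF : HD F F' y) (C : Mat n) :
    HD (fun z => ctr3 (F z) C) (ctr3 F' C) y := fun i j => by
  simp only [_root_.ctr3, Matrix.of_apply]
  exact HasDerivAt.fun_sum fun a _ => HasDerivAt.fun_sum fun b _ => (hF _ _).mul_const _
theorem HD.ctr2 {F : ℂ → T2 n} {F' : T2 n} {y : ℂ} (hF : HD F F' y) (C : Mat n) :
    HD (fun z => ctr2 (F z) C) (ctr2 F' C) y := fun i j => by
  simp only [_root_.ctr2, Matrix.of_apply]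
  exact HasDerivAt.fun_sum fun a _ => HasDerivAt.fun_sum fun b _ => (hF _ _).mul_const _
theorem HD.kl {F : ℂ → Mat n} {F' : Mat n} {y : ℂ} (hF : HD F F' y) :
    HD (fun z => (1 : Mat n) ⊗ₖ (F z)) ((1 : Mat n) ⊗ₖ F') y := fun i j => by
  simp only [Matrix.kroneckerMap_apply]
  exact (hF _ _).const_mul _

theorem mul_kr (s : T2 n) (e : Mat n) (i j i' j' : Fin n) :
    (s * ((1 : Mat n) ⊗ₖ e)) (i, j) (i', j') = ∑ m, s (i, j) (i', m) * e m j' := by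
  simp only [Matrix.mul_apply, Fintype.sum_prod_type, Matrix.kroneckerMap_apply, Matrix.one_apply]
  simp [Finset.sum_ite_irrel]
theorem kl_mul (s : T2 n) (e : Mat n) (i j i' j' : Fin n) :
    ((e ⊗ₖ (1 : Mat n)) * s) (i, j) (i', j') = ∑ m, e i m * s (m, j) (i', j') := by
  simp only [Matrix.mul_apply, Fintype.sum_prod_type, Matrix.kroneckerMap_apply, Matrix.one_apply]
  simp
theorem mul_kl (s : T2 n) (e : Mat n) (i j i' j' : Fin n) :
    (s * (e ⊗ₖ (1 : Mat n))) (i, j) (i', j') = ∑ m, s (i, j) (m, j') * e m i' := by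
  simp only [Matrix.mul_apply, Fintype.sum_prod_type, Matrix.kroneckerMap_apply, Matrix.one_apply]
  simp
theorem kr_mul (s : T2 n) (e : Mat n) (i j i' j' : Fin n) :
    (((1 : Mat n) ⊗ₖ e) * s) (i, j) (i', j') = ∑ m, e j m * s (i, m) (i', j') := by
  simp only [Matrix.mul_apply, Fintype.sum_prod_type, Matrix.kroneckerMap_apply, Matrix.one_apply]
  simp [Finset.sum_ite_irrel]

theorem sum_rot (f : Fin n → Fin n → Fin n → ℂ) :
    ∑ a, ∑ b, ∑ m, f a b m = ∑ m, ∑ a, ∑ b, f a b m := by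
  rw [Finset.sum_comm (s := (Finset.univ : Finset (Fin n))) (t := Finset.univ)
    (f := fun m a => ∑ b, f a b m)]
  refine Finset.sum_congr rfl fun a _ => ?_
  rw [Finset.sum_comm]

theorem ctr3_12_23 (s t : T2 n) (C : Mat n) :
    ctr3 (emb12 s * emb23 t) C = s * ((1 : Mat n) ⊗ₖ ctr2 t C) := by
  ext ⟨i, j⟩ ⟨i', j'⟩
  simp only [ctr3, Matrix.of_apply, mul_12_23, mul_kr, ctr2, Finset.sum_mul, Finset.mul_sum]
  rw [sum_rot]
  simp only [mul_assoc]

theorem ctr3_13_12 (s t : T2 n) (C : Mat n) :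
    ctr3 (emb13 s * emb12 t) C = (ctr2 s C ⊗ₖ (1 : Mat n)) * t := by
  ext ⟨i, j⟩ ⟨i', j'⟩
  simp only [ctr3, Matrix.of_apply, mul_13_12, kl_mul, ctr2, Finset.sum_mul, Finset.mul_sum]
  rw [sum_rot]
  simp only [mul_right_comm]

theorem ctr3_12_13 (s t : T2 n) (C : Mat n) :
    ctr3 (emb12 s * emb13 t) C = s * (ctr2 t C ⊗ₖ (1 : Mat n)) := by
  ext ⟨i, j⟩ ⟨i', j'⟩
  simp only [ctr3, Matrix.of_apply, mul_12_13, mul_kl, ctr2, Finset.sum_mul, Finset.mul_sum]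
  rw [sum_rot]
  simp only [mul_assoc]

theorem ctr3_23_12 (s t : T2 n) (C : Mat n) :
    ctr3 (emb23 s * emb12 t) C = ((1 : Mat n) ⊗ₖ ctr2 s C) * t := by
  ext ⟨i, j⟩ ⟨i', j'⟩
  simp only [ctr3, Matrix.of_apply, mul_23_12, kr_mul, ctr2, Finset.sum_mul, Finset.mul_sum]
  rw [sum_rot]
  simp only [mul_right_comm]

/-! ### extension across the diagonal -/

/-- `F` extends `(z-y)^k r(w;y,z)` differentiably to `z = y` -/
def ExtD (r : ℂ → ℂ → ℂ → T2 n) (k : ℕ) (w y : ℂ) (F : ℂ → T2 n) (F' : T2 n) : Prop :=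
  HD F F' y ∧ ∀ᶠ z in 𝓝[≠] y, F z = (z - y) ^ k • r w y z

theorem hasDerivAt_pow_sub (k : ℕ) (hk : 1 ≤ k) (y : ℂ) :
    HasDerivAt (fun z : ℂ => (z - y) ^ k) (if k = 1 then 1 else 0) y := by
  have h1 : HasDerivAt (fun z : ℂ => z - y) 1 y := (hasDerivAt_id y).sub_const y
  have := h1.fun_pow k
  have e : (k : ℂ) * (y - y) ^ (k - 1) * 1 = if k = 1 then 1 else 0 := by
    by_cases hk1 : k = 1
    · simp [hk1]
    · have : k - 1 ≠ 0 := by omega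
      simp [hk1, this]
  rwa [e] at this

/-- existence of the minimal pole order -/
theorem Sol.exists_ext (h : Sol r rc) {u : ℂ} (hu : u ≠ 0) (y : ℂ) :
    ∃ k : ℕ, 1 ≤ k ∧ ∃ F F', ExtD r k u y F F' ∧ (k = 1 ∨ F y ≠ 0) := by
  classical
  let Q : ℕ → Prop := fun k => ∃ F : ℂ → T2 n, (∀ i j, AnalyticAt ℂ (fun z => F z i j) y) ∧
    ∀ᶠ z in 𝓝[≠] y, F z = (z - y) ^ (k + 1) • r u y z
  have hQ : ∃ k, Q k := by
    choose N hN using fun i j => h.mero_entry hu y i j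
    let M := ∑ i, ∑ j, N i j
    refine ⟨M, fun z => (z - y) ^ (M + 1) • r u y z, fun i j => ?_, Eventually.of_forall fun _ => rfl⟩
    have hle : N i j ≤ M :=
      (Finset.single_le_sum (f := fun j => N i j) (fun _ _ => Nat.zero_le _) (Finset.mem_univ j)).trans
      (Finset.single_le_sum (f := fun i => ∑ j, N i j) (fun _ _ => Nat.zero_le _) (Finset.mem_univ i))
    have : (fun z => ((z - y) ^ (M + 1) • r u y z) i j) =
        fun z => (z - y) ^ (M + 1 - N i j) * ((z - y) ^ N i j • r u y z i j) := by
      ext z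
      rw [Matrix.smul_apply, smul_eq_mul, smul_eq_mul, ← mul_assoc, ← pow_add]
      congr 2; omega
    rw [this]
    exact ((analyticAt_id.sub analyticAt_const).pow _).mul (hN i j)
  obtain ⟨F, hF, he⟩ := Nat.find_spec hQ
  refine ⟨Nat.find hQ + 1, by omega, F, Matrix.of fun i j => deriv (fun z => F z i j) y,
    ⟨fun i j => (hF i j).differentiableAt.hasDerivAt, he⟩, ?_⟩
  by_contra! hcon
  obtain ⟨h1, h2⟩ := hcon
  have hpos : 0 < Nat.find hQ := by omega
  apply Nat.find_min hQ (m := Nat.find hQ - 1) (by omega)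
  refine ⟨fun z => Matrix.of fun i j => dslope (fun z => F z i j) y z, fun i j => ?_, ?_⟩
  · obtain ⟨p, hp⟩ := hF i j
    exact ⟨_, hp.has_fpower_series_dslope_fslope⟩
  · filter_upwards [he, self_mem_nhdsWithin] with z hz hzy
    have hzy : z ≠ y := hzy
    ext i j
    rw [Matrix.of_apply, dslope_of_ne _ hzy, slope_def_field, hz, h2]
    have : z - y ≠ 0 := sub_ne_zero.2 hzy
    simp only [Matrix.smul_apply, smul_eq_mul, Matrix.zero_apply, sub_zero]
    rw [div_eq_iff this, show Nat.find hQ - 1 + 1 = Nat.find hQ by omega, pow_succ]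
    ring

/-- Shifting the spectral parameter -/
theorem Sol.ext_shift (h : Sol r rc) {u t y ys : ℂ} (hu : u ≠ 0) (ht : t ≠ 0) (htu : t ≠ u)
    (hy : y ≠ ys) (hd : (resh (r t y ys)).det ≠ 0) {k : ℕ} (hk : 1 ≤ k) {F : ℂ → T2 n} {F' : T2 n}
    (hF : ExtD r k u y F F') : ∃ G', ∃ G : ℂ → T2 n, ExtD r k (u - t) y G G' := by
  obtain ⟨C, hC⟩ := ctr2_surj hd 1
  have htu' : t - u ≠ 0 := sub_ne_zero.2 htu
  have d1 := hF.1.mul ((h.HD_1 ht hy).ctr2 C).kl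
  have d2 := HD.smul (hasDerivAt_pow_sub k hk y)
    ((((h.HD_1 htu' hy).e23).mul (HD.const (emb13 (r u y ys)) y)).ctr3 C)
  refine ⟨_, _, d1.sub d2, ?_⟩
  filter_upwards [hF.2, self_mem_nhdsWithin, nhdsWithin_le_nhds (isOpen_ne.mem_nhds hy)] with z hz hzy hzs
  have hzy : z ≠ y := hzy
  have hzs : z ≠ ys := hzs
  have := congrArg (fun T => ctr3 T C) (h.aybe u (t - u) y z ys hu htu' (by simpa using ht) hzy.symm hy hzs)
  have e1 : u + (t - u) = t := by ring
  simp only [e1, neg_sub, ctr3_add, ctr3_12_23, ctr3_13_12, hC] at this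
  rw [hz, Matrix.smul_mul, this, ← smul_sub]
  congr 1
  simp

end

noncomputable section
set_option linter.unusedSimpArgs false
set_option linter.unusedVariables false
variable {n : ℕ} {r : ℂ → ℂ → ℂ → T2 n} {rc : ℕ → ℂ → ℂ → T2 n}

/-! ### The merge lemma -/

/-- the permutation tensor, entrywise -/
def Pm (n : ℕ) : T2 n := Matrix.of fun p q => if q.2 = p.1 then (if q.1 = p.2 then 1 else 0) else 0

theorem eq_smul_Pm (hn : n ≠ 0) (A : T2 n)
    (h1 : ∀ e : Mat n, A * ((1 : Mat n) ⊗ₖ e) = (e ⊗ₖ (1 : Mat n)) * A)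
    (h2 : ∀ e : Mat n, A * (e ⊗ₖ (1 : Mat n)) = ((1 : Mat n) ⊗ₖ e) * A) :
    ∃ c : ℂ, A = c • Pm n := by
  have : NeZero n := ⟨hn⟩
  have H1 : ∀ i j i' p x, A (i, j) (i', p) = if p = i then A (x, j) (i', x) else 0 := by
    intro i j i' p x
    have := congrFun (congrFun (h1 (Matrix.single p x 1)) (i, j)) (i', x)
    rw [mul_kr, kl_mul] at this
    simp only [Matrix.single_apply] at this
    simpa [Finset.sum_ite_eq, ite_and] using this
  have H2 : ∀ i j p j' x, A (i, j) (p, j') = if p = j then A (i, x) (x, j') else 0 := by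
    intro i j p j' x
    have := congrFun (congrFun (h2 (Matrix.single p x 1)) (i, j)) (x, j')
    rw [mul_kl, kr_mul] at this
    simp only [Matrix.single_apply] at this
    simpa [Finset.sum_ite_eq, ite_and] using this
  refine ⟨A (0, 0) (0, 0), ?_⟩
  ext ⟨i, j⟩ ⟨i', j'⟩
  rw [H1 i j i' j' 0, H2 0 j i' 0 0]
  simp only [Pm, Matrix.smul_apply, Matrix.of_apply, smul_eq_mul]
  split_ifs <;> simp

/-- values and derivatives at the merged point -/
theorem Sol.merge_eq (h : Sol r rc) {u t y y₃ : ℂ} (hu : u ≠ 0) (ht : t ≠ 0) (htu : t ≠ u)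
    (hy : y ≠ y₃) {k : ℕ} (hk : 1 ≤ k) {F G : ℂ → T2 n} {F' G' : T2 n}
    (hF : ExtD r k u y F F') (hG : ExtD r k (u - t) y G G') :
    emb12 (F y) * emb23 (r t y y₃) = emb13 (r t y y₃) * emb12 (G y) ∧
    emb12 F' * emb23 (r t y y₃) + emb12 (F y) * emb23 (d1r r t y y₃) =
      emb13 (r t y y₃) * emb12 G' +
        (if k = 1 then (1 : ℂ) else 0) • (emb23 (r (t - u) y y₃) * emb13 (r u y y₃)) := by
  have htu' : t - u ≠ 0 := sub_ne_zero.2 htu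
  have d1 := hF.1.e12.mul (h.HD_1 ht hy).e23
  have d2 := ((HD.const (emb13 (r t y y₃)) y).mul hG.1.e12).add
    (HD.smul (hasDerivAt_pow_sub k hk y) ((h.HD_1 htu' hy).e23.mul (HD.const (emb13 (r u y y₃)) y)))
  have := d1.unique d2 (by
    filter_upwards [hF.2, hG.2, self_mem_nhdsWithin, nhdsWithin_le_nhds (isOpen_ne.mem_nhds hy)]
      with z hz hz2 hzy hzs
    have hzy : z ≠ y := hzy
    have hzs : z ≠ y₃ := hzs
    have := h.aybe u (t - u) y z y₃ hu htu' (by simpa using ht) hzy.symm hy hzs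
    have e1 : u + (t - u) = t := by ring
    rw [e1, neg_sub] at this
    rw [hz, hz2, emb12_smul, emb12_smul, Matrix.smul_mul, this, smul_add, Matrix.mul_smul])
  have hk0 : k ≠ 0 := by omega
  constructor
  · have := this.1
    simpa [hk0] using this
  · have := this.2
    simpa [hk0] using this

/-- the second leg contraction of a three-tensor -/
def ctrM (T : T3 n) (C : Mat n) : T2 n :=
  Matrix.of fun p q => ∑ a, ∑ b, T (p.1, a, p.2) (q.1, b, q.2) * C b a

theorem Sol.merge_eq2 (h : Sol r rc) {u t y ys : ℂ} (hu : u ≠ 0) (ht : t ≠ 0) (htu : t ≠ u)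
    (hy : y ≠ ys) {k : ℕ} (hk : 1 ≤ k) {F G : ℂ → T2 n} {F' G' : T2 n}
    (hF : ExtD r k u y F F') (hG : ExtD r k (u - t) y G G') (hFG : G y = F y) (C : Mat n) :
    F y * (ctr2 (r (-t) y ys) C ⊗ₖ (1 : Mat n)) = ((1 : Mat n) ⊗ₖ ctr2 (r (-t) y ys) C) * F y := by
  have hut : u - t ≠ 0 := sub_ne_zero.2 htu.symm
  have lim0 : Tendsto (fun z : ℂ => (z - y) ^ k) (𝓝[≠] y) (𝓝 0) := by
    have := (hasDerivAt_pow_sub k hk y).continuousAt.tendsto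
    simp only [sub_self] at this
    rw [zero_pow (by omega)] at this
    exact this.mono_left nhdsWithin_le_nhds
  have key : ∀ᶠ z in 𝓝[≠] y, (z - y) ^ k • (emb12 (r (u - t) y ys) * emb23 (r u ys z)) =
      emb13 (F z) * emb12 (r (-t) y ys) + emb23 (r t ys z) * emb13 (G z) := by
    filter_upwards [hF.2, hG.2, self_mem_nhdsWithin, nhdsWithin_le_nhds (isOpen_ne.mem_nhds hy)]
      with z hz hz2 hzy hzs
    have hzy : z ≠ y := hzy
    have hzs : z ≠ ys := hzs
    have := h.aybe (u - t) t y ys z hut ht (by simpa using hu) hy hzy.symm hzs.symm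
    have e1 : u - t + t = u := by ring
    rw [e1] at this
    rw [hz, hz2, emb13_smul, emb13_smul, Matrix.smul_mul, this, smul_add, Matrix.mul_smul]
  have l1 := lim0.smul ((tendsto_const_nhds (x := emb12 (r (u - t) y ys))).mul
    ((continuous_emb23.tendsto _).comp ((h.cont_2 hu hy.symm).tendsto.mono_left
      (nhdsWithin_le_nhds (s := {y}ᶜ)))))
  have l2 := (((continuous_emb13.tendsto _).comp (hF.1.tendsto.mono_left (nhdsWithin_le_nhds (s := {y}ᶜ)))).mul
    (tendsto_const_nhds (x := emb12 (r (-t) y ys)))).add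
    (((continuous_emb23.tendsto _).comp ((h.cont_2 ht hy.symm).tendsto.mono_left
      (nhdsWithin_le_nhds (s := {y}ᶜ)))).mul
      ((continuous_emb13.tendsto _).comp (hG.1.tendsto.mono_left (nhdsWithin_le_nhds (s := {y}ᶜ)))))
  have e := tendsto_nhds_unique_of_eventuallyEq l1 l2 key
  rw [zero_smul, hFG] at e
  ext ⟨i, j⟩ ⟨i', j'⟩
  have e' := congrFun (congrFun (congrArg (fun T => ctrM T C) e) (i, j)) (i', j')
  simp only [ctrM, Matrix.of_apply, Matrix.zero_apply, Matrix.add_apply, mul_13_12, mul_23_13, zero_mul,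
    Finset.sum_const_zero, add_mul, Finset.sum_add_distrib, Finset.sum_mul] at e'
  rw [mul_kl, kr_mul]
  simp only [ctr2, Matrix.of_apply, Finset.mul_sum, Finset.sum_mul]
  simp only [h.flip_apply ht hy.symm] at e'
  rw [eq_comm, add_eq_zero_iff_eq_neg] at e'
  rw [sum_rot] at e'
  conv at e' => rhs; rw [sum_rot]
  simp only [← mul_assoc]
  rw [e']
  simp only [← Finset.sum_neg_distrib]
  refine Finset.sum_congr rfl fun m _ => Finset.sum_congr rfl fun a _ => Finset.sum_congr rfl fun b _ => ?_
  ring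

/-- partial trace over the first leg -/
def ptr1 (t : T2 n) : Mat n := Matrix.of fun a b => ∑ m, t (m, a) (m, b)

def PhiT (T : T3 n) : T2 n := Matrix.of fun p q => ∑ m, T (m, p.1, p.2) (q.1, m, q.2)

def Lam (R A : T2 n) : T2 n :=
  Matrix.of fun p q => ∑ m, ∑ k, R (m, p.2) (k, q.2) * A (k, p.1) (q.1, m)

def kap (A : T2 n) : Mat n := Matrix.of fun i j => ∑ m, A (m, i) (j, m)

theorem PhiT_12_23 (s t : T2 n) : PhiT (emb12 s * emb23 t) = Lam t s := by
  ext ⟨i, a⟩ ⟨j, b⟩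
  simp only [PhiT, Lam, Matrix.of_apply, mul_12_23]
  rw [Finset.sum_comm]
  exact Finset.sum_congr rfl fun m _ => Finset.sum_congr rfl fun k _ => mul_comm _ _
theorem PhiT_13_12 (s t : T2 n) : PhiT (emb13 t * emb12 s) = Lam t s := by
  ext ⟨i, a⟩ ⟨j, b⟩
  simp only [PhiT, Lam, Matrix.of_apply, mul_13_12]
theorem PhiT_23_13 (s t : T2 n) : PhiT (emb23 s * emb13 t) = s * t := by
  ext ⟨i, a⟩ ⟨j, b⟩
  simp only [PhiT, Matrix.of_apply, mul_23_13]
  rw [Matrix.mul_apply, Fintype.sum_prod_type]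
theorem Lam_Pm (t : T2 n) : Lam t (Pm n) = (1 : Mat n) ⊗ₖ ptr1 t := by
  ext ⟨i, a⟩ ⟨j, b⟩
  simp only [Lam, Pm, ptr1, Matrix.of_apply, Matrix.kroneckerMap_apply, Matrix.one_apply]
  simp [eq_comm]
theorem Lam_one (A : T2 n) : Lam 1 A = kap A ⊗ₖ (1 : Mat n) := by
  ext ⟨i, a⟩ ⟨j, b⟩
  simp only [Lam, kap, Matrix.of_apply, Matrix.kroneckerMap_apply, Matrix.one_apply, Prod.mk.injEq]
  by_cases hab : a = b <;> simp [hab]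
theorem PhiT_add (S T : T3 n) : PhiT (S + T) = PhiT S + PhiT T := by
  ext p q; simp [PhiT, Finset.sum_add_distrib]
theorem PhiT_smul (c : ℂ) (T : T3 n) : PhiT (c • T) = c • PhiT T := by
  ext p q; simp [PhiT, Finset.mul_sum]
theorem Lam_add_left (R S A : T2 n) : Lam (R + S) A = Lam R A + Lam S A := by
  ext p q; simp [Lam, add_mul, Finset.sum_add_distrib]
theorem Lam_smul_left (c : ℂ) (R A : T2 n) : Lam (c • R) A = c • Lam R A := by
  ext p q; simp [Lam, mul_assoc, Finset.mul_sum]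
theorem Lam_smul_right (c : ℂ) (R A : T2 n) : Lam R (c • A) = c • Lam R A := by
  ext p q
  simp only [Lam, Matrix.of_apply, Matrix.smul_apply, smul_eq_mul, Finset.mul_sum]
  exact Finset.sum_congr rfl fun m _ => Finset.sum_congr rfl fun k _ => by ring
theorem Lam_sub_right (R A B : T2 n) : Lam R (A - B) = Lam R A - Lam R B := by
  ext p q; simp [Lam, mul_sub, Finset.sum_sub_distrib]

theorem Lam_tendsto {α : Type*} {l : Filter α} {R A : α → T2 n} {R0 A0 : T2 n}
    (hR : Tendsto R l (𝓝 R0)) (hA : Tendsto A l (𝓝 A0)) :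
    Tendsto (fun x => Lam (R x) (A x)) l (𝓝 (Lam R0 A0)) := by
  refine tendsto_pi_nhds.2 fun i => tendsto_pi_nhds.2 fun j => ?_
  simp only [Lam, Matrix.of_apply]
  refine tendsto_finsetSum _ fun m _ => tendsto_finsetSum _ fun k _ => ?_
  exact ((tendsto_pi_nhds.1 (tendsto_pi_nhds.1 hR _) _)).mul ((tendsto_pi_nhds.1 (tendsto_pi_nhds.1 hA _) _))

theorem ptr1_tendsto {α : Type*} {l : Filter α} {R : α → T2 n} {R0 : T2 n}
    (hR : Tendsto R l (𝓝 R0)) : Tendsto (fun x => ptr1 (R x)) l (𝓝 (ptr1 R0)) := by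
  refine tendsto_pi_nhds.2 fun i => tendsto_pi_nhds.2 fun j => ?_
  simp only [ptr1, Matrix.of_apply]
  exact tendsto_finsetSum _ fun m _ => (tendsto_pi_nhds.1 (tendsto_pi_nhds.1 hR _) _)

theorem kr_tendsto {α : Type*} {l : Filter α} {R : α → Mat n} {R0 : Mat n}
    (hR : Tendsto R l (𝓝 R0)) :
    Tendsto (fun x => (1 : Mat n) ⊗ₖ R x) l (𝓝 ((1 : Mat n) ⊗ₖ R0)) := by
  refine tendsto_pi_nhds.2 fun i => tendsto_pi_nhds.2 fun j => ?_
  exact tendsto_const_nhds.mul (tendsto_pi_nhds.1 (tendsto_pi_nhds.1 hR _) _)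

end

noncomputable section
set_option linter.unusedSimpArgs false
set_option linter.unusedVariables false
variable {n : ℕ} {r : ℂ → ℂ → ℂ → T2 n} {rc : ℕ → ℂ → ℂ → T2 n}

theorem tendsto_of_mul_left {ι α : Type*} [Fintype ι] [DecidableEq ι] {l : Filter α}
    {R X : α → Matrix ι ι ℂ} {Z : Matrix ι ι ℂ}
    (hR : Tendsto R l (𝓝 1)) (hX : Tendsto (fun t => R t * X t) l (𝓝 Z)) : Tendsto X l (𝓝 Z) := by
  have hdet : Tendsto (fun t => (R t).det) l (𝓝 1) := by
    have := ((Continuous.matrix_det (continuous_id (X := Matrix ι ι ℂ))).tendsto 1).comp hR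
    simpa [Function.comp_def] using this
  have hadj : Tendsto (fun t => (R t).adjugate) l (𝓝 1) := by
    have := ((Continuous.matrix_adjugate (continuous_id (X := Matrix ι ι ℂ))).tendsto 1).comp hR
    simpa [Function.comp_def] using this
  have h1 := (hdet.inv₀ one_ne_zero).smul (hadj.mul hX)
  rw [inv_one, one_smul, one_mul] at h1
  refine h1.congr' ?_
  filter_upwards [hdet.eventually_ne one_ne_zero] with t ht
  rw [← mul_assoc, Matrix.adjugate_mul, Matrix.smul_mul, one_mul, smul_smul, inv_mul_cancel₀ ht, one_smul]

theorem Sol.tendsto_smul_r (h : Sol r rc) {y y₃ : ℂ} (hy : y ≠ y₃) :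
    Tendsto (fun t : ℂ => t • r t y y₃) (𝓝[≠] 0) (𝓝 1) := by
  have h0 : Tendsto (fun t : ℂ => t) (𝓝[≠] 0) (𝓝 0) := nhdsWithin_le_nhds
  have := (tendsto_const_nhds (x := (1 : T2 n))).add (h0.smul (h.tendsto_Hh hy))
  rw [zero_smul, add_zero] at this
  refine this.congr' ?_
  filter_upwards [self_mem_nhdsWithin] with t ht
  have ht : t ≠ 0 := ht
  rw [Hh_ne ht, smul_sub, smul_smul, mul_inv_cancel₀ ht, one_smul]; abel

theorem Sol.merge_val (h : Sol r rc) {u t y ys : ℂ} (hu : u ≠ 0) (ht : t ≠ 0) (htu : t ≠ u)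
    (hy : y ≠ ys) (hd : (resh (r t y ys)).det ≠ 0) (hd' : (resh (r (-t) y ys)).det ≠ 0)
    {k : ℕ} (hk : 1 ≤ k) {F G : ℂ → T2 n} {F' G' : T2 n}
    (hF : ExtD r k u y F F') (hG : ExtD r k (u - t) y G G') :
    ∃ c : ℂ, F y = c • Pm n := by
  have h1 : ∀ e : Mat n, F y * ((1 : Mat n) ⊗ₖ e) = (e ⊗ₖ (1 : Mat n)) * G y := by
    intro e
    obtain ⟨C, rfl⟩ := ctr2_surj hd e
    have := congrArg (fun T => ctr3 T C) (h.merge_eq hu ht htu hy hk hF hG).1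
    simpa only [ctr3_12_23, ctr3_13_12] using this
  have hFG : G y = F y := by
    have := h1 1
    rw [Matrix.one_kronecker_one, mul_one, one_mul] at this
    exact this.symm
  refine eq_smul_Pm h.n0 _ (fun e => by rw [h1, hFG]) fun e => ?_
  obtain ⟨C, rfl⟩ := ctr2_surj hd' e
  exact h.merge_eq2 hu ht htu hy hk hF hG hFG C

theorem Sol.merge (h : Sol r rc) {u y ys : ℂ} (hu : u ≠ 0) (hy : y ≠ ys)
    (hd : (resh (r u y ys)).det ≠ 0) :
    ∃ k : ℕ, 1 ≤ k ∧ ∃ c : ℂ, ∃ K : Mat n, (k = 1 ∨ c ≠ 0) ∧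
      Tendsto (fun z => (z - y) ^ k • rc 0 y z) (𝓝[≠] y) (𝓝 (c • Pm n)) ∧
      ∀ y₃, y₃ ≠ y → c • ((1 : Mat n) ⊗ₖ ptr1 (d1r0 rc y y₃)) + K ⊗ₖ (1 : Mat n) =
        (if k = 1 then (1 : ℂ) else 0) • (r (-u) y y₃ * r u y y₃) := by
  obtain ⟨k, hk, F, F', hF, hkF⟩ := h.exists_ext hu y
  have ev0 : ∀ᶠ t : ℂ in 𝓝[≠] 0, t ≠ 0 ∧ t ≠ u := by
    filter_upwards [self_mem_nhdsWithin, nhdsWithin_le_nhds (isOpen_ne.mem_nhds hu.symm)] with t a b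
    exact ⟨a, b⟩
  have ev1 := h.good_t hu hy hd
  have ev2 := tendsto_neg_punct.eventually ev1
  have ev := ev0.and (ev1.and ev2)
  have ex : ∀ᶠ t : ℂ in 𝓝[≠] 0, ∃ G', ∃ G : ℂ → T2 n, ExtD r k (u - t) y G G' := by
    filter_upwards [ev] with t ht
    exact h.ext_shift hu ht.1.1 ht.1.2 hy ht.2.1 hk hF
  obtain ⟨g, hg⟩ := ex.choice
  have evs := ev.and hg
  obtain ⟨c, hc⟩ : ∃ c : ℂ, F y = c • Pm n := by
    obtain ⟨t, ht, G, hG⟩ := evs.exists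
    exact h.merge_val hu ht.1.1 ht.1.2 hy ht.2.1 ht.2.2 hk hF hG
  set δ : ℂ := if k = 1 then (1 : ℂ) else 0 with hδ
  -- derivative equation
  have der : ∀ y₃, y ≠ y₃ → ∀ᶠ t : ℂ in 𝓝[≠] 0,
      emb12 F' * emb23 (r t y y₃) + emb12 (F y) * emb23 (d1r r t y y₃) =
      emb13 (r t y y₃) * emb12 (g t) + δ • (emb23 (r (t - u) y y₃) * emb13 (r u y y₃)) := by
    intro y₃ hy3
    filter_upwards [evs] with t ht
    obtain ⟨G, hG⟩ := ht.2
    exact (h.merge_eq hu ht.1.1.1 ht.1.1.2 hy3 hk hF hG).2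
  have tid : Tendsto (fun t : ℂ => t) (𝓝[≠] 0) (𝓝 0) := nhdsWithin_le_nhds
  have tru : ∀ y₃, y ≠ y₃ → Tendsto (fun t : ℂ => r (t - u) y y₃) (𝓝[≠] 0) (𝓝 (r (-u) y y₃)) := by
    intro y₃ hy3
    have c1 : ContinuousAt (fun t : ℂ => t - u) 0 := by fun_prop
    have := (h.cont_u (neg_ne_zero.2 hu) hy3).tendsto
    refine Tendsto.comp (f := fun t : ℂ => t - u) (g := fun v => r v y y₃) this ?_
    have := c1.tendsto.mono_left (nhdsWithin_le_nhds (s := {(0 : ℂ)}ᶜ))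
    simpa using this
  -- convergence of g
  have hgF : Tendsto g (𝓝[≠] 0) (𝓝 F') := by
    have l1 : Tendsto (fun t : ℂ => emb12 F' * emb23 (t • r t y ys) +
        t • (emb12 (F y) * emb23 (d1r r t y ys) - δ • (emb23 (r (t - u) y ys) * emb13 (r u y ys))))
        (𝓝[≠] 0) (𝓝 (emb12 F' * emb23 1 + (0 : ℂ) • (emb12 (F y) * emb23 (d1r0 rc y ys) -
          δ • (emb23 (r (-u) y ys) * emb13 (r u y ys))))) := by
      refine ((tendsto_const_nhds).mul ((continuous_emb23.tendsto _).comp (h.tendsto_smul_r hy))).add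
        (tid.smul ((tendsto_const_nhds.mul ((continuous_emb23.tendsto _).comp (h.tendsto_d1r hy))).sub
          (Tendsto.const_smul ?_ _)))
      exact ((continuous_emb23.tendsto _).comp (tru ys hy)).mul tendsto_const_nhds
    rw [zero_smul, add_zero, emb23_one, mul_one] at l1
    have hR := (continuous_emb13.tendsto _).comp (h.tendsto_smul_r hy)
    rw [emb13_one] at hR
    have l2 := tendsto_of_mul_left (X := fun t => emb12 (g t)) hR (l1.congr' (by
      filter_upwards [der ys hy] with t ht
      simp only [Function.comp]
      rw [emb23_smul, emb13_smul, Matrix.mul_smul, Matrix.smul_mul, ← smul_add, ← add_sub_assoc, ht,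
        add_sub_cancel_right]))
    refine tendsto_pi_nhds.2 fun i => tendsto_pi_nhds.2 fun j => ?_
    have := tendsto_pi_nhds.1 (tendsto_pi_nhds.1 l2 (i.1, i.2, i.1)) (j.1, j.2, i.1)
    simpa [emb12] using this
  -- contracted equation
  have der2 : ∀ y₃, y ≠ y₃ → ∀ᶠ t : ℂ in 𝓝[≠] 0,
      (t⁻¹ • kap (F' - g t)) ⊗ₖ (1 : Mat n) = δ • (r (t - u) y y₃ * r u y y₃)
        - c • ((1 : Mat n) ⊗ₖ ptr1 (d1r r t y y₃)) - Lam (Hh r rc t y y₃) (F' - g t) := by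
    intro y₃ hy3
    filter_upwards [der y₃ hy3, ev0] with t ht ht0
    have := congrArg PhiT ht
    rw [PhiT_add, PhiT_add, PhiT_smul, PhiT_12_23, PhiT_12_23, PhiT_13_12, PhiT_23_13, hc,
      Lam_smul_right, Lam_Pm] at this
    have e1 : Lam (r t y y₃) (F' - g t) = (t⁻¹ • kap (F' - g t)) ⊗ₖ (1 : Mat n)
        + Lam (Hh r rc t y y₃) (F' - g t) := by
      conv_lhs => rw [r_eq_Hh (r := r) (rc := rc) ht0.1 y y₃]
      rw [Lam_add_left, Lam_smul_left, Lam_one, Matrix.smul_kronecker]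
    rw [Lam_sub_right] at e1
    have e2 : Lam (r t y y₃) F' = Lam (r t y y₃) (g t) + (t⁻¹ • kap (F' - g t)) ⊗ₖ (1 : Mat n)
        + Lam (Hh r rc t y y₃) (F' - g t) := by
      rw [add_assoc, ← e1]; abel
    rw [e2] at this
    have e3 := sub_eq_zero.2 this
    rw [← sub_eq_zero, ← e3]; abel
  have lim2 : ∀ y₃, y ≠ y₃ → Tendsto (fun t : ℂ => (t⁻¹ • kap (F' - g t)) ⊗ₖ (1 : Mat n)) (𝓝[≠] 0)
      (𝓝 (δ • (r (-u) y y₃ * r u y y₃) - c • ((1 : Mat n) ⊗ₖ ptr1 (d1r0 rc y y₃)))) := by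
    intro y₃ hy3
    have a1 : Tendsto (fun t : ℂ => δ • (r (t - u) y y₃ * r u y y₃)) (𝓝[≠] 0)
      (𝓝 (δ • (r (-u) y y₃ * r u y y₃))) := ((tru y₃ hy3).mul tendsto_const_nhds).const_smul _
    have a2 : Tendsto (fun t : ℂ => c • ((1 : Mat n) ⊗ₖ ptr1 (d1r r t y y₃))) (𝓝[≠] 0)
      (𝓝 (c • ((1 : Mat n) ⊗ₖ ptr1 (d1r0 rc y y₃)))) :=
        (kr_tendsto (ptr1_tendsto (h.tendsto_d1r hy3))).const_smul _
    have a3 := Lam_tendsto (h.tendsto_Hh hy3) ((tendsto_const_nhds (x := F')).sub hgF)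
    have a0 : Lam (rc 0 y y₃) (F' - F') = 0 := by
      rw [Lam_sub_right, sub_self]
    rw [a0] at a3
    have := (a1.sub a2).sub a3
    rw [sub_zero] at this
    exact this.congr' ((der2 y₃ hy3).mono fun t ht => ht.symm)
  -- the limit of kap
  have hn := h.n0
  have : NeZero n := ⟨hn⟩
  obtain ⟨K, hK⟩ : ∃ K : Mat n, Tendsto (fun t : ℂ => t⁻¹ • kap (F' - g t)) (𝓝[≠] 0) (𝓝 K) := by
    refine ⟨Matrix.of fun i j => (δ • (r (-u) y ys * r u y ys) - c • ((1 : Mat n) ⊗ₖ ptr1 (d1r0 rc y ys))) (i, 0) (j, 0), ?_⟩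
    refine tendsto_pi_nhds.2 fun i => tendsto_pi_nhds.2 fun j => ?_
    have := tendsto_pi_nhds.1 (tendsto_pi_nhds.1 (lim2 ys hy) (i, 0)) (j, 0)
    simpa [Matrix.kroneckerMap_apply] using this
  refine ⟨k, hk, c, K, ?_, ?_, ?_⟩
  · rcases hkF with h1 | h1
    · exact Or.inl h1
    · right
      rintro rfl
      rw [hc, zero_smul] at h1
      exact h1 rfl
  · -- the pole of r0
    obtain ⟨C, hC⟩ := ctr2_surj hd 1
    have tz : Tendsto (fun z : ℂ => (z - y) ^ k) (𝓝[≠] y) (𝓝 0) := by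
      have := (hasDerivAt_pow_sub k hk y).continuousAt.tendsto
      simp only [sub_self] at this
      rw [zero_pow (by omega)] at this
      exact this.mono_left nhdsWithin_le_nhds
    have b1 : Tendsto (fun z => (1 : Mat n) ⊗ₖ ctr2 (r u z ys) C) (𝓝[≠] y) (𝓝 ((1 : Mat n) ⊗ₖ ctr2 (r u y ys) C)) :=
      ((((h.HD_1 hu hy).ctr2 C).kl).tendsto).mono_left nhdsWithin_le_nhds
    have b2 : Tendsto F (𝓝[≠] y) (𝓝 (F y)) := hF.1.tendsto.mono_left nhdsWithin_le_nhds
    have b3 : Tendsto (fun z => ctr3 (emb13 (r u y ys) * emb23 (rc 0 z ys) - emb13 (drm r u y ys)) C) (𝓝[≠] y)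
        (𝓝 (ctr3 (emb13 (r u y ys) * emb23 (rc 0 y ys) - emb13 (drm r u y ys)) C)) := by
      have hh : HD (fun z => rc 0 z ys) (d1r0 rc y ys) y := fun i j => (h.r0_diff_1 hy i j).hasDerivAt
      have := ((((HD.const (emb13 (r u y ys)) y).mul hh.e23).sub (HD.const (emb13 (drm r u y ys)) y)).ctr3 C).tendsto
      exact this.mono_left nhdsWithin_le_nhds
    have b4 := (b1.mul b2).sub (tz.smul b3)
    rw [hC, Matrix.one_kronecker_one, one_mul, zero_smul, sub_zero, hc] at b4
    refine b4.congr' ?_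
    filter_upwards [hF.2, self_mem_nhdsWithin, nhdsWithin_le_nhds (isOpen_ne.mem_nhds hy)] with z hz hzy hzs
    have hzy : z ≠ y := hzy
    have hzs : z ≠ ys := hzs
    have := congrArg (fun T => ctr3 T C) (h.L2 hu hzy.symm hy hzs)
    simp only [ctr3_12_13, hC, Matrix.one_kronecker_one, mul_one, ctr3_add, ctr3_sub, ctr3_23_12] at this
    rw [this, hz, ctr3_sub]
    simp only [smul_add, smul_sub, Matrix.mul_smul]
    abel
  · intro y₃ hy3
    have l : Tendsto (fun t : ℂ => (t⁻¹ • kap (F' - g t)) ⊗ₖ (1 : Mat n)) (𝓝[≠] 0) (𝓝 (K ⊗ₖ (1 : Mat n))) := by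
      refine tendsto_pi_nhds.2 fun i => tendsto_pi_nhds.2 fun j => ?_
      exact (tendsto_pi_nhds.1 (tendsto_pi_nhds.1 hK _) _).mul_const _
    rw [tendsto_nhds_unique l (lim2 y₃ hy3.symm)]
    abel

end

noncomputable section
set_option linter.unusedSimpArgs false
set_option linter.unusedVariables false
variable {n : ℕ} {r : ℂ → ℂ → ℂ → T2 n} {rc : ℕ → ℂ → ℂ → T2 n}

/-! ### Power sums -/

theorem nilp_pow_sub {R : Type*} [Ring R] {g m : R} (hc : Commute g m) (h : IsNilpotent (g - m)) (k : ℕ) :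
    IsNilpotent (g ^ k - m ^ k) := by
  rw [← hc.mul_geom_sum₂]
  refine Commute.isNilpotent_mul_right ?_ h
  refine Commute.sum_right _ _ _ fun i _ => ?_
  exact Commute.mul_right (((Commute.refl g).sub_left hc.symm).pow_right _)
        (((hc).sub_left (Commute.refl _)).pow_right _)

theorem trace_pow_of_nil {V : Type*} [AddCommGroup V] [Module ℂ V] [FiniteDimensional ℂ V]
    (g : Module.End ℂ V) (μ : ℂ) (hnil : IsNilpotent (g - algebraMap ℂ (Module.End ℂ V) μ)) (k : ℕ) :
    LinearMap.trace ℂ V (g ^ k) = (Module.finrank ℂ V : ℂ) * μ ^ k := by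
  have hc : Commute g (algebraMap ℂ (Module.End ℂ V) μ) := (Algebra.commutes μ g).symm
  have hnk := nilp_pow_sub hc hnil k
  have := LinearMap.isNilpotent_trace_of_isNilpotent hnk
  rw [isNilpotent_iff_eq_zero, map_sub, sub_eq_zero, ← map_pow, Algebra.algebraMap_eq_smul_one, map_smul,
      LinearMap.trace_one, smul_eq_mul] at this
  rw [this, mul_comm]

theorem exists_powsum (W : Mat n) : ∃ (σ : Type) (_ : Fintype σ) (lam : σ → ℂ),
    Fintype.card σ = n ∧ ∀ k : ℕ, (W ^ k).trace = ∑ i, lam i ^ k := by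
  classical
  let f : Module.End ℂ (Fin n → ℂ) := Matrix.toLin' W
  have hIntl : DirectSum.IsInternal f.maxGenEigenspace := by
    rw [DirectSum.isInternal_submodule_iff_iSupIndep_and_iSup_eq_top]
    exact ⟨f.independent_maxGenEigenspace, Module.End.iSup_maxGenEigenspace_eq_top f⟩
  have hN : {μ | f.maxGenEigenspace μ ≠ ⊥}.Finite :=
    WellFoundedGT.finite_ne_bot_of_iSupIndep hIntl.submodule_iSupIndep
  have hmap : ∀ k μ, MapsTo ⇑(f ^ k) (f.maxGenEigenspace μ : Set _) (f.maxGenEigenspace μ : Set _) := fun k μ =>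
    Module.End.mapsTo_maxGenEigenspace_of_comm ((Commute.refl f).pow_right k) μ
  have htr : ∀ k : ℕ, (W ^ k).trace =
      ∑ μ ∈ hN.toFinset, (Module.finrank ℂ (f.maxGenEigenspace μ) : ℂ) * μ ^ k := by
    intro k
    have e1 : (W ^ k).trace = LinearMap.trace ℂ _ (f ^ k) := by
      rw [← Matrix.toLin'_pow, Matrix.trace_toLin'_eq]
    rw [e1, LinearMap.trace_eq_sum_trace_restrict' hIntl hN (hmap k)]
    refine Finset.sum_congr rfl fun μ _ => ?_
    set V := f.maxGenEigenspace μ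
    have hm1 : MapsTo ⇑f (V : Set _) (V : Set _) := by simpa using hmap 1 μ
    let g : Module.End ℂ V := f.restrict hm1
    have e2 : (f ^ k).restrict (hmap k μ) = g ^ k := (Module.End.pow_restrict k hm1 (hmap k μ)).symm
    have hnil : IsNilpotent (g - algebraMap ℂ (Module.End ℂ V) μ) := by
      have := Module.End.isNilpotent_restrict_maxGenEigenspace_sub_algebraMap f μ
      convert! this using 1
    rw [e2]
    exact trace_pow_of_nil g μ hnil k
  have hsum : ∀ k : ℕ, (W ^ k).trace = ∑ i : (Σ μ : hN.toFinset, Fin (Module.finrank ℂ (f.maxGenEigenspace (μ : ℂ)))),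
      (i.1 : ℂ) ^ k := by
    intro k
    rw [htr, Fintype.sum_sigma, ← Finset.sum_coe_sort]
    exact Finset.sum_congr rfl fun μ _ => by simp
  refine ⟨(Σ μ : hN.toFinset, Fin (Module.finrank ℂ (f.maxGenEigenspace (μ : ℂ)))), inferInstance, fun i => (i.1 : ℂ), ?_, hsum⟩
  have := hsum 0
  simp only [pow_zero, Matrix.trace_one, Fintype.card_fin, Finset.sum_const, Finset.card_univ, nsmul_eq_mul, mul_one] at this
  exact_mod_cast this.symm

open Polynomial in
theorem newton_contra (P : ℕ → ℂ[X]) (hP : ∀ K, 1 ≤ K → (P K).natDegree ≤ K + 1)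
    (hP1 : (P 1).coeff 2 = 1) (S : Set ℂ) (hS : S.Infinite)
    (hW : ∀ s ∈ S, ∃ W : Mat n, ∀ K, 1 ≤ K → (W ^ K).trace = (P K).eval s) : False := by
  have hE : ∀ s : ℂ, ∃ E : ℕ → ℂ, s ∈ S → E 0 = 1 ∧ E (n + 1) = 0 ∧ ∀ k : ℕ, (k : ℂ) * E k = (-1) ^ (k + 1) *
      ∑ a ∈ Finset.HasAntidiagonal.antidiagonal k with a.1 < k, (-1) ^ a.1 * E a.1 * (P a.2).eval s := by
    intro s
    by_cases hs : s ∈ S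
    · obtain ⟨W, hW⟩ := hW s hs
      obtain ⟨σ, _, lam, hcard, hlam⟩ := exists_powsum W
      refine ⟨fun k => MvPolynomial.aeval lam (MvPolynomial.esymm σ ℂ k), fun _ => ⟨by simp, ?_, fun k => ?_⟩⟩
      · have : MvPolynomial.esymm σ ℂ (n + 1) = 0 := by
          rw [MvPolynomial.esymm, Finset.powersetCard_eq_empty.2 (by rw [Finset.card_univ, hcard]; omega)]
          simp
        simp [this]
      · have := congrArg (MvPolynomial.aeval lam) (MvPolynomial.mul_esymm_eq_sum σ ℂ k)
        simp only [map_mul, map_natCast, map_pow, map_neg, map_one, map_sum] at this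
        rw [this]
        congr 1
        refine Finset.sum_congr rfl fun a ha => ?_
        simp only [Finset.mem_filter, Finset.HasAntidiagonal.mem_antidiagonal] at ha
        rw [← hW a.2 (by omega), hlam, MvPolynomial.psum]
        simp
    · exact ⟨0, fun h => absurd h hs⟩
  choose E hE using hE
  have key : ∀ k : ℕ, ∃ Q : ℕ → ℂ[X], ∀ m ≤ k, (Q m).natDegree ≤ 2 * m ∧ (Q m).coeff (2 * m) ≠ 0 ∧
      ∀ s ∈ S, E s m = (Q m).eval s := by
    intro k
    induction k with
    | zero =>
      refine ⟨fun _ => 1, fun m hm => ?_⟩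
      obtain rfl : m = 0 := by omega
      simp only [natDegree_one, le_refl, mul_zero, coeff_one_zero, ne_eq, one_ne_zero, not_false_eq_true, eval_one, true_and]
      exact fun s hs => (hE s hs).1
    | succ k ih =>
      obtain ⟨Q, hQ⟩ := ih
      let R : ℂ[X] := C (((k + 1 : ℕ) : ℂ)⁻¹ * (-1) ^ (k + 1 + 1)) *
        ∑ a ∈ Finset.HasAntidiagonal.antidiagonal (k + 1) with a.1 < k + 1, C ((-1) ^ a.1) * (Q a.1 * P a.2)
      have hk0 : ((k + 1 : ℕ) : ℂ) ≠ 0 := by exact_mod_cast Nat.succ_ne_zero k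
      have hdeg : ∀ a ∈ (Finset.HasAntidiagonal.antidiagonal (k + 1)).filter (fun a : ℕ × ℕ => a.1 < k + 1),
          (C ((-1 : ℂ) ^ a.1) * (Q a.1 * P a.2)).natDegree ≤ 2 * a.1 + (a.2 + 1) := by
        intro a ha
        simp only [Finset.mem_filter, Finset.HasAntidiagonal.mem_antidiagonal] at ha
        refine (natDegree_C_mul_le _ _).trans (natDegree_mul_le.trans (add_le_add (hQ _ (by omega)).1 (hP _ (by omega))))
      refine ⟨Function.update Q (k + 1) R, fun m hm => ?_⟩
      rcases Nat.lt_or_ge m (k + 1) with h | h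
      · rw [Function.update_of_ne (by omega)]
        exact hQ m (by omega)
      · obtain rfl : m = k + 1 := by omega
        rw [Function.update_self]
        refine ⟨?_, ?_, fun s hs => ?_⟩
        · refine (natDegree_C_mul_le _ _).trans (natDegree_sum_le_of_forall_le _ _ fun a ha => (hdeg a ha).trans ?_)
          simp only [Finset.mem_filter, Finset.HasAntidiagonal.mem_antidiagonal] at ha
          omega
        · simp only [R]
          rw [coeff_C_mul, finsetSum_coeff, Finset.sum_eq_single (k, 1)]
          · rw [coeff_C_mul]
            have e : 2 * (k + 1) = 2 * k + 2 := by ring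
            rw [e, coeff_mul_add_eq_of_natDegree_le (hQ k le_rfl).1 (hP 1 le_rfl), hP1]
            have := (hQ k le_rfl).2.1
            simp [this, hk0]
            exact_mod_cast Nat.succ_ne_zero k
          · intro a ha hne
            refine coeff_eq_zero_of_natDegree_lt (lt_of_le_of_lt (hdeg a ha) ?_)
            simp only [Finset.mem_filter, Finset.HasAntidiagonal.mem_antidiagonal] at ha
            have : a.2 ≠ 1 := fun h2 => hne (Prod.ext (by simp; omega) h2)
            omega
          · intro hne
            simp at hne
        · have := (hE s hs).2.2 (k + 1)
          simp only [R]
          rw [eval_mul, eval_C, eval_finsetSum]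
          rw [mul_assoc, eq_inv_mul_iff_mul_eq₀ hk0, this]
          congr 1
          refine Finset.sum_congr rfl fun a ha => ?_
          simp only [Finset.mem_filter, Finset.HasAntidiagonal.mem_antidiagonal] at ha
          rw [(hQ a.1 (by omega)).2.2 s hs]
          simp [mul_assoc]
  obtain ⟨Q, hQ⟩ := key (n + 1)
  obtain ⟨h1, h2, h3⟩ := hQ (n + 1) le_rfl
  have : Q (n + 1) = 0 := by
    refine eq_zero_of_infinite_isRoot _ (hS.mono fun s hs => ?_)
    show IsRoot _ _
    rw [IsRoot.def, ← h3 s hs, (hE s hs).2.1]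
  rw [this] at h2
  simp at h2

end

noncomputable section
set_option linter.unusedSimpArgs false
set_option linter.unusedVariables false
variable {n : ℕ} {r : ℂ → ℂ → ℂ → T2 n} {rc : ℕ → ℂ → ℂ → T2 n}

/-! ### Traces of `r₀` -/

def tt (rc : ℕ → ℂ → ℂ → T2 n) (y z : ℂ) : Mat n := ptr1 (rc 0 y z)
def gn (rc : ℕ → ℂ → ℂ → T2 n) (y z : ℂ) : ℂ := (tt rc y z).trace / n
def prm (M : Mat n) : Mat n := M - (M.trace / n) • 1
def SS (r : ℂ → ℂ → ℂ → T2 n) (u y z : ℂ) : T2 n := r (-u) y z * r u y z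
/-- `∂₁ t` -/
def dt (rc : ℕ → ℂ → ℂ → T2 n) (y z : ℂ) : Mat n := ptr1 (d1r0 rc y z)

theorem Sol.HD_r0 (h : Sol r rc) {y z : ℂ} (hy : y ≠ z) : HD (fun x => rc 0 x z) (d1r0 rc y z) y :=
  fun i j => (h.r0_diff_1 hy i j).hasDerivAt
theorem HD.ptr1 {F : ℂ → T2 n} {F' : T2 n} {y : ℂ} (hF : HD F F' y) :
    HD (fun z => ptr1 (F z)) (ptr1 F') y := fun i j => by
  simp only [_root_.ptr1, Matrix.of_apply]
  exact HasDerivAt.fun_sum fun m _ => hF _ _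
theorem HD.trace {F : ℂ → Mat n} {F' : Mat n} {y : ℂ} (hF : HD F F' y) :
    HasDerivAt (fun z => (F z).trace) F'.trace y :=
  HasDerivAt.fun_sum fun m _ => hF _ _
theorem Sol.HD_tt (h : Sol r rc) {y z : ℂ} (hy : y ≠ z) : HD (fun x => tt rc x z) (dt rc y z) y :=
  (h.HD_r0 hy).ptr1
theorem Sol.gn_deriv (h : Sol r rc) {y z : ℂ} (hy : y ≠ z) :
    HasDerivAt (fun x => gn rc x z) ((dt rc y z).trace / n) y :=
  ((h.HD_tt hy).trace).div_const _
theorem trace_tendsto {α : Type*} {l : Filter α} {R : α → Mat n} {R0 : Mat n}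
    (hR : Tendsto R l (𝓝 R0)) : Tendsto (fun x => (R x).trace) l (𝓝 R0.trace) :=
  ((Continuous.matrix_trace (continuous_id (X := Mat n))).tendsto _).comp hR
theorem prm_tendsto {α : Type*} {l : Filter α} {R : α → Mat n} {R0 : Mat n}
    (hR : Tendsto R l (𝓝 R0)) : Tendsto (fun x => prm (R x)) l (𝓝 (prm R0)) :=
  hR.sub (((trace_tendsto hR).div_const _).smul tendsto_const_nhds)
theorem Sol.tt_cont_1 (h : Sol r rc) {y z : ℂ} (hy : y ≠ z) : Tendsto (fun x => tt rc x z) (𝓝 y) (𝓝 (tt rc y z)) :=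
  ptr1_tendsto (h.r0_cont_1 hy).tendsto
theorem Sol.tt_cont_2 (h : Sol r rc) {y z : ℂ} (hy : y ≠ z) : Tendsto (fun x => tt rc y x) (𝓝 z) (𝓝 (tt rc y z)) :=
  ptr1_tendsto (h.r0_cont_2 hy).tendsto
theorem Sol.gn_cont_1 (h : Sol r rc) {y z : ℂ} (hy : y ≠ z) : Tendsto (fun x => gn rc x z) (𝓝 y) (𝓝 (gn rc y z)) :=
  (trace_tendsto (h.tt_cont_1 hy)).div_const _
theorem Sol.gn_cont_2 (h : Sol r rc) {y z : ℂ} (hy : y ≠ z) : Tendsto (fun x => gn rc y x) (𝓝 z) (𝓝 (gn rc y z)) :=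
  (trace_tendsto (h.tt_cont_2 hy)).div_const _

theorem ptr1_Pm : ptr1 (Pm n) = 1 := by
  ext a b
  simp only [ptr1, Pm, Matrix.of_apply, Matrix.one_apply]
  simp [eq_comm]
theorem ptr1_smul (c : ℂ) (t : T2 n) : ptr1 (c • t) = c • ptr1 t := by
  ext a b; simp [ptr1, Finset.mul_sum]
theorem ptr1_add (s t : T2 n) : ptr1 (s + t) = ptr1 s + ptr1 t := by
  ext a b; simp [ptr1, Finset.sum_add_distrib]
theorem ptr1_kron (A B : Mat n) : ptr1 (A ⊗ₖ B) = A.trace • B := by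
  ext a b; simp [ptr1, Matrix.trace, Finset.sum_mul]
theorem trace_ptr1 (t : T2 n) : (ptr1 t).trace = t.trace := by
  simp only [ptr1, Matrix.trace, Matrix.diag, Matrix.of_apply, Fintype.sum_prod_type]
  rw [Finset.sum_comm]

/-- the pole of `gn` -/
theorem Sol.gn_pole (h : Sol r rc) {y c : ℂ} {k : ℕ}
    (hc : Tendsto (fun z => (z - y) ^ k • rc 0 y z) (𝓝[≠] y) (𝓝 (c • Pm n))) :
    Tendsto (fun z => (z - y) ^ k * gn rc y z) (𝓝[≠] y) (𝓝 c) := by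
  have hn : (n : ℂ) ≠ 0 := by exact_mod_cast h.n0
  have := (trace_tendsto (ptr1_tendsto hc)).div_const (n : ℂ)
  simp only [ptr1_smul, ptr1_Pm, Matrix.trace_smul, Matrix.trace_one, Fintype.card_fin, smul_eq_mul] at this
  rw [mul_div_assoc, div_self hn, mul_one] at this
  refine this.congr fun z => ?_
  rw [gn, tt, mul_div_assoc]

def Y1 (r : ℂ → ℂ → ℂ → T2 n) (rc : ℕ → ℂ → ℂ → T2 n) (u y : ℂ) : Prop :=
  ∃ c : ℂ, ∃ K : Mat n, Tendsto (fun z => (z - y) * gn rc y z) (𝓝[≠] y) (𝓝 c) ∧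
      ∀ z, z ≠ y → SS r u y z = c • ((1 : Mat n) ⊗ₖ dt rc y z) + K ⊗ₖ (1 : Mat n)

theorem Sol.Y1_dense (h : Sol r rc) {u : ℂ} (hu : GoodU r u) : Dense {y | Y1 r rc u y} := by
  have hn : (n : ℂ) ≠ 0 := by exact_mod_cast h.n0
  obtain ⟨ys, hys⟩ := h.good_y hu
  have hu0 : u ≠ 0 := hu.1
  intro y0
  by_contra hcl
  rw [mem_closure_iff_nhds] at hcl
  push Not at hcl
  obtain ⟨U, hU, hUe⟩ := hcl
  obtain ⟨y0', hy0', hy0s⟩ : ∃ y0', U ∈ 𝓝 y0' ∧ y0' ≠ ys := by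
    have h1 : ∀ᶠ y in 𝓝[≠] y0, U ∈ 𝓝 y := nhdsWithin_le_nhds (eventually_mem_nhds_iff.2 hU)
    by_cases hy : y0 = ys
    · obtain ⟨y, hy1, hy2⟩ := (h1.and self_mem_nhdsWithin).exists
      exact ⟨y, hy1, hy ▸ hy2⟩
    · exact ⟨y0, hU, hy⟩
  obtain ⟨p, hp⟩ : ∃ p, ∀ᶠ y in 𝓝 p, y ∈ U ∧ y ≠ ys ∧ (resh (r u y ys)).det ≠ 0 := by
    have h1 : ∀ᶠ y in 𝓝[≠] y0', y ∈ U ∧ y ≠ ys ∧ (resh (r u y ys)).det ≠ 0 :=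
      Filter.Eventually.and (mem_nhdsWithin_of_mem_nhds hy0') (hys y0' hy0s)
    obtain ⟨p, hp1, hp2⟩ := ((eventually_eventually_nhdsWithin.2 h1).and self_mem_nhdsWithin).exists
    refine ⟨p, ?_⟩
    rwa [IsOpen.nhdsWithin_eq isOpen_compl_singleton hp2] at hp1
  obtain ⟨ρ, hρ, hball⟩ := Metric.eventually_nhds_iff_ball.1 hp
  have key : ∀ y ∈ Metric.ball p ρ, ∃ k : ℕ, 1 ≤ k ∧ ∃ c : ℂ, c ≠ 0 ∧
      Tendsto (fun z => (z - y) ^ k * gn rc y z) (𝓝[≠] y) (𝓝 c) ∧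
      ∀ z z', z ≠ y → z' ≠ y → (dt rc y z).trace = (dt rc y z').trace := by
    intro y hy
    obtain ⟨hyU, hyys, hd⟩ := hball y hy
    obtain ⟨k, hk, c, K, hkc, ht, he⟩ := h.merge hu0 hyys hd
    have hk1 : k ≠ 1 := by
      rintro rfl
      have : y ∈ U ∩ {y | Y1 r rc u y} := by
        refine ⟨hyU, c, K, by simpa using h.gn_pole ht, fun z hz => ?_⟩
        have := he z hz
        simp only [if_true, one_smul] at this
        exact this.symm
      rw [hUe] at this
      exact this
    have hc0 : c ≠ 0 := hkc.resolve_left hk1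
    refine ⟨k, hk, c, hc0, h.gn_pole ht, ?_⟩
    have : ∀ z, z ≠ y → (dt rc y z).trace = - K.trace / c := by
      intro z hz
      have := congrArg Matrix.trace (he z hz)
      simp only [hk1, if_false, zero_smul, Matrix.trace_add, Matrix.trace_smul, Matrix.trace_kronecker,
        Matrix.trace_one, Fintype.card_fin, smul_eq_mul, Matrix.trace_zero] at this
      have e : (n : ℂ) * (c * (dt rc y z).trace + K.trace) = 0 := by rw [← this]; simp only [dt]; ring
      have e2 := (mul_eq_zero.1 e).resolve_left hn
      rw [eq_div_iff hc0]
      linear_combination e2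
    intro z z' hz hz'
    rw [this z hz, this z' hz']
  obtain ⟨k, hk, c, hc0, hlim, -⟩ := key p (Metric.mem_ball_self hρ)
  set q : ℂ := p + ((ρ / 2 : ℝ) : ℂ) with hq
  have hqb : q ∈ Metric.ball p ρ := by
    rw [Metric.mem_ball, hq, dist_eq_norm, add_sub_cancel_left, Complex.norm_real, Real.norm_eq_abs,
      abs_of_pos (by positivity)]
    linarith
  have hqp : q ≠ p := by
    rw [hq]; simp only [ne_eq, add_eq_left, Complex.ofReal_eq_zero]; positivity
  have hysb : ∀ y ∈ Metric.ball p ρ, y ≠ ys := fun y hy => (hball y hy).2.1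
  have hconst : ∀ ε : ℝ, 0 < ε → gn rc p (p - ε) - gn rc p ys = gn rc q (p - ε) - gn rc q ys := by
    intro ε hε
    let D : Set ℂ := Metric.ball p ρ ∩ {y | p.re - ε < y.re}
    have hDo : IsOpen D := Metric.isOpen_ball.inter (isOpen_lt continuous_const Complex.continuous_re)
    have hDc : IsPreconnected D :=
      ((convex_ball p ρ).inter (convex_halfSpace_re_gt _)).isPreconnected
    have hne : ∀ y ∈ D, y ≠ p - ε := by
      rintro y ⟨-, hy⟩ rfl
      simp at hy
    have hder : ∀ y ∈ D, HasDerivAt (fun y => gn rc y (p - ε) - gn rc y ys) 0 y := by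
      intro y hy
      have := (h.gn_deriv (hne y hy)).sub (h.gn_deriv (hysb y hy.1))
      obtain ⟨_, _, _, _, _, h3⟩ := key y hy.1
      rw [h3 _ _ (hne y hy).symm (hysb y hy.1).symm, sub_self] at this
      exact this
    refine hDo.is_const_of_deriv_eq_zero hDc (fun y hy => (hder y hy).differentiableAt.differentiableWithinAt)
      (fun y hy => (hder y hy).deriv) ⟨Metric.mem_ball_self hρ, ?_⟩ ⟨hqb, ?_⟩
    · simpa using hε
    · simp [hq]; linarith
  have hmap : Tendsto (fun ε : ℝ => p - (ε : ℂ)) (𝓝[>] 0) (𝓝[≠] p) := by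
    have hcont : Continuous (fun ε : ℝ => p - (ε : ℂ)) := by fun_prop
    have := hcont.tendsto 0
    simp only [Complex.ofReal_zero, sub_zero] at this
    refine tendsto_nhdsWithin_iff.2 ⟨this.mono_left nhdsWithin_le_nhds, ?_⟩
    filter_upwards [self_mem_nhdsWithin] with ε hε
    have hε : 0 < ε := hε
    simp [hε.ne']
  have l1 := hlim.comp hmap
  have l2 : Tendsto (fun z => (z - p) ^ k * (gn rc q z - gn rc q ys + gn rc p ys)) (𝓝[≠] p) (𝓝 (0 * (gn rc q p - gn rc q ys + gn rc p ys))) := by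
    have tz : Tendsto (fun z : ℂ => (z - p) ^ k) (𝓝[≠] p) (𝓝 0) := by
      have := (hasDerivAt_pow_sub k hk p).continuousAt.tendsto
      simp only [sub_self] at this
      rw [zero_pow (by omega)] at this
      exact this.mono_left nhdsWithin_le_nhds
    exact tz.mul ((((h.gn_cont_2 hqp).mono_left nhdsWithin_le_nhds).sub_const _).add_const _)
  rw [zero_mul] at l2
  have l3 := l2.comp hmap
  refine hc0 (tendsto_nhds_unique_of_eventuallyEq l1 l3 ?_)
  filter_upwards [self_mem_nhdsWithin] with ε hε
  have := hconst ε hε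
  simp only [Function.comp]
  rw [← this]; ring

end

noncomputable section
set_option linter.unusedSimpArgs false
set_option linter.unusedVariables false
variable {n : ℕ} {r : ℂ → ℂ → ℂ → T2 n} {rc : ℕ → ℂ → ℂ → T2 n}

theorem eq_of_dense {X : Type*} [TopologicalSpace X] [T2Space X] {D : Set ℂ} (hD : Dense D)
    {F G : ℂ → X} {x : ℂ} (hF : Tendsto F (𝓝 x) (𝓝 (F x))) (hG : Tendsto G (𝓝 x) (𝓝 (G x)))
    (hU : ∀ᶠ y in 𝓝 x, y ∈ D → F y = G y) : F x = G x := by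
  have : (𝓝[D] x).NeBot := mem_closure_iff_nhdsWithin_neBot.1 (hD x)
  refine tendsto_nhds_unique_of_eventuallyEq (hF.mono_left (nhdsWithin_le_nhds (s := D)))
    (hG.mono_left nhdsWithin_le_nhds) ?_
  rw [EventuallyEq, eventually_nhdsWithin_iff]
  exact hU

theorem ne_eventually {x z : ℂ} (h : x ≠ z) : ∀ᶠ y in 𝓝 x, y ≠ z := isOpen_ne.mem_nhds h

theorem tflip_kron (A B : Mat n) : tflip (A ⊗ₖ B) = B ⊗ₖ A := by
  ext ⟨a, b⟩ ⟨a', b'⟩; simp [tflip_apply, mul_comm]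
theorem tflip_add (s t : T2 n) : tflip (s + t) = tflip s + tflip t := rfl
theorem tflip_smul (c : ℂ) (t : T2 n) : tflip (c • t) = c • tflip t := rfl

theorem prm_add (A B : Mat n) : prm (A + B) = prm A + prm B := by
  simp only [prm, Matrix.trace_add, add_div, add_smul]; abel
theorem prm_smul (c : ℂ) (A : Mat n) : prm (c • A) = c • prm A := by
  simp only [prm, Matrix.trace_smul, smul_sub, smul_smul, smul_eq_mul, mul_div_assoc]
theorem prm_one (hn : n ≠ 0) : prm (1 : Mat n) = 0 := by
  have : (n : ℂ) ≠ 0 := by exact_mod_cast hn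
  simp [prm, this]
theorem trace_prm (hn : n ≠ 0) (A : Mat n) : (prm A).trace = 0 := by
  have : (n : ℂ) ≠ 0 := by exact_mod_cast hn
  simp [prm, this]

theorem Sol.SS_flip (h : Sol r rc) {u y z : ℂ} (hu : u ≠ 0) (hy : y ≠ z) :
    tflip (SS r u y z) = SS r (-u) z y := by
  rw [SS, SS, tflip_mul, h.flip hu hy, h.flip (neg_ne_zero.2 hu) hy]
  simp

theorem Sol.SS_cont_2 (h : Sol r rc) {u y z : ℂ} (hu : u ≠ 0) (hy : y ≠ z) :
    Tendsto (fun x => SS r u y x) (𝓝 z) (𝓝 (SS r u y z)) :=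
  (h.cont_2 (neg_ne_zero.2 hu) hy).tendsto.mul (h.cont_2 hu hy).tendsto
theorem Sol.SS_cont_1 (h : Sol r rc) {u y z : ℂ} (hu : u ≠ 0) (hy : y ≠ z) :
    Tendsto (fun x => SS r u x z) (𝓝 y) (𝓝 (SS r u y z)) :=
  (h.cont_1 (neg_ne_zero.2 hu) hy).tendsto.mul (h.cont_1 hu hy).tendsto

theorem Sol.exists_ab (h : Sol r rc) {u : ℂ} (hu : GoodU r u) : ∃ ab : ℂ → Mat n,
    (∀ z, Tendsto ab (𝓝 z) (𝓝 (ab z))) ∧ (∀ z, (ab z).trace = 0) ∧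
    ∀ y, Y1 r rc u y → ∃ c : ℂ, Tendsto (fun z => (z - y) * gn rc y z) (𝓝[≠] y) (𝓝 c) ∧
      ∀ z, z ≠ y → c • prm (dt rc y z) = ab z ∧ ∃ K : Mat n,
        SS r u y z = (1 : Mat n) ⊗ₖ ab z + K ⊗ₖ (1 : Mat n) := by
  have hn : (n : ℂ) ≠ 0 := by exact_mod_cast h.n0
  have hu0 : u ≠ 0 := hu.1
  have hD := h.Y1_dense (h.good_neg hu)
  have ind : ∀ y y' z, y ≠ z → y' ≠ z → prm (ptr1 (SS r u y z)) = prm (ptr1 (SS r u y' z)) := by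
    intro y y' z hy hy'
    refine eq_of_dense hD (F := fun z => prm (ptr1 (SS r u y z))) (G := fun z => prm (ptr1 (SS r u y' z)))
      (prm_tendsto (ptr1_tendsto (h.SS_cont_2 hu0 hy))) (prm_tendsto (ptr1_tendsto (h.SS_cont_2 hu0 hy'))) ?_
    filter_upwards [ne_eventually hy.symm, ne_eventually hy'.symm] with z hz hz' hzD
    obtain ⟨c, K, -, hs⟩ := hzD
    have : ∀ y, y ≠ z → prm (ptr1 (SS r u y z)) = (n : ℂ) • prm K := by
      intro y hy
      have e1 := h.SS_flip (neg_ne_zero.2 hu0) hy.symm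
      rw [neg_neg, hs y hy] at e1
      rw [← e1, tflip_add, tflip_smul, tflip_kron, tflip_kron, ptr1_add, ptr1_smul, ptr1_kron, ptr1_kron,
        prm_add, prm_smul, prm_smul, prm_one h.n0, prm_smul]
      simp
    simp only [this y hz.symm, this y' hz'.symm]
  have hz1 : ∀ z : ℂ, z + 1 ≠ z := by simp
  refine ⟨fun z => (n : ℂ)⁻¹ • prm (ptr1 (SS r u (z + 1) z)), ?_, ?_, ?_⟩
  · intro z
    have := (prm_tendsto (ptr1_tendsto (h.SS_cont_2 hu0 (hz1 z)))).const_smul (n : ℂ)⁻¹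
    refine this.congr' ?_
    filter_upwards [ne_eventually (hz1 z).symm] with x hx
    rw [ind _ _ _ hx.symm (hz1 x)]
  · intro z
    simp [trace_prm h.n0]
  · rintro y ⟨c, K, hc, hs⟩
    refine ⟨c, hc, fun z hz => ?_⟩
    have e : c • prm (dt rc y z) = (n : ℂ)⁻¹ • prm (ptr1 (SS r u (z + 1) z)) := by
      rw [ind _ _ _ (hz1 z) hz.symm, hs z hz, ptr1_add, ptr1_smul, ptr1_kron, ptr1_kron,
        prm_add, prm_smul, prm_smul, prm_smul, prm_one h.n0]
      simp only [Matrix.trace_one, Fintype.card_fin, smul_zero, add_zero, smul_smul]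
      congr 1
      field_simp
    refine ⟨e, K + (c * ((dt rc y z).trace / n)) • 1, ?_⟩
    beta_reduce
    rw [← e, hs z hz, prm, Matrix.add_kronecker, smul_sub, sub_eq_add_neg, Matrix.kronecker_add]
    rw [smul_smul, ← neg_smul, Matrix.kronecker_smul, Matrix.kronecker_smul, Matrix.smul_kronecker]
    module

end

noncomputable section
set_option linter.unusedSimpArgs false
set_option linter.unusedVariables false
variable {n : ℕ} {r : ℂ → ℂ → ℂ → T2 n} {rc : ℕ → ℂ → ℂ → T2 n}

theorem HD.prm {F : ℂ → Mat n} {F' : Mat n} {y : ℂ} (hF : HD F F' y) :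
    HD (fun z => prm (F z)) (prm F') y := by
  have := hF.sub (HD.smul (f := fun z => (F z).trace / n) (hF.trace.div_const _) (HD.const 1 y))
  rw [smul_zero, add_zero] at this
  exact this

theorem HD.trace_mul {F : ℂ → Mat n} {F' : Mat n} {y : ℂ} (B : Mat n) (hF : HD F F' y) :
    HasDerivAt (fun z => (B * F z).trace) (B * F').trace y := by
  have := ((HD.const B y).mul hF).trace
  simpa using this

theorem exists_B0 {A : Mat n} (hA : A ≠ 0) (ht : A.trace = 0) :
    ∃ B : Mat n, B.trace = 0 ∧ (B * A).trace = 1 := by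
  have h1 : (Aᴴ * A).trace ≠ 0 := by
    open scoped ComplexOrder in
    exact fun e => hA (Matrix.trace_conjTranspose_mul_self_eq_zero_iff.1 e)
  refine ⟨((Aᴴ * A).trace)⁻¹ • Aᴴ, ?_, ?_⟩
  · simp [Matrix.trace_conjTranspose, ht]
  · rw [Matrix.smul_mul, Matrix.trace_smul, smul_eq_mul, inv_mul_cancel₀ h1]

theorem trace_mul_prm {B : Mat n} (hB : B.trace = 0) (A : Mat n) : (B * prm A).trace = (B * A).trace := by
  simp [prm, Matrix.mul_sub, hB]

/-- the data derived from a non-scalar `SS`, to be contradicted -/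
structure Ctr (rc : ℕ → ℂ → ℂ → T2 n) (ab : ℂ → Mat n) (z0 : ℂ) (B0 : Mat n) (Y : ℂ → ℂ)
    (b : ℂ → Mat n) (D : Set ℂ) : Prop where
  abc : ∀ z, Tendsto ab (𝓝 z) (𝓝 (ab z))
  abt : ∀ z, (ab z).trace = 0
  B0t : B0.trace = 0
  B0a : (B0 * ab z0).trace = 1
  Yd : ∀ y, y ≠ z0 → DifferentiableAt ℂ Y y
  Ye : ∀ y, y ≠ z0 → Y y = (B0 * tt rc y z0).trace
  rep : ∀ y z, y ≠ z → y ≠ z0 → tt rc y z = Y y • ab z + b z + gn rc y z • 1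
  dense : Dense D
  pole : ∀ y ∈ D, y ≠ z0 → ∃ c : ℂ, Tendsto (fun z => (z - y) * gn rc y z) (𝓝[≠] y) (𝓝 c) ∧
    c * deriv Y y = 1

theorem Sol.exists_ctr (h : Sol r rc) {u : ℂ} (hu : GoodU r u) {ab : ℂ → Mat n}
    (hc : ∀ z, Tendsto ab (𝓝 z) (𝓝 (ab z))) (ht : ∀ z, (ab z).trace = 0)
    (hY : ∀ y, Y1 r rc u y → ∃ c : ℂ, Tendsto (fun z => (z - y) * gn rc y z) (𝓝[≠] y) (𝓝 c) ∧
      ∀ z, z ≠ y → c • prm (dt rc y z) = ab z) {z0 : ℂ} (h0 : ab z0 ≠ 0) :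
    ∃ B0 Y b D, Ctr rc ab z0 B0 Y b D := by
  obtain ⟨B0, hB, hBa⟩ := exists_B0 h0 (ht z0)
  have hD := h.Y1_dense hu
  set Y : ℂ → ℂ := fun y => (B0 * tt rc y z0).trace with hYdef
  have hYder : ∀ y, y ≠ z0 → HasDerivAt Y (B0 * dt rc y z0).trace y := fun y hy =>
    (h.HD_tt hy).trace_mul B0
  have hpole : ∀ y, Y1 r rc u y → y ≠ z0 → ∃ c : ℂ,
      Tendsto (fun z => (z - y) * gn rc y z) (𝓝[≠] y) (𝓝 c) ∧ c * (B0 * dt rc y z0).trace = 1 ∧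
      ∀ z, z ≠ y → c • prm (dt rc y z) = ab z := by
    intro y hy hy0
    obtain ⟨c, h1, h2⟩ := hY y hy
    refine ⟨c, h1, ?_, h2⟩
    have := h2 z0 hy0.symm
    rw [← this, Matrix.mul_smul, Matrix.trace_smul, trace_mul_prm hB, smul_eq_mul] at hBa
    exact hBa
  have key : ∀ z y y', y ≠ z → y ≠ z0 → y' ≠ z → y' ≠ z0 →
      prm (tt rc y z) - Y y • ab z = prm (tt rc y' z) - Y y' • ab z := by
    intro z y y' h1 h2 h1' h2'
    ext i j
    let s : Set ℂ := {z, z0}ᶜ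
    have hso : IsOpen s := (Set.toFinite {z, z0}).isClosed.isOpen_compl
    have hsc : IsPreconnected s :=
      (Set.Countable.isConnected_compl_of_one_lt_rank (by simp) (Set.toFinite {z, z0}).countable).isPreconnected
    have hs : ∀ x, x ∈ s ↔ x ≠ z ∧ x ≠ z0 := by intro x; simp [s]
    have hd : ∀ x ∈ s, HasDerivAt (fun x => (prm (tt rc x z) - Y x • ab z) i j)
        ((prm (dt rc x z) - (B0 * dt rc x z0).trace • ab z) i j) x := by
      intro x hx
      have := ((h.HD_tt ((hs x).1 hx).1).prm.sub (HD.smul (hYder x ((hs x).1 hx).2) (HD.const (ab z) x))) i j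
      simpa using this
    have hdo : DifferentiableOn ℂ (fun x => (prm (tt rc x z) - Y x • ab z) i j) s :=
      fun x hx => (hd x hx).differentiableAt.differentiableWithinAt
    refine hso.is_const_of_deriv_eq_zero hsc hdo ?_ ((hs y).2 ⟨h1, h2⟩) ((hs y').2 ⟨h1', h2'⟩)
    intro x hx
    refine eq_of_dense hD (F := deriv _) (G := 0)
      ((hdo.deriv hso).continuousOn.continuousAt (hso.mem_nhds hx)).tendsto tendsto_const_nhds ?_
    filter_upwards [hso.mem_nhds hx] with x hx hxD
    rw [(hd x hx).deriv]
    obtain ⟨c, -, c1, c2⟩ := hpole x hxD ((hs x).1 hx).2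
    have c2 := c2 z ((hs x).1 hx).1.symm
    rw [← c2, smul_smul, mul_comm, c1, one_smul, sub_self]
    rfl
  have hex : ∀ z, ∃ p : ℂ, p ≠ z ∧ p ≠ z0 := by
    intro z
    obtain ⟨p, hp⟩ := Infinite.exists_notMem_finset ({z, z0} : Finset ℂ)
    exact ⟨p, by simpa using hp⟩
  choose p hp1 hp2 using hex
  refine ⟨B0, Y, fun z => prm (tt rc (p z) z) - Y (p z) • ab z, {y | Y1 r rc u y}, hc, ht, hB, hBa,
    fun y hy => (hYder y hy).differentiableAt, fun y hy => rfl, ?_, hD, ?_⟩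
  · intro y z hyz hy0
    rw [← key z y (p z) hyz hy0 (hp1 z) (hp2 z)]
    simp only [prm, gn]
    abel
  · intro y hy hy0
    obtain ⟨c, c1, c2, -⟩ := hpole y hy hy0
    exact ⟨c, c1, by rw [(hYder y hy0).deriv]; exact c2⟩

end

noncomputable section
set_option linter.unusedSimpArgs false
set_option linter.unusedVariables false
variable {n : ℕ} {r : ℂ → ℂ → ℂ → T2 n} {rc : ℕ → ℂ → ℂ → T2 n}

/-- partial trace over the second factor -/
def ptr2 (t : T2 n) : Mat n := Matrix.of fun a b => ∑ m, t (a, m) (b, m)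
/-- partial trace over the second and third factors -/
def pt23 (T : T3 n) : Mat n := Matrix.of fun a b => ∑ m, ∑ k, T (a, m, k) (b, m, k)

theorem pt23_add (S T : T3 n) : pt23 (S + T) = pt23 S + pt23 T := by
  ext i j; simp [pt23, Finset.sum_add_distrib]
theorem pt23_sub (S T : T3 n) : pt23 (S - T) = pt23 S - pt23 T := by
  ext i j; simp [pt23, Finset.sum_sub_distrib]
theorem pt23_neg (T : T3 n) : pt23 (-T) = - pt23 T := by
  ext i j; simp [pt23]
theorem pt23_12 (s : T2 n) : pt23 (emb12 s) = (n : ℂ) • ptr2 s := by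
  ext i j; simp [pt23, ptr2, emb12, Finset.mul_sum]
theorem pt23_13 (s : T2 n) : pt23 (emb13 s) = (n : ℂ) • ptr2 s := by
  ext i j; simp [pt23, ptr2, emb13, Finset.mul_sum]
theorem pt23_23 (s : T2 n) : pt23 (emb23 s) = s.trace • 1 := by
  ext i j
  simp only [pt23, emb23, Matrix.of_apply, Matrix.trace, Matrix.diag, Matrix.smul_apply, Fintype.sum_prod_type,
    Matrix.one_apply, Finset.sum_mul, smul_eq_mul]
theorem pt23_12_23 (s t : T2 n) : pt23 (emb12 s * emb23 t) = ctr2 s (ptr2 t) := by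
  ext i j
  simp only [pt23, ctr2, ptr2, Matrix.of_apply, mul_12_23, Finset.mul_sum]
  refine Finset.sum_congr rfl fun a _ => ?_
  rw [Finset.sum_comm]
theorem sum_rev3 (f : Fin n → Fin n → Fin n → ℂ) :
    ∑ a, ∑ b, ∑ c, f a b c = ∑ c, ∑ b, ∑ a, f a b c := by
  rw [Finset.sum_comm]
  simp_rw [Finset.sum_comm (γ := Fin n) (f := fun a c => f a _ c)]
  rw [Finset.sum_comm]
theorem pt23_13_12 (s t : T2 n) : pt23 (emb13 s * emb12 t) = ptr2 s * ptr2 t := by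
  ext i j
  simp only [pt23, ptr2, Matrix.of_apply, mul_13_12]
  simp only [Matrix.mul_apply, Matrix.of_apply, Finset.mul_sum, Finset.sum_mul]
  rw [sum_rot]
theorem pt23_23_13 (s t : T2 n) : pt23 (emb23 t * emb13 s) = ctr2 s (ptr1 t) := by
  ext i j
  simp only [pt23, ctr2, ptr1, Matrix.of_apply, mul_23_13, Finset.mul_sum]
  rw [sum_rev3]
  refine Finset.sum_congr rfl fun a _ => Finset.sum_congr rfl fun b _ => Finset.sum_congr rfl fun m _ => ?_
  ring
theorem Sol.ptr2_r0 (h : Sol r rc) {y z : ℂ} (hy : y ≠ z) : ptr2 (rc 0 y z) = - tt rc z y := by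
  ext i j
  simp only [ptr2, tt, ptr1, Matrix.of_apply, Matrix.neg_apply]
  rw [← Finset.sum_neg_distrib]
  exact Finset.sum_congr rfl fun m _ => h.r0_flip_apply hy _ _ _ _
theorem Sol.gn_flip (h : Sol r rc) {y z : ℂ} (hy : y ≠ z) : gn rc y z = - gn rc z y := by
  have : (ptr2 (rc 0 y z)).trace = (tt rc y z).trace := by
    rw [tt, trace_ptr1]
    simp only [ptr2, Matrix.trace, Matrix.diag, Matrix.of_apply, Fintype.sum_prod_type]
  rw [gn, ← this, h.ptr2_r0 hy, gn, Matrix.trace_neg, neg_div]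

theorem ctr2_add (s : T2 n) (A B : Mat n) : ctr2 s (A + B) = ctr2 s A + ctr2 s B := by
  ext i j; simp [ctr2, mul_add, Finset.sum_add_distrib]
theorem ctr2_smul (s : T2 n) (c : ℂ) (A : Mat n) : ctr2 s (c • A) = c • ctr2 s A := by
  ext i j; simp only [ctr2, Matrix.of_apply, Matrix.smul_apply, smul_eq_mul, Finset.mul_sum]
  refine Finset.sum_congr rfl fun a _ => Finset.sum_congr rfl fun a _ => ?_
  ring
theorem ctr2_one (s : T2 n) : ctr2 s 1 = ptr2 s := by
  ext i j; simp [ctr2, ptr2, Matrix.one_apply]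
theorem ctr2_tendsto {α : Type*} {l : Filter α} {R : α → T2 n} {R0 : T2 n} {A : α → Mat n} {A0 : Mat n}
    (hR : Tendsto R l (𝓝 R0)) (hA : Tendsto A l (𝓝 A0)) :
    Tendsto (fun x => ctr2 (R x) (A x)) l (𝓝 (ctr2 R0 A0)) := by
  refine tendsto_pi_nhds.2 fun i => tendsto_pi_nhds.2 fun j => ?_
  simp only [ctr2, Matrix.of_apply]
  refine tendsto_finsetSum _ fun m _ => tendsto_finsetSum _ fun k _ => ?_
  exact ((tendsto_pi_nhds.1 (tendsto_pi_nhds.1 hR _) _)).mul ((tendsto_pi_nhds.1 (tendsto_pi_nhds.1 hA _) _))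

end

noncomputable section
set_option linter.unusedSimpArgs false
set_option linter.unusedVariables false
variable {n : ℕ} {r : ℂ → ℂ → ℂ → T2 n} {rc : ℕ → ℂ → ℂ → T2 n}

variable {ab : ℂ → Mat n} {z0 : ℂ} {B0 : Mat n} {Y : ℂ → ℂ} {b : ℂ → Mat n} {D : Set ℂ}

theorem Ctr.b0 (h : Sol r rc) (C : Ctr rc ab z0 B0 Y b D) : (b z0 * B0).trace = 0 := by
  have hz : z0 + 1 ≠ z0 := by simp
  have e := C.Ye _ hz
  rw [C.rep _ _ hz hz, Matrix.mul_add, Matrix.mul_add, Matrix.mul_smul, Matrix.mul_smul, Matrix.trace_add,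
    Matrix.trace_add, Matrix.trace_smul, Matrix.trace_smul, C.B0a, Matrix.mul_one, C.B0t] at e
  rw [Matrix.trace_mul_comm]
  simp only [smul_eq_mul] at e
  linear_combination -e

theorem Ctr.raw (h : Sol r rc) (C : Ctr rc ab z0 B0 Y b D) : ∃ l m ν : ℂ → ℂ, ∃ α β₁ β₂ γ : ℂ,
    (∀ y, y ≠ z0 → Tendsto l (𝓝 y) (𝓝 (l y))) ∧ ∀ y z, y ≠ z → y ≠ z0 → z ≠ z0 →
    gn rc y z * (Y y - Y z) = - Y z * l y - Y y * l z - m y - m z + n * ν y + n * ν z - α * Y y * Y z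
      - Y z * β₁ - Y y * β₂ - γ - gn rc z z0 * Y y - gn rc y z0 * Y z := by
  refine ⟨fun y => (ctr2 (rc 0 z0 y) (ab y) * B0).trace, fun y => (ctr2 (rc 0 z0 y) (b y) * B0).trace,
    fun y => (ptr2 (r1m r rc z0 y) * B0).trace, (ab z0 * ab z0 * B0).trace, (ab z0 * b z0 * B0).trace,
    (b z0 * ab z0 * B0).trace, (b z0 * b z0 * B0).trace, ?_, ?_⟩
  · intro y hy
    exact trace_tendsto ((ctr2_tendsto (h.r0_cont_2 hy.symm).tendsto (C.abc y)).mul tendsto_const_nhds)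
  intro y z hyz hy hz
  have e := congrArg (fun T => (pt23 T * B0).trace) (h.L3 hy.symm hz.symm hyz)
  have hone : ∀ y, y ≠ z0 → (ptr2 (rc 0 z0 y) * B0).trace = - Y y := by
    intro y hy
    rw [h.ptr2_r0 hy.symm, C.Ye y hy, Matrix.neg_mul, Matrix.trace_neg, Matrix.trace_mul_comm]
  have ha0 : (ab z0 * B0).trace = 1 := by rw [Matrix.trace_mul_comm, C.B0a]
  have hb0 := C.b0 h
  simp only [pt23_sub, pt23_neg, pt23_add, pt23_12_23, pt23_13_12, pt23_23_13, pt23_12, pt23_13, pt23_23] at e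
  rw [h.ptr2_r0 hyz, h.ptr2_r0 hz.symm, h.ptr2_r0 hy.symm, neg_mul_neg] at e
  have e1 : ptr1 (rc 0 y z) = Y y • ab z + b z + gn rc y z • 1 := C.rep y z hyz hy
  rw [e1, C.rep z y hyz.symm hz, C.rep z z0 hz hz, C.rep y z0 hy hy, h.gn_flip hyz.symm] at e
  rw [← neg_one_smul ℂ (Y z • ab y + b y + -gn rc y z • (1 : Mat n))] at e
  simp only [ctr2_add, ctr2_smul, ctr2_one, Matrix.add_mul, Matrix.mul_add, Matrix.sub_mul, Matrix.smul_mul,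
    Matrix.mul_smul, Matrix.neg_mul, Matrix.one_mul, Matrix.mul_one, Matrix.trace_add, Matrix.trace_sub,
    Matrix.trace_neg, Matrix.trace_smul, smul_eq_mul, hone y hy, hone z hz, ha0, hb0, C.B0t] at e
  linear_combination -e

theorem Ctr.raw2 (h : Sol r rc) (C : Ctr rc ab z0 B0 Y b D) : ∃ A B : ℂ → ℂ,
    (∀ y, y ≠ z0 → Tendsto B (𝓝 y) (𝓝 (B y))) ∧ ∀ y z, y ≠ z → y ≠ z0 → z ≠ z0 →
    gn rc y z * (Y y - Y z) = A y + A z + Y z * B y + Y y * B z := by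
  obtain ⟨l, m, ν, α, β₁, β₂, γ, hl, hr⟩ := C.raw h
  refine ⟨fun y => - m y + n * ν y - γ / 2, fun y => - l y - gn rc y z0 - (β₁ + β₂) / 2 - α * Y y / 2, ?_, ?_⟩
  · intro y hy
    exact (((hl y hy).neg.sub (h.gn_cont_1 hy)).sub_const _).sub
      (((C.Yd y hy).continuousAt.tendsto.const_mul α).div_const 2)
  · intro y z hyz hy hz
    have e1 := hr y z hyz hy hz
    have e2 := hr z y hyz.symm hz hy
    rw [h.gn_flip hyz.symm] at e2
    linear_combination (e1 + e2) / 2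

theorem Ctr.gn_eq (h : Sol r rc) (C : Ctr rc ab z0 B0 Y b D) : ∃ B : ℂ → ℂ,
    ∀ y z, y ≠ z → y ≠ z0 → z ≠ z0 →
    gn rc y z * (Y y - Y z) = - 1 - (Y y - Y z) * (B y - B z) := by
  obtain ⟨A, B, hB, hr⟩ := C.raw2 h
  have hYc : ∀ y, y ≠ z0 → Tendsto Y (𝓝 y) (𝓝 (Y y)) := fun y hy => (C.Yd y hy).continuousAt.tendsto
  have hA : ∀ y, y ≠ z0 → Tendsto A (𝓝 y) (𝓝 (A y)) := by
    intro y hy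
    obtain ⟨z, hz⟩ := Infinite.exists_notMem_finset ({y, z0} : Finset ℂ)
    simp only [Finset.mem_insert, Finset.mem_singleton, not_or] at hz
    have l1 : Tendsto (fun y => gn rc y z * (Y y - Y z) - A z - Y z * B y - Y y * B z) (𝓝 y)
        (𝓝 (gn rc y z * (Y y - Y z) - A z - Y z * B y - Y y * B z)) :=
      (((((h.gn_cont_1 (Ne.symm hz.1)).mul ((hYc y hy).sub_const _)).sub_const _).sub ((hB y hy).const_mul _)).sub
        ((hYc y hy).mul_const _))
    have e : ∀ x, x ≠ z → x ≠ z0 → gn rc x z * (Y x - Y z) - A z - Y z * B x - Y x * B z = A x := by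
      intro x hx hx0
      rw [hr x z hx hx0 hz.2]; ring
    rw [e y (Ne.symm hz.1) hy] at l1
    refine l1.congr' ?_
    filter_upwards [ne_eventually (Ne.symm hz.1), ne_eventually hy] with x hx hx0
    exact e x hx hx0
  have hdiag : ∀ y, y ≠ z0 → 2 * A y + 2 * (Y y * B y) = -1 := by
    intro y hy
    refine eq_of_dense C.dense (F := fun y => 2 * A y + 2 * (Y y * B y)) (G := fun _ => -1)
      (((hA y hy).const_mul 2).add (((hYc y hy).mul (hB y hy)).const_mul 2)) tendsto_const_nhds ?_
    filter_upwards [ne_eventually hy] with y hy hyD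
    obtain ⟨c, c1, c2⟩ := C.pole y hyD hy
    have hs := (hasDerivAt_iff_tendsto_slope.1 (C.Yd y hy).hasDerivAt)
    have l1 := (c1.mul hs).neg
    rw [c2] at l1
    have l2 : Tendsto (fun z => A y + A z + Y z * B y + Y y * B z) (𝓝[≠] y)
        (𝓝 (A y + A y + Y y * B y + Y y * B y)) :=
      ((((hA y hy).const_add _).add ((hYc y hy).mul_const _)).add ((hB y hy).const_mul _)).mono_left
        nhdsWithin_le_nhds
    have : A y + A y + Y y * B y + Y y * B y = -1 := by
      refine tendsto_nhds_unique_of_eventuallyEq l2 l1 ?_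
      filter_upwards [self_mem_nhdsWithin, nhdsWithin_le_nhds (ne_eventually hy)] with z hz hz0
      have hz : z ≠ y := hz
      have hzy : z - y ≠ 0 := sub_ne_zero.2 hz
      rw [← hr y z hz.symm hy hz0, slope_def_field]
      field_simp
      ring
    linear_combination this
  refine ⟨B, fun y z hyz hy hz => ?_⟩
  rw [hr y z hyz hy hz]
  linear_combination (hdiag y hy + hdiag z hz) / 2

end

noncomputable section
set_option linter.unusedSimpArgs false
set_option linter.unusedVariables false
variable {n : ℕ} {r : ℂ → ℂ → ℂ → T2 n} {rc : ℕ → ℂ → ℂ → T2 n}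

theorem sum5 (F : Fin n → Fin n → Fin n → Fin n → Fin n → ℂ) :
    ∑ a, ∑ a', ∑ b, ∑ b', ∑ m, F a a' b b' m = ∑ b, ∑ m, ∑ b', ∑ a, ∑ a', F a a' b b' m := by
  have e1 : ∑ a, ∑ a', ∑ b, ∑ b', ∑ m, F a a' b b' m =
      ∑ x : Fin n × Fin n × Fin n × Fin n × Fin n, F x.1 x.2.1 x.2.2.1 x.2.2.2.1 x.2.2.2.2 := by
    simp only [Fintype.sum_prod_type]
  have e2 : ∑ b, ∑ m, ∑ b', ∑ a, ∑ a', F a a' b b' m =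
      ∑ x : Fin n × Fin n × Fin n × Fin n × Fin n, F x.2.2.2.1 x.2.2.2.2 x.1 x.2.2.1 x.2.1 := by
    simp only [Fintype.sum_prod_type]
  rw [e1, e2]
  exact Fintype.sum_equiv
    { toFun := fun x => (x.2.2.1, x.2.2.2.2, x.2.2.2.1, x.1, x.2.1)
      invFun := fun x => (x.2.2.2.1, x.2.2.2.2, x.1, x.2.2.1, x.2.1)
      left_inv := fun x => rfl
      right_inv := fun x => rfl } _ _ (fun x => rfl)

/-- contraction of the last two factors -/
def ctr23 (T : T3 n) (B C : Mat n) : Mat n := ctr2 (ctr3 T C) B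
def q1 (R : T2 n) (B C : Mat n) : Mat n := B * ctr2 R C
def q2 (R : T2 n) (B C : Mat n) : Mat n := ctr2 (tflip R) B * C

theorem ctr2_mul_kl (s : T2 n) (M B : Mat n) : ctr2 (s * (M ⊗ₖ (1 : Mat n))) B = ctr2 s B * M := by
  ext i j
  simp only [ctr2, Matrix.of_apply, mul_kl]
  simp only [Matrix.mul_apply, Matrix.of_apply, Finset.sum_mul]
  rw [sum_rot]
  refine Finset.sum_congr rfl fun a _ => Finset.sum_congr rfl fun b _ => Finset.sum_congr rfl fun m _ => ?_
  ring
theorem ctr2_kr_mul (s : T2 n) (M B : Mat n) : ctr2 (((1 : Mat n) ⊗ₖ M) * s) B = ctr2 s (B * M) := by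
  ext i j
  simp only [ctr2, Matrix.of_apply, kr_mul]
  simp only [Matrix.mul_apply, Matrix.of_apply, Finset.sum_mul, Finset.mul_sum]
  rw [sum_rev3]
  refine Finset.sum_congr rfl fun a _ => Finset.sum_congr rfl fun b _ => Finset.sum_congr rfl fun m _ => ?_
  ring

theorem ctr23_12_13 (s t : T2 n) (B C : Mat n) :
    ctr23 (emb12 s * emb13 t) B C = ctr2 s B * ctr2 t C := by
  rw [ctr23, ctr3_12_13, ctr2_mul_kl]
theorem ctr23_23_12 (s R : T2 n) (B C : Mat n) :
    ctr23 (emb23 R * emb12 s) B C = ctr2 s (q1 R B C) := by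
  rw [ctr23, ctr3_23_12, ctr2_kr_mul, q1]
theorem ctr23_13_23 (t R : T2 n) (B C : Mat n) :
    ctr23 (emb13 t * emb23 R) B C = ctr2 t (q2 R B C) := by
  ext i j
  simp only [ctr23, ctr2, ctr3, q2, Matrix.of_apply, mul_13_23]
  simp only [Matrix.mul_apply, Matrix.of_apply, Finset.sum_mul, Finset.mul_sum, tflip_apply]
  rw [sum5]
  refine Finset.sum_congr rfl fun a _ => Finset.sum_congr rfl fun b _ => Finset.sum_congr rfl fun m _ =>
    Finset.sum_congr rfl fun k _ => Finset.sum_congr rfl fun l _ => ?_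
  ring
theorem ctr23_23 (R : T2 n) (B C : Mat n) : ∃ k : ℂ, ctr23 (emb23 R) B C = k • 1 := by
  refine ⟨∑ a, ∑ b, (∑ c, ∑ d, R (a, c) (b, d) * C d c) * B b a, ?_⟩
  ext i j
  simp only [ctr23, ctr2, ctr3, emb23, Matrix.of_apply, Matrix.smul_apply, Matrix.one_apply, smul_eq_mul]
  by_cases hij : i = j <;> simp [hij]
theorem trace_q (R : T2 n) (B C : Mat n) : (q1 R B C).trace = (q2 R B C).trace := by
  simp only [q1, q2, ctr2, Matrix.trace, Matrix.diag, Matrix.mul_apply, Matrix.of_apply, tflip_apply,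
    Finset.sum_mul, Finset.mul_sum]
  have e1 : ∀ F : Fin n → Fin n → Fin n → Fin n → ℂ, ∑ a', ∑ a, ∑ b, ∑ b', F a a' b b' =
     ∑ b, ∑ b', ∑ a, ∑ a', F a a' b b' := by
    intro F
    have e1 : ∑ a', ∑ a, ∑ b, ∑ b', F a a' b b' =
        ∑ x : Fin n × Fin n × Fin n × Fin n, F x.2.1 x.1 x.2.2.1 x.2.2.2 := by
      simp only [Fintype.sum_prod_type]
    have e2 : ∑ b, ∑ b', ∑ a, ∑ a', F a a' b b' =
        ∑ x : Fin n × Fin n × Fin n × Fin n, F x.2.2.1 x.2.2.2 x.1 x.2.1 := by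
      simp only [Fintype.sum_prod_type]
    rw [e1, e2]
    exact Fintype.sum_equiv
      { toFun := fun x => (x.2.2.1, x.2.2.2, x.2.1, x.1)
        invFun := fun x => (x.2.2.2, x.2.2.1, x.1, x.2.1)
        left_inv := fun x => rfl
        right_inv := fun x => rfl } _ _ (fun x => rfl)
  rw [e1]
  refine Finset.sum_congr rfl fun a _ => Finset.sum_congr rfl fun b _ => Finset.sum_congr rfl fun m _ =>
    Finset.sum_congr rfl fun k _ => ?_
  ring
theorem trace_ctr2 (s : T2 n) (B : Mat n) : (ctr2 s B).trace = (ptr1 s * B).trace := by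
  simp only [ctr2, ptr1, Matrix.trace, Matrix.diag, Matrix.mul_apply, Matrix.of_apply, Finset.sum_mul]
  rw [← sum_rot]
theorem ctr23_add (S T : T3 n) (B C : Mat n) : ctr23 (S + T) B C = ctr23 S B C + ctr23 T B C := by
  rw [ctr23, ctr3_add]; ext i j; simp [ctr23, ctr2, add_mul, Finset.sum_add_distrib]
theorem ctr23_sub (S T : T3 n) (B C : Mat n) : ctr23 (S - T) B C = ctr23 S B C - ctr23 T B C := by
  rw [ctr23, ctr3_sub]; ext i j; simp [ctr23, ctr2, sub_mul, Finset.sum_sub_distrib]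
theorem ctr2_neg (s : T2 n) (B : Mat n) : ctr2 s (-B) = - ctr2 s B := by
  ext i j; simp [ctr2]

end

noncomputable section
set_option linter.unusedSimpArgs false
set_option linter.unusedVariables false
variable {n : ℕ} {r : ℂ → ℂ → ℂ → T2 n} {rc : ℕ → ℂ → ℂ → T2 n}

open Polynomial in
/-- `f` is a polynomial of degree at most `d` in `Y` on `E` -/
def PolyIn (E : Set ℂ) (Y : ℂ → ℂ) (d : ℕ) (f : ℂ → ℂ) : Prop :=
  ∃ p : ℂ[X], p.natDegree ≤ d ∧ ∀ y ∈ E, f y = p.eval (Y y)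

open Polynomial in
theorem PolyIn.lim {E : Set ℂ} {Y : ℂ → ℂ} {d : ℕ} {ι : Type*} {l : Filter ι} [l.NeBot] {F : ι → ℂ → ℂ}
    {f : ℂ → ℂ} (hF : ∀ᶠ i in l, PolyIn E Y d (F i)) (hl : ∀ y ∈ E, Tendsto (fun i => F i y) l (𝓝 (f y))) :
    PolyIn E Y d f := by
  let φ : ℂ[X] →ₗ[ℂ] (E → ℂ) :=
    { toFun := fun p y => p.eval (Y y)
      map_add' := fun p q => by ext y; simp
      map_smul' := fun c p => by ext y; simp }
  let V : Submodule ℂ (E → ℂ) := (degreeLT ℂ (d + 1)).map φ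
  have hfin : FiniteDimensional ℂ (degreeLT ℂ (d + 1)) :=
    Module.Finite.equiv (degreeLTEquiv ℂ (d + 1)).symm
  have hV : FiniteDimensional ℂ V := inferInstance
  have hcl : IsClosed (V : Set (E → ℂ)) := V.closed_of_finiteDimensional
  have hm : (fun y : E => f y) ∈ (V : Set (E → ℂ)) := by
    refine hcl.mem_of_tendsto (f := fun i => fun y : E => F i y) (b := l) (tendsto_pi_nhds.2 fun y => hl y y.2) ?_
    filter_upwards [hF] with i hi
    obtain ⟨p, hp, he⟩ := hi
    refine ⟨p, ?_, ?_⟩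
    · simp only [SetLike.mem_coe, mem_degreeLT]
      exact lt_of_le_of_lt degree_le_natDegree (by exact_mod_cast Nat.lt_succ_of_le hp)
    · ext y
      exact (he y y.2).symm
  obtain ⟨p, hp, he⟩ := hm
  refine ⟨p, ?_, fun y hy => (congrFun he ⟨y, hy⟩).symm⟩
  simp only [SetLike.mem_coe, mem_degreeLT] at hp
  by_cases h0 : p = 0
  · simp [h0]
  · exact Nat.le_of_lt_succ ((natDegree_lt_iff_degree_lt h0).2 hp)

open Polynomial in
theorem PolyIn.add {E : Set ℂ} {Y : ℂ → ℂ} {d : ℕ} {f g : ℂ → ℂ} (hf : PolyIn E Y d f) (hg : PolyIn E Y d g) :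
    PolyIn E Y d (fun y => f y + g y) := by
  obtain ⟨p, hp, h1⟩ := hf
  obtain ⟨q, hq, h2⟩ := hg
  exact ⟨p + q, (natDegree_add_le _ _).trans (max_le hp hq), fun y hy => by simp [h1 y hy, h2 y hy]⟩
open Polynomial in
theorem PolyIn.mul {E : Set ℂ} {Y : ℂ → ℂ} {d e : ℕ} {f g : ℂ → ℂ} (hf : PolyIn E Y d f) (hg : PolyIn E Y e g) :
    PolyIn E Y (d + e) (fun y => f y * g y) := by
  obtain ⟨p, hp, h1⟩ := hf
  obtain ⟨q, hq, h2⟩ := hg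
  exact ⟨p * q, natDegree_mul_le.trans (add_le_add hp hq), fun y hy => by simp [h1 y hy, h2 y hy]⟩
open Polynomial in
theorem PolyIn.lin {E : Set ℂ} {Y : ℂ → ℂ} (a c : ℂ) : PolyIn E Y 1 (fun y => a * Y y + c) :=
  ⟨C a * X + C c, natDegree_linear_le, fun y hy => by simp⟩
open Polynomial in
theorem PolyIn.const {E : Set ℂ} {Y : ℂ → ℂ} (c : ℂ) : PolyIn E Y 0 (fun y => c) :=
  ⟨C c, by simp, fun y hy => by simp⟩
theorem PolyIn.mono {E : Set ℂ} {Y : ℂ → ℂ} {d e : ℕ} {f : ℂ → ℂ} (hf : PolyIn E Y d f) (hd : d ≤ e) :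
    PolyIn E Y e f := by
  obtain ⟨p, hp, h1⟩ := hf
  exact ⟨p, hp.trans hd, h1⟩
theorem PolyIn.congr {E : Set ℂ} {Y : ℂ → ℂ} {d : ℕ} {f g : ℂ → ℂ} (hf : PolyIn E Y d f)
    (he : ∀ y ∈ E, g y = f y) : PolyIn E Y d g := by
  obtain ⟨p, hp, h1⟩ := hf
  exact ⟨p, hp, fun y hy => by rw [he y hy, h1 y hy]⟩
theorem PolyIn.sum {E : Set ℂ} {Y : ℂ → ℂ} {d : ℕ} {f : ℕ → ℂ → ℂ} (s : Finset ℕ)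
    (hf : ∀ i ∈ s, PolyIn E Y d (f i)) : PolyIn E Y d (fun y => ∑ i ∈ s, f i y) := by
  induction s using Finset.induction_on with
  | empty => simpa using (PolyIn.const (E := E) (Y := Y) 0).mono (Nat.zero_le d)
  | insert a s ha ih =>
    simp only [Finset.sum_insert ha]
    exact (hf a (by simp)).add (ih fun i hi => hf i (by simp [hi]))
theorem PolyIn.prod {E : Set ℂ} {Y : ℂ → ℂ} {f : ℕ → ℂ → ℂ} (s : Finset ℕ)
    (hf : ∀ i ∈ s, PolyIn E Y 1 (f i)) : PolyIn E Y s.card (fun y => ∏ i ∈ s, f i y) := by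
  induction s using Finset.induction_on with
  | empty => simpa using (PolyIn.const (E := E) (Y := Y) 1)
  | insert a s ha ih =>
    simp only [Finset.prod_insert ha, Finset.card_insert_of_notMem ha]
    rw [add_comm]
    exact (hf a (by simp)).mul (ih fun i hi => hf i (by simp [hi]))

variable {ab : ℂ → Mat n} {z0 : ℂ} {B0 : Mat n} {Y : ℂ → ℂ} {b : ℂ → Mat n} {D : Set ℂ}

def xx (r : ℂ → ℂ → ℂ → T2 n) (u z : ℂ) (B : Mat n) (y : ℂ) : Mat n := ctr2 (r u y z) B

theorem Sol.xx_mul (h : Sol r rc) {w u z z' : ℂ} (hw : w ≠ 0) (hu : u ≠ 0) (huw : w + u ≠ 0) (hz : z ≠ z')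
    (B C : Mat n) : ∃ B' C' : Mat n, ∀ y, y ≠ z → y ≠ z' →
      xx r w z B y * xx r u z' C y = xx r (w + u) z B' y + xx r (w + u) z' C' y := by
  refine ⟨q1 (r u z z') B C, - q2 (r (-w) z z') B C, fun y hy hy' => ?_⟩
  have e := h.dual huw (neg_ne_zero.2 hw) (by simpa using hu) hy hy' hz
  have e1 : w + u + -w = u := by ring
  rw [neg_neg, e1] at e
  have e := congrArg (fun T => ctr23 T B C) e
  simp only [ctr23_add, ctr23_12_13, ctr23_13_23, ctr23_23_12] at e
  simp only [xx, ctr2_neg]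
  rw [e]; abel

theorem Ctr.xx_trace (h : Sol r rc) (Q : Ctr rc ab z0 B0 Y b D) {u z z' : ℂ} (hu : u ≠ 0) (hz : z ≠ z')
    (B C : Mat n) : ∃ α δ β : ℂ, ∀ y, y ≠ z → y ≠ z' → y ≠ z0 →
      (xx r u z B y * xx r (-u) z' C y).trace = α * Y y + δ + β * (gn rc y z - gn rc y z') := by
  obtain ⟨k, hk⟩ := ctr23_23 (drm r (-u) z z') B C
  set B' := q1 (r (-u) z z') B C with hB'
  set C' := q2 (r (-u) z z') B C with hC'
  have ht : B'.trace = C'.trace := trace_q _ _ _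
  refine ⟨(ab z * B').trace - (ab z' * C').trace, (b z * B').trace - (b z' * C').trace + k * n, B'.trace,
    fun y hy hy' hy0 => ?_⟩
  have e := congrArg (fun T => (ctr23 T B C).trace) (h.L1 (neg_ne_zero.2 hu) hy hy' hz)
  simp only [ctr23_add, ctr23_sub, ctr23_12_13, ctr23_13_23, ctr23_23_12, neg_neg, hk, Matrix.trace_add,
    Matrix.trace_sub, trace_ctr2, ← hB', ← hC'] at e
  have e1 : ptr1 (rc 0 y z) = _ := Q.rep y z hy hy0
  have e2 : ptr1 (rc 0 y z') = _ := Q.rep y z' hy' hy0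
  rw [e1, e2] at e
  simp only [Matrix.add_mul, Matrix.smul_mul, Matrix.trace_add, Matrix.trace_smul, Matrix.one_mul,
    Matrix.trace_one, Fintype.card_fin, smul_eq_mul] at e
  rw [xx, xx, e, ht]
  ring

theorem xx_add (u z y : ℂ) (A B : Mat n) : xx r u z (A + B) y = xx r u z A y + xx r u z B y := ctr2_add _ _ _
theorem xx_sum (u z y : ℂ) (A : ℕ → Mat n) (s : Finset ℕ) :
    xx r u z (∑ i ∈ s, A i) y = ∑ i ∈ s, xx r u z (A i) y := by
  induction s using Finset.induction_on with
  | empty => ext i j; simp [xx, ctr2]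
  | insert a s ha ih => rw [Finset.sum_insert ha, Finset.sum_insert ha, xx_add, ih]

theorem Sol.xx_prod (h : Sol r rc) {u : ℂ} (hu : u ≠ 0) (zs : ℕ → ℂ) (hzs : Function.Injective zs) (B : Mat n)
    (k : ℕ) : ∃ Cs : ℕ → Mat n, ∀ y, (∀ j, y ≠ zs j) →
      ((List.range (k + 1)).map fun j => xx r u (zs j) B y).prod =
        ∑ j ∈ Finset.range (k + 1), xx r ((k + 1 : ℕ) * u) (zs j) (Cs j) y := by
  induction k with
  | zero => exact ⟨fun _ => B, fun y hy => by simp⟩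
  | succ k ih =>
    obtain ⟨Cs, hCs⟩ := ih
    have hk : ((k + 1 : ℕ) : ℂ) * u ≠ 0 := mul_ne_zero (by exact_mod_cast Nat.succ_ne_zero k) hu
    have hk2 : ((k + 1 : ℕ) : ℂ) * u + u ≠ 0 := by
      have : ((k + 1 : ℕ) : ℂ) * u + u = ((k + 1 + 1 : ℕ) : ℂ) * u := by push_cast; ring
      rw [this]; exact mul_ne_zero (by exact_mod_cast Nat.succ_ne_zero (k + 1)) hu
    have hex : ∀ j : ℕ, ∃ B' C' : Mat n, j < k + 1 → ∀ y, y ≠ zs j → y ≠ zs (k + 1) →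
      xx r ((k + 1 : ℕ) * u) (zs j) (Cs j) y * xx r u (zs (k + 1)) B y =
        xx r ((k + 1 : ℕ) * u + u) (zs j) B' y + xx r ((k + 1 : ℕ) * u + u) (zs (k + 1)) C' y := by
      intro j
      by_cases hj : j < k + 1
      · obtain ⟨B', C', hh⟩ := h.xx_mul hk hu hk2 (hzs.ne hj.ne) (Cs j) B
        exact ⟨B', C', fun _ => hh⟩
      · exact ⟨0, 0, fun hj' => absurd hj' hj⟩
    choose B' C' hBC using hex
    refine ⟨fun j => if j < k + 1 then B' j else ∑ i ∈ Finset.range (k + 1), C' i, fun y hy => ?_⟩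
    have e1 : ((k + 1 + 1 : ℕ) : ℂ) * u = ((k + 1 : ℕ) : ℂ) * u + u := by push_cast; ring
    rw [List.range_succ, List.map_append, List.prod_append, hCs y hy, Finset.sum_range_succ _ (k + 1), e1]
    simp only [List.map_singleton, List.prod_singleton, lt_irrefl, if_false, xx_sum, Finset.sum_mul]
    rw [← Finset.sum_add_distrib]
    refine Finset.sum_congr rfl fun j hj => ?_
    rw [Finset.mem_range] at hj
    rw [hBC j hj y (hy j) (hy _), if_pos hj]

theorem Ctr.trace_prod (h : Sol r rc) (Q : Ctr rc ab z0 B0 Y b D) {u : ℂ} (hu : u ≠ 0) (zs : ℕ → ℂ)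
    (hzs : Function.Injective zs) (B : Mat n) (k : ℕ) : ∃ α δ β : ℕ → ℂ, ∀ y, y ≠ z0 → (∀ j, y ≠ zs j) →
      (((List.range (k + 1)).map fun j => xx r u (zs j) B y).prod *
        xx r (-((k + 1 : ℕ) * u)) (zs (k + 1)) B y).trace =
      ∑ j ∈ Finset.range (k + 1), (α j * Y y + δ j + β j * (gn rc y (zs j) - gn rc y (zs (k + 1)))) := by
  obtain ⟨Cs, hCs⟩ := h.xx_prod hu zs hzs B k
  have hk : ((k + 1 : ℕ) : ℂ) * u ≠ 0 := mul_ne_zero (by exact_mod_cast Nat.succ_ne_zero k) hu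
  have hex : ∀ j : ℕ, ∃ α δ β : ℂ, j < k + 1 → ∀ y, y ≠ zs j → y ≠ zs (k + 1) → y ≠ z0 →
      (xx r ((k + 1 : ℕ) * u) (zs j) (Cs j) y * xx r (-((k + 1 : ℕ) * u)) (zs (k + 1)) B y).trace =
        α * Y y + δ + β * (gn rc y (zs j) - gn rc y (zs (k + 1))) := by
    intro j
    by_cases hj : j < k + 1
    · obtain ⟨α, δ, β, hh⟩ := Q.xx_trace h hk (hzs.ne hj.ne) (Cs j) B
      exact ⟨α, δ, β, fun _ => hh⟩
    · exact ⟨0, 0, 0, fun hj' => absurd hj' hj⟩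
  choose α δ β hh using hex
  refine ⟨α, δ, β, fun y hy0 hy => ?_⟩
  rw [hCs y hy, Finset.sum_mul, Matrix.trace_sum]
  exact Finset.sum_congr rfl fun j hj => hh j (Finset.mem_range.1 hj) y (hy j) (hy _) hy0

end

noncomputable section
set_option linter.unusedSimpArgs false
set_option linter.unusedVariables false
variable {n : ℕ} {r : ℂ → ℂ → ℂ → T2 n} {rc : ℕ → ℂ → ℂ → T2 n}

variable {ab : ℂ → Mat n} {z0 : ℂ} {B0 : Mat n} {Y : ℂ → ℂ} {b : ℂ → Mat n} {D : Set ℂ}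

theorem Ctr.poly1 (h : Sol r rc) (Q : Ctr rc ab z0 B0 Y b D) {u : ℂ} (hu : u ≠ 0) (zs : ℕ → ℂ)
    (hzs : Function.Injective zs) (hz0 : ∀ j, zs j ≠ z0) (B : Mat n) (k : ℕ) {E : Set ℂ}
    (hE : ∀ y ∈ E, y ≠ z0 ∧ ∀ j, y ≠ zs j) :
    PolyIn E Y (k + 3) (fun y => (∏ i ∈ Finset.range (k + 2), (Y y - Y (zs i))) *
      (((List.range (k + 1)).map fun j => xx r u (zs j) B y).prod *
        xx r (-((k + 1 : ℕ) * u)) (zs (k + 1)) B y).trace) := by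
  obtain ⟨Bf, hB⟩ := Q.gn_eq h
  obtain ⟨α, δ, β, hT⟩ := Q.trace_prod h hu zs hzs B k
  have lin : ∀ i, PolyIn E Y 1 (fun y => Y y - Y (zs i)) := fun i =>
    (PolyIn.lin 1 (- Y (zs i))).congr fun y hy => by ring
  have key : ∀ j ∈ Finset.range (k + 1), PolyIn E Y (k + 3) (fun y =>
      (∏ i ∈ Finset.range (k + 2), (Y y - Y (zs i))) * (α j * Y y + δ j) +
      (∏ i ∈ (Finset.range (k + 1)).erase j, (Y y - Y (zs i))) *
        (((Y y - Y (zs j)) * (Y y - Y (zs (k + 1)))) * (β j * (Bf (zs j) - Bf (zs (k + 1)))) +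
          β j * (Y (zs (k + 1)) - Y (zs j)))) := by
    intro j hj
    refine PolyIn.add ?_ ?_
    · refine ((PolyIn.prod _ fun i _ => lin i).mul (PolyIn.lin (α j) (δ j))).mono ?_
      simp
    · refine ((PolyIn.prod _ fun i _ => lin i).mul
        ((((lin j).mul (lin (k + 1))).mul (PolyIn.const _)).add ((PolyIn.const _).mono (Nat.zero_le _)))).mono ?_
      rw [Finset.card_erase_of_mem hj]
      simp
  refine (PolyIn.sum (Finset.range (k + 1)) key).congr fun y hy => ?_
  obtain ⟨hy0, hyj⟩ := hE y hy
  rw [hT y hy0 hyj, Finset.mul_sum]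
  refine Finset.sum_congr rfl fun j hj => ?_
  have e1 := hB y (zs j) (hyj j) hy0 (hz0 j)
  have e2 := hB y (zs (k + 1)) (hyj _) hy0 (hz0 _)
  have e3 : (∏ i ∈ Finset.range (k + 2), (Y y - Y (zs i))) =
      ((Y y - Y (zs j)) * (∏ i ∈ (Finset.range (k + 1)).erase j, (Y y - Y (zs i)))) * (Y y - Y (zs (k + 1))) := by
    rw [Finset.prod_range_succ _ (k + 1), Finset.mul_prod_erase _ (fun i => Y y - Y (zs i)) hj]
  rw [e3]
  set P := ∏ i ∈ (Finset.range (k + 1)).erase j, (Y y - Y (zs i))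
  linear_combination P * β j * (Y y - Y (zs (k + 1))) * e1 - P * β j * (Y y - Y (zs j)) * e2

theorem ctr2_one_left (B : Mat n) : ctr2 (1 : T2 n) B = B.trace • 1 := by
  ext i j
  simp only [ctr2, Matrix.of_apply, Matrix.one_apply, Prod.mk.injEq, Matrix.smul_apply, smul_eq_mul, Matrix.trace,
    Matrix.diag]
  by_cases hij : i = j
  · simp [hij]
  · simp [hij]
theorem ctr2_add_left (s t : T2 n) (B : Mat n) : ctr2 (s + t) B = ctr2 s B + ctr2 t B := by
  ext i j; simp [ctr2, add_mul, Finset.sum_add_distrib]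
theorem ctr2_smul_left (c : ℂ) (t : T2 n) (B : Mat n) : ctr2 (c • t) B = c • ctr2 t B := by
  ext i j; simp [ctr2, mul_assoc, Finset.mul_sum]

theorem Sol.xx_lim (h : Sol r rc) {y z : ℂ} (hy : y ≠ z) {B : Mat n} (hB : B.trace = 0) :
    Tendsto (fun u => xx r u z B y) (𝓝[≠] 0) (𝓝 (ctr2 (rc 0 y z) B)) := by
  refine (ctr2_tendsto (h.tendsto_Hh hy) (tendsto_const_nhds (x := B))).congr' ?_
  filter_upwards [self_mem_nhdsWithin] with u hu
  rw [xx, r_eq_Hh (r := r) (rc := rc) hu, ctr2_add_left, ctr2_smul_left, ctr2_one_left, hB]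
  simp

theorem listprod_tendsto {α : Type*} {l : Filter α} {F : ℕ → α → Mat n} {G : ℕ → Mat n}
    (hF : ∀ j, Tendsto (F j) l (𝓝 (G j))) (k : ℕ) :
    Tendsto (fun x => ((List.range k).map fun j => F j x).prod) l (𝓝 ((List.range k).map G).prod) := by
  induction k with
  | zero => simpa using tendsto_const_nhds
  | succ k ih =>
    simp only [List.range_succ, List.map_append, List.prod_append, List.map_singleton, List.prod_singleton]
    exact ih.mul (hF k)

theorem Ctr.poly2 (h : Sol r rc) (Q : Ctr rc ab z0 B0 Y b D) (zs : ℕ → ℂ)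
    (hzs : Function.Injective zs) (hz0 : ∀ j, zs j ≠ z0) {B : Mat n} (hB : B.trace = 0) (k : ℕ) {E : Set ℂ}
    (hE : ∀ y ∈ E, y ≠ z0 ∧ ∀ j, y ≠ zs j) :
    PolyIn E Y (k + 3) (fun y => (∏ i ∈ Finset.range (k + 2), (Y y - Y (zs i))) *
      (((List.range (k + 1)).map fun j => ctr2 (rc 0 y (zs j)) B).prod * ctr2 (rc 0 y (zs (k + 1))) B).trace) := by
  refine PolyIn.lim (l := 𝓝[≠] (0 : ℂ)) (F := fun u y => (∏ i ∈ Finset.range (k + 2), (Y y - Y (zs i))) *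
      (((List.range (k + 1)).map fun j => xx r u (zs j) B y).prod *
        xx r (-((k + 1 : ℕ) * u)) (zs (k + 1)) B y).trace) ?_ ?_
  · filter_upwards [self_mem_nhdsWithin] with u hu
    exact Q.poly1 h hu zs hzs hz0 B k hE
  · intro y hy
    obtain ⟨hy0, hyj⟩ := hE y hy
    refine tendsto_const_nhds.mul (trace_tendsto ((listprod_tendsto (fun j => h.xx_lim (hyj j) hB) _).mul ?_))
    refine (h.xx_lim (hyj (k + 1)) hB).comp ?_
    refine tendsto_nhdsWithin_iff.2 ⟨?_, ?_⟩
    · have : Continuous fun u : ℂ => -(((k + 1 : ℕ) : ℂ) * u) := by fun_prop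
      have := (this.tendsto 0).mono_left (nhdsWithin_le_nhds (s := {0}ᶜ))
      simpa using this
    · filter_upwards [self_mem_nhdsWithin] with u hu
      exact neg_ne_zero.2 (mul_ne_zero (by exact_mod_cast Nat.succ_ne_zero k) hu)

theorem Ctr.poly3 (h : Sol r rc) (Q : Ctr rc ab z0 B0 Y b D) {z : ℂ} (hz : z ≠ z0) {B : Mat n} (hB : B.trace = 0)
    (k : ℕ) {E : Set ℂ} {δ : ℝ} (hδ : 0 < δ) (hE : ∀ y ∈ E, y ≠ z0 ∧ δ < dist y z) :
    PolyIn E Y (k + 3) (fun y => (Y y - Y z) ^ (k + 2) * ((ctr2 (rc 0 y z) B) ^ (k + 2)).trace) := by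
  have hYc : ContinuousAt Y z := (Q.Yd z hz).continuousAt
  let zs : ℂ → ℕ → ℂ := fun ε j => z + ε / (j + 1)
  have hzt : ∀ j, Tendsto (fun ε => zs ε j) (𝓝[≠] 0) (𝓝 z) := by
    intro j
    have : Continuous fun ε : ℂ => z + ε / ((j : ℂ) + 1) := by fun_prop
    have := (this.tendsto 0).mono_left (nhdsWithin_le_nhds (s := {0}ᶜ))
    simpa using this
  refine PolyIn.lim (l := 𝓝[≠] (0 : ℂ)) (F := fun ε y =>
    (∏ i ∈ Finset.range (k + 2), (Y y - Y (zs ε i))) *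
      (((List.range (k + 1)).map fun j => ctr2 (rc 0 y (zs ε j)) B).prod *
        ctr2 (rc 0 y (zs ε (k + 1))) B).trace) ?_ ?_
  · have hpos : 0 < min δ (dist z0 z) := lt_min hδ (dist_pos.2 hz.symm)
    filter_upwards [self_mem_nhdsWithin, mem_nhdsWithin_of_mem_nhds (Metric.ball_mem_nhds (0 : ℂ) hpos)] with ε hε hb
    have hε : ε ≠ 0 := hε
    have hn : ∀ j, dist (zs ε j) z < min δ (dist z0 z) := by
      intro j
      refine lt_of_le_of_lt ?_ (mem_ball_zero_iff.1 hb)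
      have e : dist (zs ε j) z = ‖ε‖ / ‖(j : ℂ) + 1‖ := by simp [zs, dist_eq_norm]
      rw [e]
      refine div_le_self (norm_nonneg _) ?_
      have : ((j : ℂ) + 1) = ((j + 1 : ℕ) : ℂ) := by push_cast; rfl
      rw [this, Complex.norm_natCast]
      exact_mod_cast Nat.succ_pos j
    refine Q.poly2 h (zs ε) ?_ ?_ hB k ?_
    · intro i j hij
      have hi : (i : ℂ) + 1 ≠ 0 := by exact_mod_cast Nat.succ_ne_zero i
      have hj : (j : ℂ) + 1 ≠ 0 := by exact_mod_cast Nat.succ_ne_zero j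
      simp only [zs, add_right_inj] at hij
      rw [div_eq_div_iff hi hj] at hij
      have := mul_left_cancel₀ hε hij
      have : (j : ℂ) = i := by linear_combination this
      exact_mod_cast this.symm
    · intro j he
      have := hn j
      rw [he] at this
      exact absurd (lt_of_lt_of_le this (min_le_right _ _)) (lt_irrefl _)
    · intro y hy
      refine ⟨(hE y hy).1, fun j he => ?_⟩
      have := hn j
      rw [← he] at this
      exact absurd ((hE y hy).2.trans (lt_of_lt_of_le this (min_le_left _ _))) (lt_irrefl _)
  · intro y hy
    have hyz : y ≠ z := dist_pos.1 (hδ.trans (hE y hy).2)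
    have h2 : ∀ j, Tendsto (fun ε => ctr2 (rc 0 y (zs ε j)) B) (𝓝[≠] 0) (𝓝 (ctr2 (rc 0 y z) B)) := fun j =>
      ctr2_tendsto ((h.r0_cont_2 hyz).tendsto.comp (hzt j)) tendsto_const_nhds
    have h1 : Tendsto (fun ε => ∏ i ∈ Finset.range (k + 2), (Y y - Y (zs ε i))) (𝓝[≠] 0)
        (𝓝 (∏ i ∈ Finset.range (k + 2), (Y y - Y z))) :=
      tendsto_finsetProd _ fun i _ => tendsto_const_nhds.sub (hYc.tendsto.comp (hzt i))
    have h3 := trace_tendsto ((listprod_tendsto h2 (k + 1)).mul (h2 (k + 1)))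
    have h4 := h1.mul h3
    simpa [List.map_const', pow_succ] using h4

open Polynomial in
theorem Ctr.false (h : Sol r rc) (Q : Ctr rc ab z0 B0 Y b D) : False := by
  have ha0 : ab z0 ≠ 0 := by
    intro h0
    have := Q.B0a
    simp [h0] at this
  obtain ⟨z, haz, hz⟩ : ∃ z, ab z ≠ 0 ∧ z ≠ z0 := by
    have : ∀ᶠ z in 𝓝[≠] z0, ab z ≠ 0 := ((Q.abc z0).mono_left nhdsWithin_le_nhds).eventually_ne ha0
    exact (this.and self_mem_nhdsWithin).exists
  obtain ⟨B, hB, hBa⟩ := exists_B0 haz (Q.abt z)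
  obtain ⟨ys, hys, hysD⟩ : ∃ y, (y ≠ z ∧ y ≠ z0) ∧ y ∈ D := by
    have ho : IsOpen ({z, z0}ᶜ : Set ℂ) := (Set.toFinite {z, z0}).isClosed.isOpen_compl
    have hne : ({z, z0}ᶜ : Set ℂ).Nonempty := by
      obtain ⟨w, hw⟩ := Infinite.exists_notMem_finset ({z, z0} : Finset ℂ)
      exact ⟨w, by simpa using hw⟩
    obtain ⟨y, hy, hyD⟩ := Q.dense.inter_open_nonempty _ ho hne
    exact ⟨y, by simpa using hy, hyD⟩
  obtain ⟨c, -, hc⟩ := Q.pole ys hysD hys.2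
  have hd : deriv Y ys ≠ 0 := by
    intro h0
    rw [h0] at hc
    simp at hc
  have hdp : 0 < dist ys z := dist_pos.2 hys.1
  set δ := dist ys z / 2 with hδ
  have hδp : 0 < δ := by positivity
  set E : Set ℂ := {y | y ≠ z0 ∧ δ < dist y z} with hE
  have hEo : E ∈ 𝓝 ys := by
    refine Filter.inter_mem (isOpen_ne.mem_nhds hys.2) ?_
    have : IsOpen {y : ℂ | δ < dist y z} := isOpen_lt continuous_const (by fun_prop)
    refine this.mem_nhds ?_
    show δ < dist ys z
    rw [hδ]; linarith
  have hS : (Y '' E).Infinite := by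
    intro hfin
    have h1 : ∀ᶠ y in 𝓝[≠] ys, ∀ s ∈ Y '' E, Y y ≠ s := by
      refine (Filter.eventually_all_finite hfin).2 fun s _ => ?_
      exact (Q.Yd ys hys.2).hasDerivAt.eventually_ne hd
    obtain ⟨y, hy1, hy2⟩ := (h1.and (mem_nhdsWithin_of_mem_nhds hEo)).exists
    exact hy1 _ ⟨y, hy2, rfl⟩ rfl
  have hP : ∀ K : ℕ, ∃ p : ℂ[X], (1 ≤ K → p.natDegree ≤ K + 1 ∧ ∀ y ∈ E, (Y y - Y z) ^ K *
      ((ctr2 (rc 0 y z) B) ^ K).trace = p.eval (Y y)) ∧ (K = 1 → p.coeff 2 = 1) := by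
    intro K
    match K with
    | 0 => exact ⟨0, by simp⟩
    | 1 =>
      refine ⟨(X - C (Y z)) * (X + C ((b z * B).trace)), fun _ => ⟨?_, fun y hy => ?_⟩, fun _ => ?_⟩
      · refine natDegree_mul_le.trans ?_
        rw [natDegree_X_sub_C, natDegree_X_add_C]
      · have hyz : y ≠ z := dist_pos.1 (hδp.trans hy.2)
        have e1 : ptr1 (rc 0 y z) = _ := Q.rep y z hyz hy.1
        rw [pow_one, pow_one, trace_ctr2, e1]
        have e2 : (ab z * B).trace = 1 := by rw [Matrix.trace_mul_comm]; exact hBa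
        simp [Matrix.add_mul, Matrix.trace_add, Matrix.trace_smul, hB, e2]
      · have : (X - C (Y z)) * (X + C ((b z * B).trace)) =
          X ^ 2 + C ((b z * B).trace - Y z) * X + C (- Y z * (b z * B).trace) := by
          simp only [C_sub, C_mul, C_neg]; ring
        rw [this]
        simp [coeff_X, coeff_C]
    | k + 2 =>
      obtain ⟨p, hp, he⟩ := Q.poly3 h hz hB k hδp (E := E) (fun y hy => hy)
      exact ⟨p, fun _ => ⟨hp, he⟩, by omega⟩
  choose P hP1 hP2 using hP
  refine newton_contra (n := n) P (fun K hK => (hP1 K hK).1) (hP2 1 rfl) _ hS ?_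
  rintro _ ⟨y, hy, rfl⟩
  refine ⟨(Y y - Y z) • ctr2 (rc 0 y z) B, fun K hK => ?_⟩
  rw [_root_.smul_pow, Matrix.trace_smul, smul_eq_mul, (hP1 K hK).2 y hy]

end

noncomputable section
set_option linter.unusedSimpArgs false
set_option linter.unusedVariables false
variable {n : ℕ} {r : ℂ → ℂ → ℂ → T2 n} {rc : ℕ → ℂ → ℂ → T2 n}

theorem Sol.ab_zero (h : Sol r rc) {u : ℂ} (hu : GoodU r u) : ∀ y, Y1 r rc u y → ∀ z, z ≠ y → ∃ K : Mat n,
    SS r u y z = K ⊗ₖ (1 : Mat n) := by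
  obtain ⟨ab, hc, ht, hY⟩ := h.exists_ab hu
  have h0 : ∀ z, ab z = 0 := by
    intro z
    by_contra hz
    obtain ⟨B0, Y, b, D, Q⟩ := h.exists_ctr hu hc ht (fun y hy => by
      obtain ⟨c, h1, h2⟩ := hY y hy
      exact ⟨c, h1, fun z hz => (h2 z hz).1⟩) hz
    exact Q.false h
  intro y hy z hz
  obtain ⟨c, -, h2⟩ := hY y hy
  obtain ⟨K, hK⟩ := (h2 z hz).2
  exact ⟨K, by rw [hK, h0]; simp⟩

theorem kl_tendsto {α : Type*} {l : Filter α} {R : α → Mat n} {R0 : Mat n}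
    (hR : Tendsto R l (𝓝 R0)) : Tendsto (fun x => R x ⊗ₖ (1 : Mat n)) l (𝓝 (R0 ⊗ₖ (1 : Mat n))) := by
  refine tendsto_pi_nhds.2 fun i => tendsto_pi_nhds.2 fun j => ?_
  simp only [Matrix.kroneckerMap_apply]
  exact (tendsto_pi_nhds.1 (tendsto_pi_nhds.1 hR _) _).mul tendsto_const_nhds

theorem ptr2_tendsto {α : Type*} {l : Filter α} {R : α → T2 n} {R0 : T2 n}
    (hR : Tendsto R l (𝓝 R0)) : Tendsto (fun x => ptr2 (R x)) l (𝓝 (ptr2 R0)) := by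
  refine tendsto_pi_nhds.2 fun i => tendsto_pi_nhds.2 fun j => ?_
  simp only [ptr2, Matrix.of_apply]
  exact tendsto_finsetSum _ fun m _ => (tendsto_pi_nhds.1 (tendsto_pi_nhds.1 hR _) _)

theorem ptr2_kl (K : Mat n) : ptr2 (K ⊗ₖ (1 : Mat n)) = (n : ℂ) • K := by
  ext a b; simp [ptr2, mul_comm]

theorem Sol.SS_left (h : Sol r rc) {u y z : ℂ} (hu : GoodU r u) (hy : y ≠ z) :
    (n : ℂ) • SS r u y z = ptr2 (SS r u y z) ⊗ₖ (1 : Mat n) := by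
  have hc := h.SS_cont_1 hu.1 hy
  refine eq_of_dense (F := fun x => (n : ℂ) • SS r u x z) (G := fun x => ptr2 (SS r u x z) ⊗ₖ (1 : Mat n))
    (h.Y1_dense hu) (hc.const_smul _) (kl_tendsto (ptr2_tendsto hc)) ?_
  filter_upwards [ne_eventually hy] with x hx hD
  obtain ⟨K, hK⟩ := h.ab_zero hu x hD z hx.symm
  simp only [hK, ptr2_kl, Matrix.smul_kronecker]

theorem Sol.SS_scalar (h : Sol r rc) {u y z : ℂ} (hu : GoodU r u) (hy : y ≠ z) :
    ((n : ℂ) * n) • SS r u y z = (SS r u y z).trace • 1 := by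
  have hn : (n : ℂ) ≠ 0 := by exact_mod_cast h.n0
  have e1 := h.SS_left hu hy
  have e2 := h.SS_left (h.good_neg hu) hy.symm
  rw [← h.SS_flip hu.1 hy] at e2
  set T := SS r u y z
  have e3 : (n : ℂ) • T = (1 : Mat n) ⊗ₖ ptr1 T := by
    have := congrArg tflip e2
    rw [tflip_smul, tflip_kron, tflip_tflip] at this
    exact this
  have e4 : (n : ℂ) • ptr1 T = T.trace • 1 := by
    have := congrArg ptr1 e1
    rw [ptr1_smul, ptr1_kron] at this
    rw [this]
    congr 1
    simp only [ptr2, Matrix.trace, Matrix.diag, Matrix.of_apply, Fintype.sum_prod_type]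
  rw [mul_smul, e3, ← Matrix.kronecker_smul, e4, Matrix.kronecker_smul, Matrix.one_kronecker_one]

theorem Sol.SS_scalar_all (h : Sol r rc) {u y z : ℂ} (hu : u ≠ 0) (hy : y ≠ z) :
    ((n : ℂ) * n) • SS r u y z = (SS r u y z).trace • 1 := by
  have hc : Tendsto (fun v => SS r v y z) (𝓝 u) (𝓝 (SS r u y z)) := by
    have h1 : Tendsto (fun v => r (-v) y z) (𝓝 u) (𝓝 (r (-u) y z)) :=
      (h.cont_u (neg_ne_zero.2 hu) hy).tendsto.comp (continuous_neg.tendsto u)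
    exact h1.mul (h.cont_u hu hy).tendsto
  have hne : (𝓝[{v | GoodU r v}] u).NeBot := mem_closure_iff_nhdsWithin_neBot.1 (h.good_dense hu)
  have hc := hc.mono_left (nhdsWithin_le_nhds (s := {v | GoodU r v}))
  have ht : Tendsto (fun v => (SS r v y z).trace) (𝓝[{v | GoodU r v}] u) (𝓝 (SS r u y z).trace) :=
    ((Continuous.matrix_trace (continuous_id (X := T2 n))).tendsto _).comp hc
  refine tendsto_nhds_unique_of_eventuallyEq (hc.const_smul ((n : ℂ) * n))
    (ht.smul (tendsto_const_nhds (x := (1 : T2 n)))) ?_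
  filter_upwards [self_mem_nhdsWithin] with v hv
  exact h.SS_scalar hv hy

theorem Sol.qybe (h : Sol r rc) {u : ℂ} (hu : u ≠ 0) : SatisfiesQYBE (fun y₁ y₂ => r u y₁ y₂) := by
  have hn : (n : ℂ) ≠ 0 := by exact_mod_cast h.n0
  refine h.qybe_of_scalar hu fun y z hy => ?_
  have e := h.SS_scalar_all (neg_ne_zero.2 hu) hy
  refine ⟨((n : ℂ) * n)⁻¹ * (SS r (-u) y z).trace, ?_⟩
  rw [mul_smul, ← e, smul_smul, inv_mul_cancel₀ (mul_ne_zero hn hn), one_smul, SS, neg_neg]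

end

/-- If `r` is a non-degenerate unitary solution of the AYBE, holomorphic on
`{v ≠ 0, y₁ ≠ y₂}`, of the form (*), meromorphic along the diagonal, and
`r̄₀ = (pr⊗pr)(r₀)` has no infinitesimal symmetries, then for every fixed `u ≠ 0` the
function `(y₁,y₂) ↦ r(u;y₁,y₂)` satisfies the quantum Yang–Baxter equation. -/
theorem aybe_to_qybe (n : ℕ) (hn : 2 ≤ n)
    (r : ℂ → ℂ → ℂ → T2 n) (rc : ℕ → ℂ → ℂ → T2 n)
    (hAYBE : IsAYBESolution r) (hUnit : IsUnitarySolution r) (hND : IsNonDegenerate r)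
    (hHolo : IsHolomorphicOnDomain r) (hForm : HasLaurentForm r rc)
    (hMero : IsMeromorphicAlongDiagonal r)
    (hNoSym : HasNoInfinitesimalSymmetry (fun y₁ y₂ => prTensorPr (rc 0 y₁ y₂))) :
    ∀ u : ℂ, u ≠ 0 → SatisfiesQYBE (fun y₁ y₂ => r u y₁ y₂) := by
  intro u hu
  have h : Sol r rc := ⟨by omega, hAYBE, hUnit, hND, hHolo, hForm, hMero⟩
  exact h.qybe hu
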